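/- Recurrence relations of the Griffiths polynomials of q-Racah type: for all nonnegative integers i, j, x, y with i+j ≤ N and x+y ≤ N, one has (i) λ(y;c₃c₀)·G_{i,j}(x,y) = Σ_{ε,ε'∈{−1,0,+1}} A^{ε,ε'}_{i+ε,j+ε'}(c₁,c₂,c₃,c₄;N)·G_{i+ε,j+ε'}(x,y), and (ii) λ(x;c₄c₂)·G_{i,j}(x,y) = Σ_{ε,ε'∈{−1,0,+1}} [ω_ε(q^{2i}c₂c₃c₄/c₁)/ω_{ε'}(q^{2j}c₀c₃c₄/c₁)]·A^{ε',ε}_{j+ε',i+ε}(c₁,c₀,c₄,c₃;N)·G_{i+ε,j+ε'}(x,y), where the superscripts of A are +, 0, − according as the shift is +1, 0, −1, G with a negative index or with indices summing to more than N is 0, and ω_n(c) = (−1)ⁿc^{n/2}q^{n(n+1)/2} is used also for n = ±1. (For the parameter list (c₁,c₀,c₄,c₃) the induced fifth parameter occurring in the definition of A equals c₂.) -/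

import Mathlib

noncomputable section
namespace qR

/-- q-Pochhammer symbol `(a;q)_k = ∏_{l<k} (1 - a qˡ)`. -/
def poch (q a : ℂ) (k : ℕ) : ℂ := ∏ l ∈ Finset.range k, (1 - a * q ^ l)

/-- q-binomial coefficient, zero outside `0 ≤ n ≤ N`. -/
def binom (q : ℂ) (N n : ℤ) : ℂ :=
  if 0 ≤ n ∧ n ≤ N then poch q q N.toNat / (poch q q n.toNat * poch q q (N - n).toNat) else 0

/-- Normalisation `Ω(n;c1,c2,c3;N)`; `s` and `t2` are the chosen square roots of `q` and `c2`,
so that `(q c2)^(n - N/2) = (s t2)^(2n - N)`. -/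
def Om (q s c1 c2 c3 t2 : ℂ) (N n : ℤ) : ℂ :=
  binom q N n * (1 - c2 * c3 * q ^ (2 * n + 1)) * poch q (q * c2) n.toNat
      * poch q (c1 * c2 * c3 * q ^ (N + 2)) n.toNat * poch q (q * c1) (N - n).toNat
    / ((s * t2) ^ (2 * n - N) * poch q (c2 * c3 * q ^ (n + 1)) (N + 1).toNat
        * poch q (q * c3) n.toNat)

/-- Normalised q-Racah polynomial `p_n(x;c1,c2,c3;N)`, with the convention that it
vanishes unless `0 ≤ n ≤ N` and `0 ≤ x ≤ N`. -/
def p (q s c1 c2 c3 t2 : ℂ) (N n x : ℤ) : ℂ :=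
  if 0 ≤ n ∧ n ≤ N ∧ 0 ≤ x ∧ x ≤ N then
    Om q s c1 c2 c3 t2 N n *
      ∑ k ∈ Finset.range (n.toNat + 1),
        poch q (q ^ (-n)) k * poch q (c2 * c3 * q ^ (n + 1)) k * poch q (q ^ (-x)) k
            * poch q (c1 * c2 * q ^ (x + 1)) k * q ^ k
          / (poch q (q * c2) k * poch q (c1 * c2 * c3 * q ^ (N + 2)) k
              * poch q (q ^ (-N)) k * poch q q k)
  else 0

/-- `ω_n(c) = (-1)^n c^{n/2} q^{n(n+1)/2}`, where `r` is the chosen square root of `c`. -/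
def om (q r : ℂ) (n : ℤ) : ℂ := (-1 : ℂ) ^ n * r ^ n * q ^ (n * (n + 1) / 2)

/-- `ξ_n(c1,c2) = ((qc1;q)_n/(qc2;q)_n) (c2/c1)^{n/2}`, where `t1, t2` are the chosen
square roots of `c1, c2`. -/
def xi (q c1 c2 t1 t2 : ℂ) (n : ℤ) : ℂ :=
  poch q (q * c1) n.toNat / poch q (q * c2) n.toNat * (t2 / t1) ^ n

/-- `λ(x;c) = -(1-q^{-x})(1-c q^{x+1})`. -/
def lam (q c : ℂ) (x : ℤ) : ℂ := -(1 - q ^ (-x)) * (1 - c * q ^ (x + 1))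

def PhiP (q c1 c2 c3 : ℂ) (N n : ℤ) : ℂ :=
  -c2 * q ^ (n - N) * (1 - q ^ n) * (1 - c1 * q ^ (N - n + 1)) * (1 - c2 * c3 * q ^ (n + N + 1))
      * (1 - c3 * q ^ n)
    / ((1 - c2 * c3 * q ^ (2 * n)) * (1 - c2 * c3 * q ^ (2 * n + 1)))

def PhiM (q c1 c2 c3 : ℂ) (N n : ℤ) : ℂ :=
  (1 - q ^ (n - N)) * (1 - c1 * c2 * c3 * q ^ (n + N + 2)) * (1 - c2 * q ^ (n + 1))
      * (1 - c2 * c3 * q ^ (n + 1))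
    / ((1 - c2 * c3 * q ^ (2 * n + 1)) * (1 - c2 * c3 * q ^ (2 * n + 2)))

/-- `Φ^ε(n;c1,c2,c3;N)`, where `ε = 1, -1, 0` selects `Φ⁺, Φ⁻, Φ⁰`. -/
def Phi (q c1 c2 c3 : ℂ) (N ε n : ℤ) : ℂ :=
  if ε = 1 then PhiP q c1 c2 c3 N n
  else if ε = -1 then PhiM q c1 c2 c3 N n
  else -PhiP q c1 c2 c3 N n - PhiM q c1 c2 c3 N n

/-- `λ₊(x;c1,c2,c3;N)`. -/
def lamP (q c1 c2 c3 : ℂ) (N x : ℤ) : ℂ :=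
  -(q ^ (-N - 1) / c3 - q ^ (-x)) * (1 - c1 * c2 * c3 * q ^ (N + x + 2))

/-- `λ₋(x;c1,c2,c3;N)`. -/
def lamM (q c1 c2 c3 : ℂ) (N x : ℤ) : ℂ :=
  -(q ^ (-N) - q ^ (-x)) * (1 - c1 * c2 * q ^ (N + x + 1))

def PhiPp (q sq c1 c2 c3 : ℂ) (N n : ℤ) : ℂ :=
  -sq * c2 * q ^ (2 * n - N - 1) * (1 - q ^ n) * (1 - c1 * q ^ (N - n + 1))
      * (1 - c1 * q ^ (N + 2 - n)) * (1 - c3 * q ^ n)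
    / ((1 - c2 * c3 * q ^ (2 * n)) * (1 - c2 * c3 * q ^ (2 * n + 1)))

def PhiPm (q sq c1 c2 c3 : ℂ) (N n : ℤ) : ℂ :=
  -((1 - c1 * c2 * c3 * q ^ (n + N + 2)) * (1 - c1 * c2 * c3 * q ^ (n + N + 3))
      * (1 - c2 * q ^ (n + 1)) * (1 - c2 * c3 * q ^ (n + 1)))
    / (c3 * q ^ (N + 1) * sq * (1 - c2 * c3 * q ^ (2 * n + 1)) * (1 - c2 * c3 * q ^ (2 * n + 2)))

def PhiP0 (q sq c1 c2 c3 : ℂ) (N n : ℤ) : ℂ :=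
  -PhiPp q sq c1 c2 c3 N n - PhiPm q sq c1 c2 c3 N n
    - (1 - c1 * c2 * q ^ (N + 2)) * (1 - c1 * c2 * c3 * q ^ (N + 2)) / (c3 * q ^ (N + 1) * sq)

def PhiMp (q sq c1 c2 c3 : ℂ) (N n : ℤ) : ℂ :=
  -sq * (1 - q ^ n) * (1 - c3 * q ^ n) * (1 - c2 * c3 * q ^ (n + N))
      * (1 - c2 * c3 * q ^ (n + N + 1))
    / (q ^ N * (1 - c2 * c3 * q ^ (2 * n)) * (1 - c2 * c3 * q ^ (2 * n + 1)))

def PhiMm (q sq c1 c2 c3 : ℂ) (N n : ℤ) : ℂ :=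
  -c3 * sq * q ^ N * (1 - q ^ (n - N)) * (1 - q ^ (n - N + 1)) * (1 - c2 * q ^ (n + 1))
      * (1 - c2 * c3 * q ^ (n + 1))
    / ((1 - c2 * c3 * q ^ (2 * n + 1)) * (1 - c2 * c3 * q ^ (2 * n + 2)))

def PhiM0 (q sq c1 c2 c3 : ℂ) (N n : ℤ) : ℂ :=
  -PhiMp q sq c1 c2 c3 N n - PhiMm q sq c1 c2 c3 N n - sq * (1 - c3 * q ^ N) * (q ^ (-N) - 1)

/-- Contiguity coefficient `Φ_σ^ε(n;c1,c2,c3;N)`, where `σ = 1` is the `+` and `σ = -1`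
the `-` family, `ε ∈ {1,0,-1}` selects the superscript, and `sq` is the chosen square
root of `q c2`. -/
def PhiC (q sq c1 c2 c3 : ℂ) (σ ε N n : ℤ) : ℂ :=
  if σ = 1 then
    if ε = 1 then PhiPp q sq c1 c2 c3 N n
    else if ε = -1 then PhiPm q sq c1 c2 c3 N n
    else PhiP0 q sq c1 c2 c3 N n
  else
    if ε = 1 then PhiMp q sq c1 c2 c3 N n
    else if ε = -1 then PhiMm q sq c1 c2 c3 N n
    else PhiM0 q sq c1 c2 c3 N n

def Fp (q c1 c2 : ℂ) (x : ℤ) : ℂ :=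
  c1 * c2 ^ 2 * q ^ (x + 1) * (1 - c1 * q ^ x) * (1 - q ^ x)
    / ((1 - c1 * c2 * q ^ (2 * x)) * (1 - c1 * c2 * q ^ (2 * x + 1)))

def Fm (q c1 c2 : ℂ) (x : ℤ) : ℂ :=
  c1 * c2 * q ^ (x + 1) * (1 - c2 * q ^ (x + 1)) * (1 - c1 * c2 * q ^ (x + 1))
    / ((1 - c1 * c2 * q ^ (2 * x + 1)) * (1 - c1 * c2 * q ^ (2 * x + 2)))

/-- The coefficients `A^{ε,ε'}_{i,j}(c1,c2,c3,c4;N)` for `(ε,ε') ≠ (0,0)`;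
`t2` is the chosen square root of `c2` and the fifth parameter
`c0 = (q^{2N+3} c1 c2 c3 c4)⁻¹` is computed internally. -/
def Aaux (q s c1 c2 c3 c4 t2 : ℂ) (N ε ε' i j : ℤ) : ℂ :=
  if ε' = 1 ∨ ε' = -1 then
    -c3 * q ^ (N + 1) *
        (if ε' = 1 then Fp q c4 ((q ^ (2 * N + 3) * c1 * c2 * c3 * c4)⁻¹) j
         else Fm q c4 ((q ^ (2 * N + 3) * c1 * c2 * c3 * c4)⁻¹) j) *
        PhiC q (s * t2) c1 c2 c3 ε' ε (N - j) i
  else if ε = 1 ∨ ε = -1 then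
    c3 * q ^ (N + 1) *
        (Fp q c4 ((q ^ (2 * N + 3) * c1 * c2 * c3 * c4)⁻¹) j
          + Fm q c4 ((q ^ (2 * N + 3) * c1 * c2 * c3 * c4)⁻¹) j) *
        Phi q c1 c2 c3 (N - j) ε i
  else 0

/-- The coefficients `A^{ε,ε'}_{i,j}(c1,c2,c3,c4;N)`. -/
def A (q s c1 c2 c3 c4 t2 : ℂ) (N ε ε' i j : ℤ) : ℂ :=
  if ε = 0 ∧ ε' = 0 then
    -((1 - c3 * q ^ (N + 1 - j)) * (s * t2) / (1 - c1 * c2 * q ^ (N + 2 - j)))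
          * ∑ e ∈ ({-1, 0, 1} : Finset ℤ), Aaux q s c1 c2 c3 c4 t2 N e 1 i j
      - (1 - c1 * c2 * q ^ (N + 1 - j)) / ((1 - c3 * q ^ (N - j)) * (s * t2))
          * ∑ e ∈ ({-1, 0, 1} : Finset ℤ), Aaux q s c1 c2 c3 c4 t2 N e (-1) i j
      - ∑ e ∈ ({-1, 1} : Finset ℤ), Aaux q s c1 c2 c3 c4 t2 N e 0 i j
  else Aaux q s c1 c2 c3 c4 t2 N ε ε' i j

/-- `Λ(x;c1,c2,c3,c4;N)`; `s, t1, t2, t3, t4` are the chosen square roots of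
`q, c1, c2, c3, c4`. -/
def Lam (q s c1 c2 c3 c4 t1 t2 t3 t4 : ℂ) (N x : ℤ) : ℂ :=
  (-1 : ℂ) ^ x * binom q N x * (1 - c1 * c2 * q ^ (2 * x + 1)) * poch q (q * c2) x.toNat
      * (s * t2) ^ N * (t1 * t3 / (t2 * t4)) ^ x * q ^ (x * (x - 1) / 2)
    / (poch q (q * c1) x.toNat * poch q (q ^ (x + 1) * c1 * c2) (N + 1).toNat)

/-- Tratnik polynomial of q-Racah type `T_{i,j}(x,y;c1,c2,c3,c4;N)`; the fifth parameter
`c0 = (q^{2N+3} c1 c2 c3 c4)⁻¹` and its square root `t0 = (s^{2N+3} t1 t2 t3 t4)⁻¹`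
are computed internally. -/
def T (q s c1 c2 c3 c4 t1 t2 t3 t4 : ℂ) (N i j x y : ℤ) : ℂ :=
  if 0 ≤ i ∧ 0 ≤ j ∧ i + j ≤ N then
    p q s c1 c2 c3 t2 (N - j) i x *
      p q s c3 ((q ^ (2 * N + 3) * c1 * c2 * c3 * c4)⁻¹) c4
        ((s ^ (2 * N + 3) * t1 * t2 * t3 * t4)⁻¹) (N - x) j y
  else 0

/-- Griffiths polynomial of q-Racah type `G_{i,j}(x,y;c1,c2,c3,c4;N)`; the fifth parameter
`c0 = (q^{2N+3} c1 c2 c3 c4)⁻¹` and its square root `t0 = (s^{2N+3} t1 t2 t3 t4)⁻¹`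
are computed internally. -/
def G (q s c1 c2 c3 c4 t1 t2 t3 t4 : ℂ) (N i j x y : ℤ) : ℂ :=
  if 0 ≤ i ∧ 0 ≤ j ∧ i + j ≤ N then
    ∑ a ∈ Finset.range ((min (N - j) (N - y)).toNat + 1),
      om q (t1 * t2 * t3 / t4) (a : ℤ) * p q s c1 c2 c3 t2 (N - j) i (a : ℤ) *
        p q s c3 ((q ^ (2 * N + 3) * c1 * c2 * c3 * c4)⁻¹) c4
          ((s ^ (2 * N + 3) * t1 * t2 * t3 * t4)⁻¹) (N - (a : ℤ)) j y *
        p q s c4 c2 c1 t2 (N - y) (a : ℤ) x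
  else 0

end qR

namespace qR
set_option linter.all false
set_option maxHeartbeats 1000000
set_option maxRecDepth 20000

theorem q3 (q a b X : ℂ) : 1 - a * b * (X * X) = 1 - a * b * X ^ 2 ∧ 1 - a * b * (X * X * q) = 1 - a * b * q * X ^ 2 ∧
    1 - a * b * (X * X * q ^ 2) = 1 - a * b * q ^ 2 * X ^ 2 := by refine ⟨?_, ?_, ?_⟩ <;> ring
theorem r3 (q a b X : ℂ) : 1 - a * b * (X * X) = 1 - b * a * X ^ 2 ∧ 1 - a * b * (X * X * q) = 1 - b * a * q * X ^ 2 ∧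
    1 - a * b * (X * X * q ^ 2) = 1 - b * a * q ^ 2 * X ^ 2 := by refine ⟨?_, ?_, ?_⟩ <;> ring
theorem pw {σ a : ℂ} (h : σ ^ 2 = a) : σ ^ 3 = σ * a ∧ σ ^ 4 = a ^ 2 := by subst h; constructor <;> ring
theorem po {a q : ℂ} (h : 1 - a * q ^ 1 ≠ 0) : 1 - a * q ≠ 0 := by rwa [pow_one] at h
theorem pk {q : ℂ} (h : 1 - q ^ 1 ≠ 0) : 1 - q ≠ 0 := by rwa [pow_one] at h
theorem m3 : (-1:ℂ)^(3:ℕ) = -1 ∧ (-1:ℂ)^(3:ℤ) = -1 ∧ (-1:ℂ)^(4:ℤ) = 1 ∧ (-1:ℂ)^(5:ℤ) = -1 := by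
  refine ⟨?_, ?_, ?_, ?_⟩ <;> norm_num [zpow_ofNat]

def cf (q c2 c3 d1 d2 z : ℂ) (k : ℕ) : ℂ :=
  poch q z⁻¹ k * poch q (c2 * c3 * q * z) k * q ^ k
    / (poch q (q * c2) k * poch q d1 k * poch q d2 k * poch q q k)

def ph (q g w : ℂ) (k : ℕ) : ℂ := poch q w⁻¹ k * poch q (g * q * w) k

def bb (q c2 c3 z : ℂ) : ℂ :=
  (1 - c2 * q * z) * (1 - c2 * c3 * q * z) / ((1 - c2 * c3 * q * z ^ 2) * (1 - c2 * c3 * q ^ 2 * z ^ 2))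

def dd (q c2 c3 z : ℂ) : ℂ :=
  (1 - z) * (1 - c3 * z) / ((1 - c2 * c3 * z ^ 2) * (1 - c2 * c3 * q * z ^ 2))

theorem poch_succ (q a : ℂ) (k : ℕ) : poch q a (k+1) = poch q a k * (1 - a * q ^ k) := by
  simp [poch, Finset.prod_range_succ]

theorem poch_zero (q a : ℂ) : poch q a 0 = 1 := by simp [poch]

theorem poch_succ' (q a : ℂ) (k : ℕ) : poch q a (k+1) = (1 - a) * poch q (a * q) k := by
  simp only [poch, Finset.prod_range_succ', pow_zero, mul_one]
  rw [mul_comm]; congr 1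
  apply Finset.prod_congr rfl; intro l _; ring

theorem ph_succ (q g w : ℂ) (hw : w ≠ 0) (k : ℕ) :
    ph q g w (k+1) = ph q g w k * ((1 - w⁻¹ * q ^ k) * (1 - g * q * w * q ^ k)) := by
  simp only [ph, poch_succ]; ring

/-- three facts on shifting `z`. -/
theorem cf_succ (q c2 c3 d1 d2 z : ℂ) (m : ℕ) :
    cf q c2 c3 d1 d2 z (m+1) = cf q c2 c3 d1 d2 z m *
      ((1 - z⁻¹ * q ^ m) * (1 - c2 * c3 * q * z * q ^ m) * q /
       ((1 - q * c2 * q ^ m) * (1 - d1 * q ^ m) * (1 - d2 * q ^ m) * (1 - q * q ^ m))) := by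
  simp only [cf, poch_succ, pow_succ, div_eq_mul_inv, mul_inv]; ring

theorem cf_up (q c2 c3 d1 d2 z : ℂ) (hq : q ≠ 0) (hz : z ≠ 0) (m : ℕ) :
    (1 - c2 * c3 * q * z) * cf q c2 c3 d1 d2 (q * z) (m+1) = cf q c2 c3 d1 d2 z m *
      ((1 - z⁻¹ * q⁻¹) * (1 - c2 * c3 * q * z * q ^ m) * (1 - c2 * c3 * q * z * q ^ (m+1)) * q /
       ((1 - q * c2 * q ^ m) * (1 - d1 * q ^ m) * (1 - d2 * q ^ m) * (1 - q * q ^ m))) := by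
  have h1 : poch q (q * z)⁻¹ (m+1) = (1 - z⁻¹ * q⁻¹) * poch q z⁻¹ m := by
    rw [poch_succ', mul_inv, show q⁻¹ * z⁻¹ * q = z⁻¹ by field_simp]; ring
  have h2 : (1 - c2 * c3 * q * z) * poch q (c2 * c3 * q * (q * z)) (m+1) =
      poch q (c2 * c3 * q * z) m * (1 - c2 * c3 * q * z * q ^ m) * (1 - c2 * c3 * q * z * q ^ (m+1)) := by
    rw [← poch_succ, ← poch_succ, poch_succ' q (c2 * c3 * q * z) (m+1)]
    congr 2; ring
  have : (1 - c2 * c3 * q * z) * cf q c2 c3 d1 d2 (q * z) (m+1) =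
      poch q (q * z)⁻¹ (m+1) * ((1 - c2 * c3 * q * z) * poch q (c2 * c3 * q * (q * z)) (m+1)) * q ^ (m+1)
    / (poch q (q * c2) (m+1) * poch q d1 (m+1) * poch q d2 (m+1) * poch q q (m+1)) := by
    simp only [cf]; ring
  rw [this, h1, h2]
  simp only [cf, poch_succ, pow_succ, div_eq_mul_inv, mul_inv]; ring

theorem cf_dn (q c2 c3 d1 d2 z : ℂ) (hq : q ≠ 0) (hz : z ≠ 0) (m : ℕ) :
    (1 - z⁻¹) * cf q c2 c3 d1 d2 (z / q) (m+1) = cf q c2 c3 d1 d2 z m *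
      ((1 - c2 * c3 * z) * (1 - z⁻¹ * q ^ m) * (1 - z⁻¹ * q ^ (m+1)) * q /
       ((1 - q * c2 * q ^ m) * (1 - d1 * q ^ m) * (1 - d2 * q ^ m) * (1 - q * q ^ m))) := by
  have h1 : poch q (c2 * c3 * q * (z / q)) (m+1) = (1 - c2 * c3 * z) * poch q (c2 * c3 * q * z) m := by
    rw [poch_succ', show c2 * c3 * q * (z / q) = c2 * c3 * z by field_simp]; congr 2; ring
  have h2 : (1 - z⁻¹) * poch q (z / q)⁻¹ (m+1) =
      poch q z⁻¹ m * (1 - z⁻¹ * q ^ m) * (1 - z⁻¹ * q ^ (m+1)) := by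
    rw [← poch_succ, ← poch_succ, poch_succ' q z⁻¹ (m+1)]
    congr 2; field_simp
  have : (1 - z⁻¹) * cf q c2 c3 d1 d2 (z / q) (m+1) =
      ((1 - z⁻¹) * poch q (z / q)⁻¹ (m+1)) * poch q (c2 * c3 * q * (z / q)) (m+1) * q ^ (m+1)
    / (poch q (q * c2) (m+1) * poch q d1 (m+1) * poch q d2 (m+1) * poch q q (m+1)) := by
    simp only [cf]; ring
  rw [this, h1, h2]
  simp only [cf, poch_succ, pow_succ, div_eq_mul_inv, mul_inv]; ring

theorem cf_zero (q c2 c3 d1 d2 z : ℂ) : cf q c2 c3 d1 d2 z 0 = 1 := by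
  simp [cf, poch_zero]

/-- coefficient recurrence. -/
theorem coefR (q g c2 c3 d1 d2 z : ℂ) (hq : q ≠ 0) (hz : z ≠ 0) (hc3 : c3 ≠ 0) (hc2 : c2 ≠ 0)
    (hg : g * c3 * q ^ 2 = d1 * d2)
    (e0 : 1 - c2 * c3 * z ^ 2 ≠ 0) (e1 : 1 - c2 * c3 * q * z ^ 2 ≠ 0)
    (e2 : 1 - c2 * c3 * q ^ 2 * z ^ 2 ≠ 0) (m : ℕ)
    (f1 : 1 - q * c2 * q ^ m ≠ 0) (f2 : 1 - d1 * q ^ m ≠ 0) (f3 : 1 - d2 * q ^ m ≠ 0)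
    (f4 : 1 - q * q ^ m ≠ 0) :
    (1 - q ^ (m+1)) * (1 - g * q ^ (m+2)) / q ^ (m+1) * cf q c2 c3 d1 d2 z (m+1)
      - cf q c2 c3 d1 d2 z m / q ^ m =
    bb q c2 c3 z * (1 - d1 * z) * (1 - d2 * z) * (cf q c2 c3 d1 d2 (q * z) (m+1) - cf q c2 c3 d1 d2 z (m+1))
    + dd q c2 c3 z * (d1 - c2 * c3 * q * z) * (d2 - c2 * c3 * q * z) / (c3 * q) *
       (cf q c2 c3 d1 d2 (z / q) (m+1) - cf q c2 c3 d1 d2 z (m+1)) := by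
  have hg' : g = d1 * d2 / (c3 * q ^ 2) := by field_simp; linear_combination hg
  have hu := cf_up q c2 c3 d1 d2 z hq hz m
  have hd := cf_dn q c2 c3 d1 d2 z hq hz m
  have hs := cf_succ q c2 c3 d1 d2 z m
  set P := cf q c2 c3 d1 d2 z m
  have hb : bb q c2 c3 z * (1 - d1 * z) * (1 - d2 * z) * (cf q c2 c3 d1 d2 (q * z) (m+1) - cf q c2 c3 d1 d2 z (m+1))
    = (1 - c2 * q * z) / ((1 - c2 * c3 * q * z ^ 2) * (1 - c2 * c3 * q ^ 2 * z ^ 2)) * (1 - d1 * z) * (1 - d2 * z) *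
      ((1 - c2 * c3 * q * z) * cf q c2 c3 d1 d2 (q * z) (m+1) - (1 - c2 * c3 * q * z) * cf q c2 c3 d1 d2 z (m+1)) := by
    simp only [bb]; ring
  have hz' : 1 - z = -z * (1 - z⁻¹) := by field_simp; ring
  have hd' : dd q c2 c3 z * (d1 - c2 * c3 * q * z) * (d2 - c2 * c3 * q * z) / (c3 * q) *
       (cf q c2 c3 d1 d2 (z / q) (m+1) - cf q c2 c3 d1 d2 z (m+1))
    = -z * (1 - c3 * z) / ((1 - c2 * c3 * z ^ 2) * (1 - c2 * c3 * q * z ^ 2)) * (d1 - c2 * c3 * q * z) * (d2 - c2 * c3 * q * z) / (c3 * q) *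
      ((1 - z⁻¹) * cf q c2 c3 d1 d2 (z / q) (m+1) - (1 - z⁻¹) * cf q c2 c3 d1 d2 z (m+1)) := by
    simp only [dd]; rw [hz']; ring
  rw [hb, hd', hu, hd, hs, hg']
  have hK : q ^ m ≠ 0 := pow_ne_zero _ hq
  clear hb hd' hu hd hs hg' hz' hg
  clear_value P
  rw [show q ^ (m + 2) = q ^ m * q ^ 2 from pow_add _ _ _] 
  rw [show q ^ (m + 1) = q ^ m * q from pow_succ _ _] 
  generalize q ^ m = K at *
  generalize h1 : 1 - q * c2 * K = X1 at *
  generalize h2 : 1 - d1 * K = X2 at *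
  generalize h3 : 1 - d2 * K = X3 at *
  generalize h4 : 1 - q * K = X4 at *
  generalize h5 : 1 - c2 * c3 * z ^ 2 = X5 at *
  generalize h6 : 1 - c2 * c3 * q * z ^ 2 = X6 at *
  generalize h7 : 1 - c2 * c3 * q ^ 2 * z ^ 2 = X7 at *
  field_simp
  subst h1 h2 h3 h4 h5 h6 h7
  ring

theorem poch_zero_left (q : ℂ) (k : ℕ) : poch q 0 k = 1 := by simp [poch]

theorem cf_eq (q c2 c3 d1 d2 z : ℂ) (k : ℕ) :
    cf q c2 c3 d1 d2 z k = cf q c2 c3 0 0 z k / (poch q d1 k * poch q d2 k) := by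
  simp only [cf, poch_zero_left, mul_one, div_eq_mul_inv, mul_inv]; ring

def kap (q d1 d2 : ℂ) : ℂ := (1 - d2 / q) / (1 - d1)

def psP (q c2 c3 d1 d2 z : ℂ) : ℂ :=
  kap q d1 d2 * (bb q c2 c3 z * (1 - d1 * z) * (1 - q * d1 * z))

def psM (q c2 c3 d1 d2 z : ℂ) : ℂ :=
  kap q d1 d2 * (dd q c2 c3 z * (d1 - c2 * c3 * q * z) * (d1 - c2 * c3 * z) / c3)

def ps0 (q g c2 c3 d1 d2 z : ℂ) : ℂ :=
  (1 - d2 / q) * (1 - g * q ^ 2 / d2) - psP q c2 c3 d1 d2 z - psM q c2 c3 d1 d2 z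

/-- coefficient form of the contiguity relation. -/
theorem coefC (q g c2 c3 d1 d2 z : ℂ) (hq : q ≠ 0) (hz : z ≠ 0) (hc3 : c3 ≠ 0) (hd2 : d2 ≠ 0)
    (hg : g * c3 * q ^ 2 = d1 * d2)
    (e0 : 1 - c2 * c3 * z ^ 2 ≠ 0) (e1 : 1 - c2 * c3 * q * z ^ 2 ≠ 0)
    (e2 : 1 - c2 * c3 * q ^ 2 * z ^ 2 ≠ 0) (m : ℕ)
    (f1 : 1 - q * c2 * q ^ m ≠ 0) (f2 : 1 - d1 * q ^ m ≠ 0) 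
    (f3 : 1 - d2 * q ^ m ≠ 0 ∨ poch q z⁻¹ (m+1) = 0)
    (f4 : 1 - q * q ^ m ≠ 0) (f5 : 1 - d1 * q ^ (m+1) ≠ 0) (f6 : 1 - d2 / q ≠ 0) (f7 : 1 - d1 ≠ 0)
    (p1 : poch q d1 m ≠ 0) (p2 : poch q d2 m ≠ 0) :
    ((q ^ (m+1))⁻¹ - d2 / q) * (1 - g * q ^ (m+3) / d2) * cf q c2 c3 d1 d2 z (m+1)
      - cf q c2 c3 d1 d2 z m / q ^ m =
    psP q c2 c3 d1 d2 z * cf q c2 c3 (q * d1) (d2 / q) (q * z) (m+1)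
    + ps0 q g c2 c3 d1 d2 z * cf q c2 c3 (q * d1) (d2 / q) z (m+1)
    + psM q c2 c3 d1 d2 z * cf q c2 c3 (q * d1) (d2 / q) (z / q) (m+1) := by
  have hg' : g = d1 * d2 / (c3 * q ^ 2) := by field_simp; linear_combination hg
  have hu := cf_up q c2 c3 0 0 z hq hz m
  have hd := cf_dn q c2 c3 0 0 z hq hz m
  have hs := cf_succ q c2 c3 0 0 z m
  have hK : q ^ m ≠ 0 := pow_ne_zero _ hq
  have t1 : poch q (q * d1) (m+1) = poch q d1 m * (1 - d1 * q ^ m) * (1 - d1 * q ^ (m+1)) / (1 - d1) := by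
    rw [eq_div_iff f7, ← poch_succ, ← poch_succ, poch_succ' q d1 (m+1), mul_comm q d1]; ring
  have t2 : poch q (d2 / q) (m+1) = (1 - d2 / q) * poch q d2 m := by
    rw [poch_succ', div_mul_cancel₀ _ hq]
  have a1 : ((q ^ (m+1))⁻¹ - d2 / q) * (1 - g * q ^ (m+3) / d2) * cf q c2 c3 d1 d2 z (m+1)
     = (q ^ (m+1))⁻¹ * (1 - g * q ^ (m+3) / d2) * cf q c2 c3 0 0 z (m+1) / 
        (poch q d1 m * (1 - d1 * q ^ m) * poch q d2 m) := by
    rcases f3 with f3 | f3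
    · rw [cf_eq, poch_succ, poch_succ]
      have : (q ^ (m+1))⁻¹ - d2 / q = (q ^ (m+1))⁻¹ * (1 - d2 * q ^ m) := by
        rw [pow_succ]; field_simp
      rw [this]
      generalize h3 : 1 - d2 * q ^ m = X3 at *
      field_simp
    · simp [cf, f3]
  have hz' : 1 - z = -z * (1 - z⁻¹) := by field_simp; ring
  have a2 : psP q c2 c3 d1 d2 z * cf q c2 c3 (q * d1) (d2 / q) (q * z) (m+1) =
     kap q d1 d2 * ((1 - c2 * q * z) / ((1 - c2 * c3 * q * z ^ 2) * (1 - c2 * c3 * q ^ 2 * z ^ 2)) * (1 - d1 * z) * (1 - q * d1 * z)) * ((1 - c2 * c3 * q * z) * cf q c2 c3 0 0 (q * z) (m+1)) /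
      (poch q (q * d1) (m+1) * poch q (d2 / q) (m+1)) := by
    rw [cf_eq]; simp only [psP, bb]; ring
  have a3 : psM q c2 c3 d1 d2 z * cf q c2 c3 (q * d1) (d2 / q) (z / q) (m+1) =
     kap q d1 d2 * (-z * (1 - c3 * z) / ((1 - c2 * c3 * z ^ 2) * (1 - c2 * c3 * q * z ^ 2)) * (d1 - c2 * c3 * q * z) * (d1 - c2 * c3 * z) / c3) * ((1 - z⁻¹) * cf q c2 c3 0 0 (z / q) (m+1)) /
      (poch q (q * d1) (m+1) * poch q (d2 / q) (m+1)) := by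
    rw [cf_eq]; simp only [psM, dd]; rw [hz']; ring
  rw [a1, a2, a3, hu, hd, cf_eq q c2 c3 d1 d2 z m, cf_eq q c2 c3 (q * d1) (d2 / q) z (m+1), hs, t1, t2]
  simp only [ps0, psP, psM, kap, bb, dd]
  rw [hg']
  generalize cf q c2 c3 0 0 z m = P
  generalize poch q d1 m = E1 at *
  generalize poch q d2 m = E2 at *
  clear a1 a2 a3 hu hd hs t1 t2 hg' hz' hg f3
  rw [show q ^ (m + 3) = q ^ m * q ^ 3 from pow_add _ _ _]
  rw [show q ^ (m + 1) = q ^ m * q from pow_succ _ _] at *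
  generalize q ^ m = K at *
  have f6' : 1 - d2 / q = (q - d2) / q := by field_simp
  have f8 : q - d2 ≠ 0 := by
    intro h; apply f6; rw [f6', h]; simp
  rw [f6']
  simp only [zero_mul, sub_zero, mul_one]
  generalize h1 : 1 - q * c2 * K = X1 at *
  generalize h2 : 1 - d1 * K = X2 at *
  generalize h3 : 1 - d1 * (K * q) = X3 at *
  generalize h4 : 1 - q * K = X4 at *
  generalize h5 : 1 - c2 * c3 * z ^ 2 = X5 at *
  generalize h6 : 1 - c2 * c3 * q * z ^ 2 = X6 at *
  generalize h7 : 1 - c2 * c3 * q ^ 2 * z ^ 2 = X7 at *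
  generalize h8 : 1 - d1 = X8 at *
  generalize h9 : q - d2 = X9 at *
  field_simp
  subst h1 h2 h3 h4 h5 h6 h7 h8 h9
  ring

def SS (q c1 c2 c3 d1 d2 z w : ℂ) (M : ℕ) : ℂ :=
  ∑ k ∈ Finset.range (M+1), cf q c2 c3 d1 d2 z k * ph q (c1 * c2) w k

theorem SS_dual (q c1 c2 c3 d1 d2 z w : ℂ) (M : ℕ) :
    SS q c1 c2 c3 d1 d2 z w M = SS q c3 c2 c1 d1 d2 w z M := by
  unfold SS
  apply Finset.sum_congr rfl; intro k _
  simp only [cf, ph, show c1 * c2 * q * w = c2 * c1 * q * w by ring,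
    show c3 * c2 * q * z = c2 * c3 * q * z by ring]
  ring

theorem cf_swap (q c2 c3 d1 d2 z : ℂ) (k : ℕ) : cf q c2 c3 d1 d2 z k = cf q c2 c3 d2 d1 z k := by
  simp only [cf]; congr 1; ring

theorem SS_swap (q c1 c2 c3 d1 d2 z w : ℂ) (M : ℕ) :
    SS q c1 c2 c3 d1 d2 z w M = SS q c1 c2 c3 d2 d1 z w M := by
  unfold SS
  apply Finset.sum_congr rfl; intro k _; rw [cf_swap]

theorem SR (q c1 c2 c3 d1 d2 z w : ℂ) (M : ℕ) (hq : q ≠ 0) (hz : z ≠ 0) (hw : w ≠ 0)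
    (hc3 : c3 ≠ 0) (hc2 : c2 ≠ 0)
    (hg : c1 * c2 * c3 * q ^ 2 = d1 * d2)
    (e0 : 1 - c2 * c3 * z ^ 2 ≠ 0) (e1 : 1 - c2 * c3 * q * z ^ 2 ≠ 0)
    (e2 : 1 - c2 * c3 * q ^ 2 * z ^ 2 ≠ 0)
    (f1 : ∀ m < M, 1 - q * c2 * q ^ m ≠ 0) (f2 : ∀ m < M, 1 - d1 * q ^ m ≠ 0)
    (f3 : ∀ m < M, 1 - d2 * q ^ m ≠ 0)
    (f4 : ∀ m < M, 1 - q * q ^ m ≠ 0)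
    (hend : cf q c2 c3 d1 d2 z M * ph q (c1 * c2) w (M+1) = 0) :
    (w⁻¹ - 1) * (1 - c1 * c2 * q * w) * SS q c1 c2 c3 d1 d2 z w M =
    bb q c2 c3 z * (1 - d1 * z) * (1 - d2 * z) * (SS q c1 c2 c3 d1 d2 (q * z) w M - SS q c1 c2 c3 d1 d2 z w M)
    + dd q c2 c3 z * (d1 - c2 * c3 * q * z) * (d2 - c2 * c3 * q * z) / (c3 * q) *
       (SS q c1 c2 c3 d1 d2 (z / q) w M - SS q c1 c2 c3 d1 d2 z w M) := by
  suffices h : ∀ L ≤ M, (w⁻¹ - 1) * (1 - c1 * c2 * q * w) * SS q c1 c2 c3 d1 d2 z w L =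
    bb q c2 c3 z * (1 - d1 * z) * (1 - d2 * z) * (SS q c1 c2 c3 d1 d2 (q * z) w L - SS q c1 c2 c3 d1 d2 z w L)
    + dd q c2 c3 z * (d1 - c2 * c3 * q * z) * (d2 - c2 * c3 * q * z) / (c3 * q) *
       (SS q c1 c2 c3 d1 d2 (z / q) w L - SS q c1 c2 c3 d1 d2 z w L)
    - (q ^ L)⁻¹ * (cf q c2 c3 d1 d2 z L * ph q (c1 * c2) w (L+1)) by
    rw [h M le_rfl, hend]; ring
  intro L
  induction L with
  | zero =>
    intro _
    simp only [SS, zero_add, Finset.sum_range_one, cf_zero, ph_succ _ _ _ hw]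
    simp [ph, poch_zero]
    ring
  | succ m ih =>
    intro hL
    have := ih (by omega)
    have hc := coefR q (c1 * c2) c2 c3 d1 d2 z hq hz hc3 hc2 (by linear_combination hg) e0 e1 e2 m
      (f1 m (by omega)) (f2 m (by omega)) (f3 m (by omega)) (f4 m (by omega))
    have hS : ∀ z, SS q c1 c2 c3 d1 d2 z w (m+1) = SS q c1 c2 c3 d1 d2 z w m
       + cf q c2 c3 d1 d2 z (m+1) * ph q (c1 * c2) w (m+1) := by
      intro z; unfold SS; rw [Finset.sum_range_succ _ (m+1)]
    have hK : q ^ (m+1) ≠ 0 := pow_ne_zero _ hq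
    have hl : (w⁻¹ - 1) * (1 - c1 * c2 * q * w) * ph q (c1 * c2) w (m+1) =
      (1 - q ^ (m+1)) * (1 - c1 * c2 * q ^ (m+2)) / q ^ (m+1) * ph q (c1 * c2) w (m+1) 
       - (q ^ (m+1))⁻¹ * ph q (c1 * c2) w (m+2) := by
      rw [ph_succ _ _ _ hw (m+1), show q ^ (m+2) = q ^ (m+1) * q from pow_succ _ _]
      generalize q ^ (m+1) = K at *
      field_simp; ring
    rw [hS, hS, hS]
    linear_combination this + ph q (c1 * c2) w (m+1) * hc + cf q c2 c3 d1 d2 z (m+1) * hl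

theorem SC (q c1 c2 c3 d1 d2 z w : ℂ) (M : ℕ) (hq : q ≠ 0) (hz : z ≠ 0) (hw : w ≠ 0)
    (hc3 : c3 ≠ 0) (hd2 : d2 ≠ 0)
    (hg : c1 * c2 * c3 * q ^ 2 = d1 * d2)
    (e0 : 1 - c2 * c3 * z ^ 2 ≠ 0) (e1 : 1 - c2 * c3 * q * z ^ 2 ≠ 0)
    (e2 : 1 - c2 * c3 * q ^ 2 * z ^ 2 ≠ 0)
    (f1 : ∀ m < M, 1 - q * c2 * q ^ m ≠ 0) (f2 : ∀ m < M + 1, 1 - d1 * q ^ m ≠ 0)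
    (f3 : ∀ m < M, 1 - d2 * q ^ m ≠ 0 ∨ (poch q z⁻¹ (m+1) = 0 ∧ m + 1 = M))
    (f4 : ∀ m < M, 1 - q * q ^ m ≠ 0) (f6 : 1 - d2 / q ≠ 0)
    (hend : cf q c2 c3 d1 d2 z M * ph q (c1 * c2) w (M+1) = 0) :
    (w⁻¹ - d2 / q) * (1 - c1 * c2 * q ^ 2 * w / d2) * SS q c1 c2 c3 d1 d2 z w M =
    psP q c2 c3 d1 d2 z * SS q c1 c2 c3 (q * d1) (d2 / q) (q * z) w M
    + ps0 q (c1 * c2) c2 c3 d1 d2 z * SS q c1 c2 c3 (q * d1) (d2 / q) z w M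
    + psM q c2 c3 d1 d2 z * SS q c1 c2 c3 (q * d1) (d2 / q) (z / q) w M := by
  suffices h : ∀ L ≤ M, (w⁻¹ - d2 / q) * (1 - c1 * c2 * q ^ 2 * w / d2) * SS q c1 c2 c3 d1 d2 z w L =
    psP q c2 c3 d1 d2 z * SS q c1 c2 c3 (q * d1) (d2 / q) (q * z) w L
    + ps0 q (c1 * c2) c2 c3 d1 d2 z * SS q c1 c2 c3 (q * d1) (d2 / q) z w L
    + psM q c2 c3 d1 d2 z * SS q c1 c2 c3 (q * d1) (d2 / q) (z / q) w L
    - (q ^ L)⁻¹ * (cf q c2 c3 d1 d2 z L * ph q (c1 * c2) w (L+1)) by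
    rw [h M le_rfl, hend]; ring
  have hp1 : ∀ m ≤ M, poch q d1 m ≠ 0 := by
    intro m hm
    exact Finset.prod_ne_zero_iff.2 fun l hl => f2 l (by have := Finset.mem_range.1 hl; omega)
  have hp2 : ∀ m < M, poch q d2 m ≠ 0 := by
    intro m hm
    refine Finset.prod_ne_zero_iff.2 fun l hl => ?_
    have := Finset.mem_range.1 hl
    rcases f3 l (by omega) with h | h
    · exact h
    · omega
  intro L
  induction L with
  | zero =>
    intro _
    simp only [SS, zero_add, Finset.sum_range_one, cf_zero, ph_succ _ _ _ hw, ps0]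
    simp [ph, poch_zero]
    field_simp
    ring
  | succ m ih =>
    intro hL
    have := ih (by omega)
    have hc := coefC q (c1 * c2) c2 c3 d1 d2 z hq hz hc3 hd2 (by linear_combination hg) e0 e1 e2 m
      (f1 m (by omega)) (f2 m (by omega)) ((f3 m (by omega)).imp id And.left) (f4 m (by omega))
      (f2 (m+1) (by omega)) f6 (by simpa using f2 0 (by omega)) (hp1 m (by omega)) (hp2 m (by omega))
    have hS : ∀ d1 d2 z, SS q c1 c2 c3 d1 d2 z w (m+1) = SS q c1 c2 c3 d1 d2 z w m
       + cf q c2 c3 d1 d2 z (m+1) * ph q (c1 * c2) w (m+1) := by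
      intro d1 d2 z; unfold SS; rw [Finset.sum_range_succ _ (m+1)]
    have hK : q ^ (m+1) ≠ 0 := pow_ne_zero _ hq
    have hl : (w⁻¹ - d2 / q) * (1 - c1 * c2 * q ^ 2 * w / d2) * ph q (c1 * c2) w (m+1) =
      ((q ^ (m+1))⁻¹ - d2 / q) * (1 - c1 * c2 * q ^ (m+3) / d2) * ph q (c1 * c2) w (m+1) 
       - (q ^ (m+1))⁻¹ * ph q (c1 * c2) w (m+2) := by
      rw [ph_succ _ _ _ hw (m+1), show q ^ (m+3) = q ^ (m+1) * q ^ 2 by ring]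
      generalize q ^ (m+1) = K at *
      field_simp; ring
    rw [hS, hS, hS, hS]
    linear_combination this + ph q (c1 * c2) w (m+1) * hc + cf q c2 c3 d1 d2 z (m+1) * hl

structure Gen (q s c1 c2 c3 t2 : ℂ) (T : ℕ) : Prop where
  hq : q ≠ 0
  hs : s ^ 2 = q
  ht : t2 ^ 2 = c2
  h1 : c1 ≠ 0
  h2 : c2 ≠ 0
  h3 : c3 ≠ 0
  hk : ∀ k : ℕ, 1 ≤ k → k ≤ T → 1 - q ^ k ≠ 0
  g1 : ∀ k : ℕ, k ≤ 2 * T + 5 → 1 - c1 * q ^ k ≠ 0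
  g2 : ∀ k : ℕ, k ≤ 2 * T + 5 → 1 - c2 * q ^ k ≠ 0
  g3 : ∀ k : ℕ, k ≤ 2 * T + 5 → 1 - c3 * q ^ k ≠ 0
  g12 : ∀ k : ℕ, k ≤ 2 * T + 5 → 1 - c1 * c2 * q ^ k ≠ 0
  g23 : ∀ k : ℕ, k ≤ 2 * T + 5 → 1 - c2 * c3 * q ^ k ≠ 0
  g123 : ∀ k : ℕ, k ≤ 2 * T + 5 → 1 - c1 * c2 * c3 * q ^ k ≠ 0

theorem Gen.symm {q s c1 c2 c3 t2 : ℂ} {T : ℕ} (h : Gen q s c1 c2 c3 t2 T) :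
    Gen q s c3 c2 c1 t2 T where
  hq := h.hq
  hs := h.hs
  ht := h.ht
  h1 := h.h3
  h2 := h.h2
  h3 := h.h1
  hk := h.hk
  g1 := h.g3
  g2 := h.g2
  g3 := h.g1
  g12 := fun k hk => by have := h.g23 k hk; rwa [mul_comm c3 c2]
  g23 := fun k hk => by have := h.g12 k hk; rwa [mul_comm c2 c1]
  g123 := fun k hk => by
    have := h.g123 k hk; rwa [show c3 * c2 * c1 = c1 * c2 * c3 by ring]

theorem poch_ne (q a : ℂ) (k : ℕ) (h : ∀ l < k, 1 - a * q ^ l ≠ 0) : poch q a k ≠ 0 :=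
  Finset.prod_ne_zero_iff.2 fun l hl => h l (Finset.mem_range.1 hl)

theorem Om_nat (q s c1 c2 c3 t2 : ℂ) (hq : q ≠ 0) (hst : s * t2 ≠ 0) (n r : ℕ) :
    Om q s c1 c2 c3 t2 ((n + r : ℕ) : ℤ) (n : ℤ) =
     poch q q (n+r) / (poch q q n * poch q q r) * (1 - c2 * c3 * q ^ (2 * n + 1)) * poch q (q * c2) n
      * poch q (c1 * c2 * c3 * q ^ (n + r + 2)) n * poch q (q * c1) r
    / ((s * t2) ^ n / (s * t2) ^ r * poch q (c2 * c3 * q ^ (n + 1)) (n + r + 1)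
        * poch q (q * c3) n) := by
  have e1 : ((n + r : ℕ) : ℤ).toNat = n + r := by omega
  have e2 : (((n + r : ℕ) : ℤ) - n).toNat = r := by simp
  have e3 : (((n + r : ℕ) : ℤ) + 1).toNat = n + r + 1 := by omega
  have e4 : (2 * (n:ℤ) - ((n + r : ℕ) : ℤ)) = n - r := by push_cast; ring
  have e5 : q ^ (2 * (n:ℤ) + 1) = q ^ (2 * n + 1) := by norm_cast
  have e6 : q ^ (((n + r : ℕ) : ℤ) + 2) = q ^ (n + r + 2) := by norm_cast
  have e7 : q ^ ((n:ℤ) + 1) = q ^ (n + 1) := by norm_cast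
  unfold Om binom
  rw [if_pos (by omega), e1, e2, e3, e4, e5, e6, e7, zpow_sub₀ hst, zpow_natCast, zpow_natCast,
    Int.toNat_natCast]

theorem Om_out (q s c1 c2 c3 t2 : ℂ) (N n : ℤ) (h : n < 0 ∨ N < n) :
    Om q s c1 c2 c3 t2 N n = 0 := by
  unfold Om binom
  rw [if_neg (by omega)]; simp

section
variable {q s c1 c2 c3 t2 : ℂ} {T : ℕ} (h : Gen q s c1 c2 c3 t2 T)
include h

theorem Gen.hst : s * t2 ≠ 0 := by
  have h1 := h.hq
  have h2 := h.h2
  rw [← h.hs] at h1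
  rw [← h.ht] at h2
  exact mul_ne_zero (by rintro rfl; simp at h1) (by rintro rfl; simp at h2)

theorem Gen.hst2 : 
    (s * t2) ^ 2 = q * c2 := by
  rw [mul_pow, h.hs, h.ht]

/-- ratio in `n`. -/
theorem Om_r (n r : ℕ) (hT : n + r + 1 ≤ T) :
    Om q s c1 c2 c3 t2 ((n + r + 1 : ℕ) : ℤ) ((n + 1 : ℕ) : ℤ) *
      ((1 - q ^ (n+1)) * (1 - c2 * c3 * q ^ (2 * n + 1)) * (1 - c1 * q ^ (r + 1)) * (q * c2) *
        (1 - c2 * c3 * q ^ (2 * n + r + 3)) * (1 - c3 * q ^ (n+1))) =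
    Om q s c1 c2 c3 t2 ((n + r + 1 : ℕ) : ℤ) (n : ℤ) *
      ((1 - q ^ (r+1)) * (1 - c2 * c3 * q ^ (2 * n + 3)) * (1 - c2 * q ^ (n+1)) * 
        (1 - c1 * c2 * c3 * q ^ (2 * n + r + 3)) * (1 - c2 * c3 * q ^ (n+1))) := by
  have hq := h.hq
  have hst := h.hst
  have A1 := Om_nat q s c1 c2 c3 t2 hq hst (n+1) r
  have A2 := Om_nat q s c1 c2 c3 t2 hq hst n (r+1)
  rw [show n + 1 + r = n + r + 1 by ring] at A1
  rw [show n + (r + 1) = n + r + 1 by ring] at A2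
  rw [A1, A2]
  have b1 : (1 - c2 * c3 * q ^ (n+1)) * poch q (c2 * c3 * q ^ (n + 1 + 1)) (n + r + 1 + 1) = 
     poch q (c2 * c3 * q ^ (n + 1)) (n + r + 1 + 1) * (1 - c2 * c3 * q ^ (2 * n + r + 3)) := by
    have := poch_succ' q (c2 * c3 * q ^ (n + 1)) (n + r + 1 + 1)
    rw [poch_succ] at this
    rw [show c2 * c3 * q ^ (n + 1 + 1) = c2 * c3 * q ^ (n + 1) * q by ring, ← this]
    ring
  have n1 : poch q (c2 * c3 * q ^ (n + 1 + 1)) (n + r + 1 + 1) ≠ 0 := poch_ne _ _ _ fun l hl => by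
    have := h.g23 (n+2+l) (by omega)
    convert this using 2; ring
  have n2 : poch q (c2 * c3 * q ^ (n + 1)) (n + r + 1 + 1) ≠ 0 := poch_ne _ _ _ fun l hl => by
    have := h.g23 (n+1+l) (by omega)
    convert this using 2; ring
  have n3 : poch q q n ≠ 0 := poch_ne _ _ _ fun l hl => by
    have := h.hk (l+1) (by omega) (by omega)
    convert this using 2; ring
  have n4 : poch q q r ≠ 0 := poch_ne _ _ _ fun l hl => by
    have := h.hk (l+1) (by omega) (by omega)
    convert this using 2; ring
  have n5 : poch q (q * c3) n ≠ 0 := poch_ne _ _ _ fun l hl => by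
    have := h.g3 (l+1) (by omega)
    convert this using 2; ring
  have m1 : 1 - q * q ^ n ≠ 0 := by have := h.hk (n+1) (by omega) (by omega); rwa [pow_succ'] at this
  have m2 : 1 - q * q ^ r ≠ 0 := by have := h.hk (r+1) (by omega) (by omega); rwa [pow_succ'] at this
  have m3 : 1 - q * c3 * q ^ n ≠ 0 := by have := h.g3 (n+1) (by omega); convert this using 2; ring
  have hst2 := h.hst2
  rw [poch_succ q q n, poch_succ q q r, poch_succ q (q * c2), poch_succ q (q * c3), poch_succ q (q * c1),
    poch_succ q (c1 * c2 * c3 * q ^ (n + r + 1 + 2)) n]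
  rw [pow_succ (s * t2) n, pow_succ (s * t2) r]
  generalize hP : poch q (c2 * c3 * q ^ (n + 1 + 1)) (n + r + 1 + 1) = P at *
  generalize hP : poch q (c2 * c3 * q ^ (n + 1)) (n + r + 1 + 1) = P' at *
  generalize s * t2 = σ at *
  have b1' : (1 - c2 * c3 * q ^ (2 * n + r + 3)) = (1 - c2 * c3 * q ^ (n+1)) * P / P' := by
    field_simp; linear_combination -b1
  rw [b1']
  rw [show (c1 * c2 * c3 * q ^ (n + r + 1 + 2) * q ^ n) = c1 * c2 * c3 * q ^ (2 * n + r + 3) by ring]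
  rw [show q ^ (n + 1) = q * q ^ n from pow_succ' _ _, show q ^ (r + 1) = q * q ^ r from pow_succ' _ _,
     show 2 * (n + 1) + 1 = 2 * n + 3 by ring]
  generalize q ^ (2 * n + r + 3) = B1 
  generalize hP : poch q (c1 * c2 * c3 * q ^ (n + r + 1 + 2)) n = B2
  have hn := pow_ne_zero n hst
  have hr := pow_ne_zero r hst
  generalize σ ^ n = sn at *
  generalize σ ^ r = sr at *
  generalize q ^ (2 * n + 3) = B3
  generalize q ^ (2 * n + 1) = B4
  generalize q ^ n = Z at *
  generalize q ^ r = R at *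
  generalize poch q (q * c2) n = q4
  generalize poch q (q * c1) r = q5
  generalize poch q q n = q1 at *
  generalize poch q q r = q2 at *
  generalize poch q (q * c3) n = q3 at *
  clear b1 b1' A1 A2 
  have h2 := h.h2
  rw [show 1 - q * c2 * Z = 1 - c2 * (q * Z) by ring]
  rw [show 1 - q * c1 * R = 1 - c1 * (q * R) by ring]
  rw [show 1 - q * c3 * Z = 1 - c3 * (q * Z) by ring] at *
  generalize 1 - c3 * (q * Z) = X1 at *
  generalize 1 - q * Z = X2 at *
  generalize 1 - q * R = X3 at *
  field_simp
  simp only [hst2]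
  ring

/-- ratio in `N`. -/
theorem Om_u (n r : ℕ) (hT : n + r + 1 ≤ T) :
    Om q s c1 c2 c3 t2 ((n + r + 1 : ℕ) : ℤ) (n : ℤ) *
      ((1 - q ^ (r+1)) * (1 - c1 * c2 * c3 * q ^ (n + r + 2)) * (1 - c2 * c3 * q ^ (2 * n + r + 2))) =
    Om q s c1 c2 c3 t2 ((n + r : ℕ) : ℤ) (n : ℤ) *
      ((1 - q ^ (n+r+1)) * (1 - c1 * c2 * c3 * q ^ (2 * n + r + 2)) * (1 - c1 * q ^ (r+1)) * (s * t2)) := by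
  have hq := h.hq
  have hst := h.hst
  have A1 := Om_nat q s c1 c2 c3 t2 hq hst n (r+1)
  have A2 := Om_nat q s c1 c2 c3 t2 hq hst n r
  rw [show n + (r + 1) = n + r + 1 by ring] at A1
  rw [A1, A2]
  have b1 : (1 - c1 * c2 * c3 * q ^ (n+r+2)) * poch q (c1 * c2 * c3 * q ^ (n + r + 1 + 2)) n = 
     poch q (c1 * c2 * c3 * q ^ (n + r + 2)) n * (1 - c1 * c2 * c3 * q ^ (2 * n + r + 2)) := by
    have := poch_succ' q (c1 * c2 * c3 * q ^ (n + r + 2)) n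
    rw [poch_succ] at this
    rw [show c1 * c2 * c3 * q ^ (n + r + 1 + 2) = c1 * c2 * c3 * q ^ (n + r + 2) * q by ring, ← this]
    ring
  have n2 : poch q (c2 * c3 * q ^ (n + 1)) (n + r + 1) ≠ 0 := poch_ne _ _ _ fun l hl => by
    have := h.g23 (n+1+l) (by omega)
    convert this using 2; ring
  have n1 : (1 - c2 * c3 * q ^ (2 * n + r + 2)) ≠ 0 := h.g23 _ (by omega)
  have n3 : poch q q n ≠ 0 := poch_ne _ _ _ fun l hl => by
    have := h.hk (l+1) (by omega) (by omega)
    convert this using 2; ring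
  have n4 : poch q q r ≠ 0 := poch_ne _ _ _ fun l hl => by
    have := h.hk (l+1) (by omega) (by omega)
    convert this using 2; ring
  have n5 : poch q (q * c3) n ≠ 0 := poch_ne _ _ _ fun l hl => by
    have := h.g3 (l+1) (by omega)
    convert this using 2; ring
  have n6 : (1 - c1 * c2 * c3 * q ^ (n + r + 2)) ≠ 0 := h.g123 _ (by omega)
  have m2 : 1 - q ^ (r+1) ≠ 0 := by have := h.hk (r+1) (by omega) (by omega); exact this
  rw [poch_succ q q r, poch_succ q (q * c1), poch_succ q q (n+r),
    poch_succ q (c2 * c3 * q ^ (n + 1)) (n + r + 1)]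
  rw [pow_succ (s * t2) r]
  generalize hP : poch q (c1 * c2 * c3 * q ^ (n + r + 1 + 2)) n = P at *
  generalize hP : poch q (c1 * c2 * c3 * q ^ (n + r + 2)) n = P' at *
  have b2 : P = P' * (1 - c1 * c2 * c3 * q ^ (2 * n + r + 2)) / (1 - c1 * c2 * c3 * q ^ (n+r+2)) := by
    field_simp; linear_combination b1
  rw [b2]
  rw [show c2 * c3 * q ^ (n + 1) * q ^ (n + r + 1) = c2 * c3 * q ^ (2 * n + r + 2) by ring,
    show q * q ^ r = q ^ (r + 1) from (pow_succ' _ _).symm,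
    show q * q ^ (n + r) = q ^ (n + r + 1) from (pow_succ' _ _).symm,
    show q * c1 * q ^ r = c1 * q ^ (r + 1) by ring]
  generalize poch q (c2 * c3 * q ^ (n + 1)) (n + r + 1) = P3 at *
  generalize s * t2 = σ at *
  have hn := pow_ne_zero n hst
  have hr := pow_ne_zero r hst
  generalize σ ^ n = sn at *
  generalize σ ^ r = sr at *
  generalize poch q (q * c2) n = q4
  generalize poch q (q * c1) r = q5
  generalize poch q q n = q1 at *
  generalize poch q q r = q2 at *
  generalize poch q (q * c3) n = q3 at *
  generalize 1 - c1 * c2 * c3 * q ^ (n + r + 2) = X1 at *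
  generalize 1 - c1 * c2 * c3 * q ^ (2 * n + r + 2) = X2 at *
  generalize 1 - c2 * c3 * q ^ (2 * n + r + 2) = X3 at *
  generalize 1 - q ^ (r + 1) = X4 at *
  clear b1 b2 A1 A2 
  field_simp

end

theorem z_ne {q : ℂ} (hq : q ≠ 0) (n : ℤ) : q ^ n ≠ 0 := zpow_ne_zero n hq

/-- atoms: nonvanishing with integer exponents -/
theorem g_int {q c : ℂ} {B : ℕ} (h : ∀ k : ℕ, k ≤ B → 1 - c * q ^ k ≠ 0) (k : ℤ) (h0 : 0 ≤ k) (h1 : k ≤ B) :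
    1 - c * q ^ k ≠ 0 := by
  lift k to ℕ using h0
  rw [zpow_natCast]; exact h k (by omega)

theorem Gen.hkz {q s c1 c2 c3 t2 : ℂ} {T : ℕ} (h : Gen q s c1 c2 c3 t2 T) (k : ℤ) (h0 : 1 ≤ k) (h1 : k ≤ T) :
    1 - q ^ k ≠ 0 := by
  lift k to ℕ using (by omega)
  rw [zpow_natCast]; exact h.hk k (by omega) (by omega)

theorem PhiM_eq {q : ℂ} (hq : q ≠ 0) (c1 c2 c3 : ℂ) (N n : ℤ) :
    PhiM q c1 c2 c3 N n = bb q c2 c3 (q ^ n) * (1 - c1 * c2 * c3 * q ^ (N + 2) * q ^ n) * (1 - q ^ (-N) * q ^ n) := by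
  simp only [PhiM, bb, two_mul, zpow_add₀ hq, zpow_sub₀ hq, zpow_neg, zpow_ofNat, pow_one]
  rw [div_mul_eq_mul_div, div_mul_eq_mul_div]
  congr 1 <;> ring

theorem PhiP_eq {q : ℂ} (hq : q ≠ 0) (c1 c2 c3 : ℂ) (h3 : c3 ≠ 0) (N n : ℤ) :
    PhiP q c1 c2 c3 N n = dd q c2 c3 (q ^ n) * (c1 * c2 * c3 * q ^ (N + 2) - c2 * c3 * q * q ^ n) *
      (q ^ (-N) - c2 * c3 * q * q ^ n) / (c3 * q) := by
  simp only [PhiP, dd, two_mul, zpow_add₀ hq, zpow_sub₀ hq, zpow_neg, zpow_ofNat, pow_one]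
  have := z_ne hq n
  have := z_ne hq N
  generalize q ^ n = Z at *
  generalize q ^ N = Q at *
  rw [show (1 - c2 * c3 * (Z * Z)) * (1 - c2 * c3 * (Z * Z * q)) = (1 - c2 * c3 * Z ^ 2) * (1 - c2 * c3 * q * Z ^ 2) by ring]
  generalize (1 - c2 * c3 * Z ^ 2) * (1 - c2 * c3 * q * Z ^ 2) = X
  rcases eq_or_ne X 0 with rfl | hX
  · simp
  · field_simp; ring

theorem Om_R {q s c1 c2 c3 t2 : ℂ} {T : ℕ} (h : Gen q s c1 c2 c3 t2 T) (N n : ℤ) (hN : N ≤ T)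
    (h0 : -1 ≤ n) (h1 : n ≤ N) :
    Om q s c1 c2 c3 t2 N (n+1) * PhiP q c1 c2 c3 N (n+1) = Om q s c1 c2 c3 t2 N n * PhiM q c1 c2 c3 N n := by
  rcases h0.eq_or_lt with h0 | h0
  · subst h0; rw [Om_out _ _ _ _ _ _ _ (-1) (by omega)]; simp [PhiP]
  rcases h1.eq_or_lt with h1 | h1
  · subst h1; rw [Om_out _ _ _ _ _ _ _ (n+1) (by omega)]; simp [PhiM]
  obtain ⟨n, rfl⟩ := Int.eq_ofNat_of_zero_le (by omega : 0 ≤ n)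
  obtain ⟨r, rfl⟩ : ∃ r : ℕ, N = ((n + r + 1 : ℕ) : ℤ) := ⟨(N - n - 1).toNat, by omega⟩
  have hr := Om_r h n r (by omega)
  have hq := h.hq
  have h2 := h.h2
  have h3 := h.h3
  have hz := z_ne hq n
  have hR := z_ne hq r
  have m2 : 1 - c2 * c3 * q ^ (2 * n + 1) ≠ 0 := h.g23 _ (by omega)
  have m6 : 1 - c2 * c3 * q ^ (2 * n + 2) ≠ 0 := h.g23 _ (by omega)
  have m7 : 1 - c2 * c3 * q ^ (2 * n + 3) ≠ 0 := h.g23 _ (by omega)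
  have k1 : PhiP q c1 c2 c3 ((n + r + 1 : ℕ) : ℤ) (n+1) = ((1 - q ^ (n+1)) * (1 - c2 * c3 * q ^ (2 * n + 1)) * (1 - c1 * q ^ (r + 1)) * (q * c2) *
        (1 - c2 * c3 * q ^ (2 * n + r + 3)) * (1 - c3 * q ^ (n+1))) * (-(q ^ (r+1))⁻¹ / ((1 - c2 * c3 * q ^ (2 * n + 1)) * (1 - c2 * c3 * q ^ (2 * n + 2)) * (1 - c2 * c3 * q ^ (2 * n + 3)))) := by
    have a1 : ((n:ℤ) + 1 - ((n + r + 1 : ℕ) : ℤ)) = -r := by push_cast; ring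
    have a2 : ((n + r + 1 : ℕ) : ℤ) - ((n:ℤ) + 1) + 1 = ((r + 1 : ℕ) : ℤ) := by push_cast; ring
    have a3 : (n:ℤ) + 1 + ((n + r + 1 : ℕ) : ℤ) + 1 = ((2 * n + r + 3 : ℕ) : ℤ) := by push_cast; ring
    have a4 : 2 * ((n:ℤ) + 1) = ((2 * n + 2 : ℕ) : ℤ) := by push_cast; ring
    have a5 : ((2 * n + 2 : ℕ) : ℤ) + 1 = ((2 * n + 3 : ℕ) : ℤ) := by push_cast; ring
    have a6 : ((n:ℤ) + 1) = ((n + 1 : ℕ) : ℤ) := by push_cast; ring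
    unfold PhiP
    rw [a1, a2, a3, a4, a5, a6, zpow_neg]
    simp only [zpow_natCast]
    rw [pow_succ q r]
    rw [zpow_natCast] at hR
    generalize 1 - c2 * c3 * q ^ (2 * n + 1) = X1 at *
    generalize 1 - c2 * c3 * q ^ (2 * n + 2) = X2 at *
    generalize 1 - c2 * c3 * q ^ (2 * n + 3) = X3 at *
    field_simp
  have k2 : PhiM q c1 c2 c3 ((n + r + 1 : ℕ) : ℤ) n = ((1 - q ^ (r+1)) * (1 - c2 * c3 * q ^ (2 * n + 3)) * (1 - c2 * q ^ (n+1)) * 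
        (1 - c1 * c2 * c3 * q ^ (2 * n + r + 3)) * (1 - c2 * c3 * q ^ (n+1))) * (-(q ^ (r+1))⁻¹ / ((1 - c2 * c3 * q ^ (2 * n + 1)) * (1 - c2 * c3 * q ^ (2 * n + 2)) * (1 - c2 * c3 * q ^ (2 * n + 3)))) := by
    have a1 : ((n:ℤ) - ((n + r + 1 : ℕ) : ℤ)) = -((r + 1 : ℕ) : ℤ) := by push_cast; ring
    have a3 : (n:ℤ) + ((n + r + 1 : ℕ) : ℤ) + 2 = ((2 * n + r + 3 : ℕ) : ℤ) := by push_cast; ring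
    have a4 : 2 * (n:ℤ) + 1 = ((2 * n + 1 : ℕ) : ℤ) := by push_cast; ring
    have a5 : 2 * (n:ℤ) + 2 = ((2 * n + 2 : ℕ) : ℤ) := by push_cast; ring
    have a6 : ((n:ℤ) + 1) = ((n + 1 : ℕ) : ℤ) := by push_cast; ring
    unfold PhiM
    rw [a1, a3, a4, a5, a6, zpow_neg]
    simp only [zpow_natCast]
    have hR' : q ^ (r+1) ≠ 0 := pow_ne_zero _ hq
    generalize q ^ (r+1) = R at *
    generalize 1 - c2 * c3 * q ^ (2 * n + 1) = X1 at *
    generalize 1 - c2 * c3 * q ^ (2 * n + 2) = X2 at *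
    generalize 1 - c2 * c3 * q ^ (2 * n + 3) = X3 at *
    field_simp
    ring
  rw [k1, k2]
  rw [show ((n:ℤ) + 1) = ((n + 1 : ℕ) : ℤ) by push_cast; ring]
  linear_combination (-(q ^ (r+1))⁻¹ / ((1 - c2 * c3 * q ^ (2 * n + 1)) * (1 - c2 * c3 * q ^ (2 * n + 2)) * (1 - c2 * c3 * q ^ (2 * n + 3)))) * hr

theorem poch_q_zero {q : ℂ} (hq : q ≠ 0) (x : ℤ) (k : ℕ) (h0 : 0 ≤ x) (h1 : x < k) :
    poch q (q ^ x)⁻¹ k = 0 := by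
  lift x to ℕ using h0
  refine Finset.prod_eq_zero (i := x) (Finset.mem_range.2 (by omega)) ?_
  rw [zpow_natCast, inv_mul_cancel₀ (pow_ne_zero _ hq), sub_self]

theorem p_out (q s c1 c2 c3 t2 : ℂ) (N n x : ℤ) (h : n < 0 ∨ N < n ∨ x < 0 ∨ N < x) :
    p q s c1 c2 c3 t2 N n x = 0 := by
  unfold p; rw [if_neg (by omega)]

theorem p_eq (q s c1 c2 c3 t2 : ℂ) (hq : q ≠ 0) (N n x : ℤ) (h0 : 0 ≤ x) (h1 : x ≤ N) (M : ℕ)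
    (hM : N ≤ M) :
    p q s c1 c2 c3 t2 N n x = Om q s c1 c2 c3 t2 N n *
      SS q c1 c2 c3 (c1 * c2 * c3 * q ^ (N + 2)) (q ^ (-N)) (q ^ n) (q ^ x) M := by
  by_cases hn : 0 ≤ n ∧ n ≤ N
  · unfold p SS
    rw [if_pos (by omega)]
    congr 1
    rw [← Finset.sum_subset (s₁ := Finset.range (n.toNat + 1)) (s₂ := Finset.range (M + 1))
      (f := fun k => cf q c2 c3 (c1 * c2 * c3 * q ^ (N + 2)) (q ^ (-N)) (q ^ n) k * ph q (c1 * c2) (q ^ x) k)]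
    · apply Finset.sum_congr rfl
      intro k _
      simp only [cf, ph, zpow_neg]
      rw [zpow_add₀ hq, zpow_add₀ hq, zpow_one]
      rw [show c2 * c3 * (q ^ n * q) = c2 * c3 * q * q ^ n by ring,
        show c1 * c2 * (q ^ x * q) = c1 * c2 * q * q ^ x by ring]
      ring
    · intro k hk
      simp only [Finset.mem_range] at *; omega
    · intro k _ hk
      simp only [Finset.mem_range] at hk
      simp only [cf]; rw [poch_q_zero hq n k hn.1 (by omega)]; simp
  · rw [p_out _ _ _ _ _ _ _ _ _ (by omega), Om_out _ _ _ _ _ _ _ _ (by omega)]; simp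

theorem lam_eq {q : ℂ} (hq : q ≠ 0) (c : ℂ) (x : ℤ) : lam q c x = ((q ^ x)⁻¹ - 1) * (1 - c * q * q ^ x) := by
  unfold lam; rw [zpow_neg, zpow_add₀ hq, zpow_one]; ring

section
variable {q s c1 c2 c3 t2 : ℂ} {T : ℕ} (h : Gen q s c1 c2 c3 t2 T)
include h

theorem Gen.f1 (m : ℕ) (hm : m ≤ T) :
    1 - q * c2 * q ^ m ≠ 0 := by
  have := h.g2 (m+1) (by omega)
  convert this using 2; ring
theorem Gen.f4 (m : ℕ) (hm : m < T) :
    1 - q * q ^ m ≠ 0 := by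
  have := h.hk (m+1) (by omega) (by omega)
  convert this using 2; ring
theorem Gen.f3 (N : ℤ) (m : ℕ) (hm : m < N) (hN : N ≤ T) :
    1 - q ^ (-N) * q ^ m ≠ 0 := by
  have := h.hkz (N - m) (by omega) (by omega)
  intro h'
  apply this
  have h2 : q ^ (-N) * q ^ m = 1 := by linear_combination -h'
  rw [← zpow_natCast, ← zpow_add₀ h.hq] at h2
  have : q ^ (N - m) = (q ^ (-N + m))⁻¹ := by rw [← zpow_neg]; congr 1; ring
  rw [this, h2]; simp
theorem Gen.f2 (N : ℤ) (m : ℕ) (h0 : 0 ≤ N) (hm : N + 2 + m ≤ 2 * T + 5) :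
    1 - c1 * c2 * c3 * q ^ (N + 2) * q ^ m ≠ 0 := by
  have := g_int h.g123 (N + 2 + m) (by omega) (by omega)
  rwa [zpow_add₀ h.hq, zpow_natCast, ← mul_assoc] at this
theorem Gen.e0 (n : ℤ) (h0 : 0 ≤ n) (h1 : 2 * n ≤ 2 * T + 5) :
    1 - c2 * c3 * (q ^ n) ^ 2 ≠ 0 := by
  have := g_int h.g23 (2 * n) (by omega) (by omega)
  rwa [two_mul, zpow_add₀ h.hq, ← sq] at this
theorem Gen.e1 (n : ℤ) (h0 : 0 ≤ n) (h1 : 2 * n + 1 ≤ 2 * T + 5) :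
    1 - c2 * c3 * q * (q ^ n) ^ 2 ≠ 0 := by
  have := g_int h.g23 (2 * n + 1) (by omega) (by omega)
  rw [two_mul, zpow_add₀ h.hq, zpow_add₀ h.hq, ← sq, zpow_one] at this
  convert this using 2; ring
theorem Gen.e2 (n : ℤ) (h0 : 0 ≤ n) (h1 : 2 * n + 2 ≤ 2 * T + 5) :
    1 - c2 * c3 * q ^ 2 * (q ^ n) ^ 2 ≠ 0 := by
  have := g_int h.g23 (2 * n + 2) (by omega) (by omega)
  rw [two_mul, zpow_add₀ h.hq, zpow_add₀ h.hq, ← sq, zpow_ofNat] at this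
  convert this using 2; ring
end

theorem hgg {q : ℂ} (hq : q ≠ 0) (c1 c2 c3 : ℂ) (N : ℤ) : c1 * c2 * c3 * q ^ 2 = c1 * c2 * c3 * q ^ (N + 2) * q ^ (-N) := by
  rw [mul_assoc _ (q ^ (N+2)), ← zpow_add₀ hq, show N + 2 + -N = 2 by ring, zpow_ofNat]

section
variable {q s c1 c2 c3 t2 : ℂ} {T : ℕ} (h : Gen q s c1 c2 c3 t2 T)
include h

theorem Rp (N n x : ℤ) (hN : N ≤ T)
    (h0 : 0 ≤ n) (h1 : n ≤ N) :
    lam q (c1 * c2) x * p q s c1 c2 c3 t2 N n x =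
      PhiP q c1 c2 c3 N (n+1) * p q s c1 c2 c3 t2 N (n+1) x
      + (-PhiP q c1 c2 c3 N n - PhiM q c1 c2 c3 N n) * p q s c1 c2 c3 t2 N n x
      + PhiM q c1 c2 c3 N (n-1) * p q s c1 c2 c3 t2 N (n-1) x := by
  by_cases hx : 0 ≤ x ∧ x ≤ N
  swap
  · rw [p_out _ _ _ _ _ _ _ n _ (by omega), p_out _ _ _ _ _ _ _ (n+1) _ (by omega),
      p_out _ _ _ _ _ _ _ (n-1) _ (by omega)]; ring
  have hq := h.hq
  have := SR q c1 c2 c3 (c1 * c2 * c3 * q ^ (N + 2)) (q ^ (-N)) (q ^ n) (q ^ x) N.toNat hq (z_ne hq n) (z_ne hq x)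
    h.h3 h.h2 (hgg hq _ _ _ N) (h.e0 n h0 (by omega)) (h.e1 n h0 (by omega)) (h.e2 n h0 (by omega))
    (fun m hm => h.f1 m (by omega)) (fun m hm => h.f2 N m (by omega) (by omega))
    (fun m hm => h.f3 N m (by omega) (by omega)) (fun m hm => h.f4 m (by omega))
    (by rw [ph, poch_q_zero hq x _ hx.1 (by omega)]; ring)
  rw [← PhiM_eq hq, ← PhiP_eq hq _ _ _ h.h3, ← lam_eq hq, show q * q ^ n = q ^ (n+1) by rw [zpow_add_one₀ hq, mul_comm],
    show q ^ n / q = q ^ (n-1) by rw [zpow_sub_one₀ hq]; rfl] at this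
  have P := fun n => p_eq q s c1 c2 c3 t2 hq N n x hx.1 hx.2 N.toNat (by omega)
  rw [P, P, P]
  have o1 := Om_R h N n hN (by omega) h1
  have o2 := Om_R h N (n-1) hN (by omega) (by omega)
  rw [sub_add_cancel] at o2
  generalize SS q c1 c2 c3 (c1 * c2 * c3 * q ^ (N + 2)) (q ^ (-N)) (q ^ (n+1)) (q ^ x) N.toNat = S1 at *
  generalize SS q c1 c2 c3 (c1 * c2 * c3 * q ^ (N + 2)) (q ^ (-N)) (q ^ (n-1)) (q ^ x) N.toNat = S2 at *
  linear_combination Om q s c1 c2 c3 t2 N n * this - S1 * o1 + S2 * o2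

theorem Dp (N n x : ℤ) (hN : N ≤ T)
    (h0 : 0 ≤ x) (h1 : x ≤ N) :
    lam q (c3 * c2) n * p q s c1 c2 c3 t2 N n x =
      PhiM q c3 c2 c1 N x * (p q s c1 c2 c3 t2 N n (x+1) - p q s c1 c2 c3 t2 N n x)
      + PhiP q c3 c2 c1 N x * (p q s c1 c2 c3 t2 N n (x-1) - p q s c1 c2 c3 t2 N n x) := by
  by_cases hx : 0 ≤ n ∧ n ≤ N
  swap
  · rw [p_out _ _ _ _ _ _ _ n _ (by omega), p_out _ _ _ _ _ _ _ n (x+1) (by omega),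
      p_out _ _ _ _ _ _ _ n (x-1) (by omega)]; ring
  have hq := h.hq
  have g := h.symm
  have := SR q c3 c2 c1 (c3 * c2 * c1 * q ^ (N + 2)) (q ^ (-N)) (q ^ x) (q ^ n) N.toNat hq (z_ne hq x) (z_ne hq n)
    g.h3 g.h2 (hgg hq _ _ _ N) (g.e0 x h0 (by omega)) (g.e1 x h0 (by omega)) (g.e2 x h0 (by omega))
    (fun m hm => g.f1 m (by omega)) (fun m hm => g.f2 N m (by omega) (by omega))
    (fun m hm => g.f3 N m (by omega) (by omega)) (fun m hm => g.f4 m (by omega))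
    (by rw [ph, poch_q_zero hq n _ hx.1 (by omega)]; ring)
  rw [← PhiM_eq hq, ← PhiP_eq hq _ _ _ h.h1, ← lam_eq hq, show q * q ^ x = q ^ (x+1) by rw [zpow_add_one₀ hq, mul_comm],
    show q ^ x / q = q ^ (x-1) by rw [zpow_sub_one₀ hq]; rfl, show c3 * c2 * c1 = c1 * c2 * c3 by ring] at this
  simp only [SS_dual q c3 c2 c1] at this
  have P := fun x h0 h1 => p_eq q s c1 c2 c3 t2 hq N n x h0 h1 N.toNat (by omega)
  have P0 := P x h0 h1
  have P1 : PhiM q c3 c2 c1 N x * p q s c1 c2 c3 t2 N n (x+1) = PhiM q c3 c2 c1 N x * (Om q s c1 c2 c3 t2 N n *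
      SS q c1 c2 c3 (c1 * c2 * c3 * q ^ (N + 2)) (q ^ (-N)) (q ^ n) (q ^ (x+1)) N.toNat) := by
    rcases h1.eq_or_lt with h1 | h1
    · subst h1; simp [PhiM]
    · rw [P (x+1) (by omega) (by omega)]
  have P2 : PhiP q c3 c2 c1 N x * p q s c1 c2 c3 t2 N n (x-1) = PhiP q c3 c2 c1 N x * (Om q s c1 c2 c3 t2 N n *
      SS q c1 c2 c3 (c1 * c2 * c3 * q ^ (N + 2)) (q ^ (-N)) (q ^ n) (q ^ (x-1)) N.toNat) := by
    rcases h0.eq_or_lt with h0 | h0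
    · subst h0; simp [PhiP]
    · rw [P (x-1) (by omega) (by omega)]
  rw [mul_sub, mul_sub, P1, P2, P0]
  linear_combination Om q s c1 c2 c3 t2 N n * this

end

theorem zp (q : ℂ) (hq : q ≠ 0) (n : ℤ) : q ^ (n+1) = q ^ n * q := zpow_add_one₀ hq n
theorem zm (q : ℂ) (hq : q ≠ 0) (n : ℤ) : q ^ (n-1) = q ^ n / q := by rw [zpow_sub_one₀ hq]; rfl

section
variable {q s c1 c2 c3 t2 : ℂ} {T : ℕ} (h : Gen q s c1 c2 c3 t2 T)
include h

theorem OmU (N n : ℤ) (hN : N + 1 ≤ T)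
    (h0 : 0 ≤ n) (h1 : n ≤ N) :
    Om q s c1 c2 c3 t2 (N+1) n * ((1 - q ^ N * q / q ^ n) * (1 - c1 * c2 * c3 * q ^ N * q ^ 2) * (1 - c2 * c3 * q ^ n * q ^ N * q ^ 2)) =
    Om q s c1 c2 c3 t2 N n * ((1 - q ^ N * q) * (1 - c1 * c2 * c3 * q ^ n * q ^ N * q ^ 2) * (1 - c1 * q ^ N * q / q ^ n) * (s * t2)) := by
  obtain ⟨n, rfl⟩ := Int.eq_ofNat_of_zero_le h0
  obtain ⟨r, rfl⟩ : ∃ r : ℕ, N = ((n + r : ℕ) : ℤ) := ⟨(N - n).toNat, by omega⟩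
  have := Om_u h n r (by omega)
  have hz := pow_ne_zero n h.hq
  rw [show (((n + r : ℕ) : ℤ) + 1) = ((n + r + 1 : ℕ) : ℤ) by push_cast; ring]
  simp only [zpow_natCast]
  have e : q ^ (n + r) * q / q ^ n = q ^ (r+1) := by field_simp; ring
  rw [show c1 * q ^ (n + r) * q / q ^ n = c1 * (q ^ (n + r) * q / q ^ n) by ring, e]
  convert this using 3
  · ring
  · ring
  · congr 1; ring

/-- the nonvanishing of U, V -/
theorem Gen.U1 (N n : ℤ) (hN : N + 1 ≤ T)
    (h0 : 0 ≤ n) (h1 : n ≤ N) : 1 - q ^ N * q / q ^ n ≠ 0 ∧ 1 - c1 * c2 * c3 * q ^ N * q ^ 2 ≠ 0 ∧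
      1 - c2 * c3 * q ^ n * q ^ N * q ^ 2 ≠ 0 ∧ 1 - q ^ N * q ≠ 0 ∧ 
      1 - c1 * c2 * c3 * q ^ n * q ^ N * q ^ 2 ≠ 0 ∧ 1 - c1 * q ^ N * q / q ^ n ≠ 0 := by
  have hq := h.hq
  have hz := z_ne hq n
  refine ⟨?_, ?_, ?_, ?_, ?_, ?_⟩
  · have := h.hkz (N - n + 1) (by omega) (by omega)
    rw [zpow_add_one₀ hq, zpow_sub₀ hq] at this
    convert this using 2; ring
  · have := g_int h.g123 (N + 2) (by omega) (by omega)
    rw [zpow_add₀ hq, zpow_ofNat] at this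
    convert this using 2; ring
  · have := g_int h.g23 (n + N + 2) (by omega) (by omega)
    rw [zpow_add₀ hq, zpow_add₀ hq, zpow_ofNat] at this
    convert this using 2; ring
  · have := h.hkz (N + 1) (by omega) (by omega)
    rwa [zpow_add_one₀ hq] at this
  · have := g_int h.g123 (n + N + 2) (by omega) (by omega)
    rw [zpow_add₀ hq, zpow_add₀ hq, zpow_ofNat] at this
    convert this using 2; ring
  · have := g_int h.g1 (N - n + 1) (by omega) (by omega)
    rw [zpow_add_one₀ hq, zpow_sub₀ hq] at this
    convert this using 2; ring

theorem CMkP (N n : ℤ) (hN : N + 1 ≤ T)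
    (h0 : 0 ≤ n) (h1 : n ≤ N) :
    Om q s c1 c2 c3 t2 (N+1) (n+1) * PhiMp q (s * t2) c1 c2 c3 (N+1) (n+1) = Om q s c1 c2 c3 t2 N n *
      psP q c2 c3 (c1 * c2 * c3 * q ^ (N+2)) (q ^ (-N)) (q ^ n) := by
  have hq := h.hq
  have hz := z_ne hq n
  have hQ := z_ne hq N
  have c2n := h.h2
  have hst := h.hst
  have hst2 := h.hst2
  obtain ⟨a1, a2, a3, a4, a5, a6⟩ := h.U1 N n hN h0 h1
  have hU := OmU h N n hN h0 h1
  have hR := Om_R h (N+1) n hN (by omega) (by omega)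
  have e1 : PhiMp q (s * t2) c1 c2 c3 (N+1) (n+1) * (c2 * q ^ n * q * (1 - c1 * q ^ N * q / q ^ n)) =
    PhiP q c1 c2 c3 (N+1) (n+1) * (s * t2 * (1 - c2 * c3 * q ^ n * q ^ N * q ^ 2)) := by
    simp only [PhiMp, PhiP, two_mul, zpow_add₀ hq, zpow_sub₀ hq, zpow_neg, zpow_ofNat, pow_one]
    generalize s * t2 = σ at *
    generalize q ^ n = Z at *
    generalize q ^ N = Q at *
    generalize 1 - c2 * c3 * (Z * q * (Z * q) * q) = X1
    generalize 1 - c2 * c3 * (Z * q * (Z * q)) = X2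
    rcases eq_or_ne X1 0 with rfl | hX
    · simp
    rcases eq_or_ne X2 0 with rfl | hX
    · simp
    field_simp
  have e2 : psP q c2 c3 (c1 * c2 * c3 * q ^ (N+2)) (q ^ (-N)) (q ^ n) * 
     ((1 - q ^ N * q / q ^ n) * (1 - c1 * c2 * c3 * q ^ N * q ^ 2)) = PhiM q c1 c2 c3 (N+1) n * ((1 - q ^ N * q) * (1 - c1 * c2 * c3 * q ^ n * q ^ N * q ^ 2) / q ^ n) := by
    rw [PhiM_eq hq]
    simp only [psP, kap, two_mul, neg_add, zpow_add₀ hq, zpow_sub₀ hq, zpow_neg, zpow_ofNat, pow_one]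
    generalize bb q c2 c3 (q ^ n) = B
    generalize q ^ n = Z at *
    generalize q ^ N = Q at *
    rw [show 1 - c1 * c2 * c3 * (Q * q ^ 2) = 1 - c1 * c2 * c3 * Q * q ^ 2 by ring]
    generalize h1 : 1 - c1 * c2 * c3 * Q * q ^ 2 = X at *
    field_simp
    ring
  have n1 : c2 * q ^ n * q * (1 - c1 * q ^ N * q / q ^ n) ≠ 0 := by positivity
  have n2 : ((1 - q ^ N * q / q ^ n) * (1 - c1 * c2 * c3 * q ^ N * q ^ 2)) ≠ 0 := by positivity
  apply mul_right_cancel₀ (mul_ne_zero (mul_ne_zero n1 n2) a3)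
  generalize Om q s c1 c2 c3 t2 (N+1) (n+1) = O1 at *
  generalize Om q s c1 c2 c3 t2 (N+1) n = O2 at *
  generalize Om q s c1 c2 c3 t2 N n = O3 at *
  generalize PhiMp q (s * t2) c1 c2 c3 (N+1) (n+1) = A1 at *
  generalize PhiP q c1 c2 c3 (N+1) (n+1) = A2 at *
  generalize psP q c2 c3 (c1 * c2 * c3 * q ^ (N+2)) (q ^ (-N)) (q ^ n) = A3 at *
  generalize PhiM q c1 c2 c3 (N+1) n = A4 at *
  generalize s * t2 = σ at *
  generalize 1 - c2 * c3 * q ^ n * q ^ N * q ^ 2 = W3 at *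
  generalize 1 - q ^ N * q / q ^ n = W1 at *
  generalize 1 - c1 * c2 * c3 * q ^ N * q ^ 2 = W2 at *
  generalize 1 - q ^ N * q = W4 at *
  generalize 1 - c1 * c2 * c3 * q ^ n * q ^ N * q ^ 2 = W5 at *
  generalize 1 - c1 * q ^ N * q / q ^ n = W6 at *
  generalize q ^ n = Z at *
  have e3 : Z / Z = 1 := div_self hz
  linear_combination O1 * W1 * W2 * W3 * e1 + σ * W1 * W2 * W3 ^ 2 * hR + σ * W3 * A4 * hU - O3 * c2 * Z * q * W6 * W3 * e2 + O3 * A4 * W4 * W5 * W6 * W3 * hst2 - O3*c2*q*W6*W3*A4*W4*W5*e3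

theorem CMkM (N n : ℤ) (hN : N + 1 ≤ T)
    (h0 : 0 ≤ n) (h1 : n ≤ N) :
    Om q s c1 c2 c3 t2 (N+1) (n-1) * PhiMm q (s * t2) c1 c2 c3 (N+1) (n-1) = Om q s c1 c2 c3 t2 N n *
      psM q c2 c3 (c1 * c2 * c3 * q ^ (N+2)) (q ^ (-N)) (q ^ n) := by
  have hq := h.hq
  have hz := z_ne hq n
  have hQ := z_ne hq N
  have c2n := h.h2
  have c3n := h.h3
  have hst := h.hst
  have hst2 := h.hst2
  obtain ⟨a1, a2, a3, a4, a5, a6⟩ := h.U1 N n hN h0 h1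
  have hU := OmU h N n hN h0 h1
  have hR := Om_R h (N+1) (n-1) hN (by omega) (by omega)
  rw [sub_add_cancel] at hR
  have e1 : PhiMm q (s * t2) c1 c2 c3 (N+1) (n-1) * (1 - c1 * c2 * c3 * q ^ n * q ^ N * q ^ 2) =
    PhiM q c1 c2 c3 (N+1) (n-1) * (c3 * (s * t2) * q ^ n * (1 - q ^ N * q / q ^ n)) := by
    simp only [PhiMm, PhiM, two_mul, zpow_add₀ hq, zpow_sub₀ hq, zpow_neg, zpow_ofNat, pow_one]
    generalize s * t2 = σ at *
    generalize q ^ n = Z at *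
    generalize q ^ N = Q at *
    generalize 1 - c2 * c3 * (Z / q * (Z / q) * q ^ 2) = X1
    generalize 1 - c2 * c3 * (Z / q * (Z / q) * q) = X2
    rcases eq_or_ne X1 0 with rfl | hX
    · simp
    rcases eq_or_ne X2 0 with rfl | hX
    · simp
    field_simp
    ring
  have e2 : psM q c2 c3 (c1 * c2 * c3 * q ^ (N+2)) (q ^ (-N)) (q ^ n) * 
     ((1 - c2 * c3 * q ^ n * q ^ N * q ^ 2) * (1 - c1 * c2 * c3 * q ^ N * q ^ 2)) = PhiP q c1 c2 c3 (N+1) n * ((1 - q ^ N * q) * (1 - c1 * q ^ N * q / q ^ n) * (c2 * c3 * q * q ^ n)) := by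
    rw [PhiP_eq hq _ _ _ c3n]
    simp only [psM, kap, two_mul, neg_add, zpow_add₀ hq, zpow_sub₀ hq, zpow_neg, zpow_ofNat, pow_one]
    generalize dd q c2 c3 (q ^ n) = B
    generalize q ^ n = Z at *
    generalize q ^ N = Q at *
    rw [show 1 - c1 * c2 * c3 * (Q * q ^ 2) = 1 - c1 * c2 * c3 * Q * q ^ 2 by ring]
    generalize h1 : 1 - c1 * c2 * c3 * Q * q ^ 2 = X at *
    field_simp
    ring
  apply mul_right_cancel₀ (mul_ne_zero (mul_ne_zero a5 a2) a3)
  generalize Om q s c1 c2 c3 t2 (N+1) (n-1) = O1 at *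
  generalize Om q s c1 c2 c3 t2 (N+1) n = O2 at *
  generalize Om q s c1 c2 c3 t2 N n = O3 at *
  generalize PhiMm q (s * t2) c1 c2 c3 (N+1) (n-1) = A1 at *
  generalize PhiP q c1 c2 c3 (N+1) n = A2 at *
  generalize psM q c2 c3 (c1 * c2 * c3 * q ^ (N+2)) (q ^ (-N)) (q ^ n) = A3 at *
  generalize PhiM q c1 c2 c3 (N+1) (n-1) = A4 at *
  generalize s * t2 = σ at *
  generalize 1 - c2 * c3 * q ^ n * q ^ N * q ^ 2 = W3 at *
  generalize 1 - q ^ N * q / q ^ n = W1 at *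
  generalize 1 - c1 * c2 * c3 * q ^ N * q ^ 2 = W2 at *
  generalize 1 - q ^ N * q = W4 at *
  generalize 1 - c1 * c2 * c3 * q ^ n * q ^ N * q ^ 2 = W5 at *
  generalize 1 - c1 * q ^ N * q / q ^ n = W6 at *
  generalize q ^ n = Z at *
  linear_combination O1 * W2 * W3 * e1 - c3 * σ * Z * W1 * W2 * W3 * hR + c3 * σ * Z * A2 * hU - O3 * W5 * e2 + O3 * A2 * W4 * W5 * W6 * Z * c3 * hst2

theorem CMk0 (N n : ℤ) (hN : N + 1 ≤ T)
    (h0 : 0 ≤ n) (h1 : n ≤ N) :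
    Om q s c1 c2 c3 t2 (N+1) n * PhiM0 q (s * t2) c1 c2 c3 (N+1) n = Om q s c1 c2 c3 t2 N n *
      ps0 q (c1 * c2) c2 c3 (c1 * c2 * c3 * q ^ (N+2)) (q ^ (-N)) (q ^ n) := by
  have hq := h.hq
  have hz := z_ne hq n
  have hQ := z_ne hq N
  have c2n := h.h2
  have c3n := h.h3
  have hst := h.hst
  have hst2 := h.hst2
  obtain ⟨a1, a2, a3, a4, a5, a6⟩ := h.U1 N n hN h0 h1
  have hU := OmU h N n hN h0 h1
  have y0 := h.e0 n h0 (by omega)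
  have y1 := h.e1 n h0 (by omega)
  have y2 := h.e2 n h0 (by omega)
  have e : PhiM0 q (s * t2) c1 c2 c3 (N+1) n * ((1 - q ^ N * q) * (1 - c1 * c2 * c3 * q ^ n * q ^ N * q ^ 2) * (1 - c1 * q ^ N * q / q ^ n) * (s * t2)) = ps0 q (c1 * c2) c2 c3 (c1 * c2 * c3 * q ^ (N+2)) (q ^ (-N)) (q ^ n) *
    ((1 - q ^ N * q / q ^ n) * (1 - c1 * c2 * c3 * q ^ N * q ^ 2) * (1 - c2 * c3 * q ^ n * q ^ N * q ^ 2)) := by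
    simp only [PhiM0, PhiMp, PhiMm, ps0, psP, psM, kap, bb, dd, two_mul, neg_add, zpow_add₀ hq, zpow_sub₀ hq, zpow_neg, zpow_ofNat, pow_one]
    generalize s * t2 = σ at *
    generalize q ^ n = Z at *
    generalize q ^ N = Q at *
    clear hU a1 a3 a4 a5 a6
    rw [show 1 - c1 * c2 * c3 * (Q * q ^ 2) = 1 - c1 * c2 * c3 * Q * q ^ 2 by ring,
      (q3 q c2 c3 Z).1, (q3 q c2 c3 Z).2.1, (q3 q c2 c3 Z).2.2]
    generalize h1 : 1 - c1 * c2 * c3 * Q * q ^ 2 = X1 at *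
    generalize h2 : 1 - c2 * c3 * Z ^ 2 = X2 at *
    generalize h3 : 1 - c2 * c3 * q * Z ^ 2 = X3 at *
    generalize h4 : 1 - c2 * c3 * q ^ 2 * Z ^ 2 = X4 at *
    field_simp
    simp only [hst2]
    subst h1 h2 h3 h4
    ring
  apply mul_right_cancel₀ (mul_ne_zero (mul_ne_zero a1 a2) a3)
  linear_combination PhiM0 q (s * t2) c1 c2 c3 (N+1) n * hU + Om q s c1 c2 c3 t2 N n * e

theorem CPkP (N n : ℤ) (hN : N + 1 ≤ T)
    (h0 : 0 ≤ n) (h1 : n ≤ N + 1) :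
    Om q s c1 c2 c3 t2 N (n+1) * PhiPp q (s * t2) c1 c2 c3 N (n+1) = Om q s c1 c2 c3 t2 (N+1) n *
      psP q c2 c3 (q ^ (-(N+1))) (c1 * c2 * c3 * q ^ (N+1+2)) (q ^ n) := by
  have hq := h.hq
  have hz := z_ne hq n
  have hQ := z_ne hq N
  have c2n := h.h2
  have c3n := h.h3
  have hst := h.hst
  have hst2 := h.hst2
  rcases h1.eq_or_lt with h1 | h1
  · subst h1
    rw [Om_out _ _ _ _ _ _ N (N+1+1) (by omega)]
    simp only [psP, zpow_add₀ hq, zpow_neg, zpow_ofNat, pow_one]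
    field_simp; simp
  replace h1 : n ≤ N := by omega
  obtain ⟨a1, a2, a3, a4, a5, a6⟩ := h.U1 N n hN h0 h1
  have hU := OmU h N n hN h0 h1
  have hR := Om_R h N n (by omega) (by omega) (by omega)
  have e1 : PhiPp q (s * t2) c1 c2 c3 N (n+1) * (1 - c2 * c3 * q ^ n * q ^ N * q ^ 2) =
    PhiP q c1 c2 c3 N (n+1) * (s * t2 * q ^ n * (1 - c1 * q ^ N * q / q ^ n)) := by
    simp only [PhiPp, PhiP, two_mul, zpow_add₀ hq, zpow_sub₀ hq, zpow_neg, zpow_ofNat, pow_one]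
    generalize s * t2 = σ at *
    generalize q ^ n = Z at *
    generalize q ^ N = Q at *
    generalize 1 - c2 * c3 * (Z * q * (Z * q) * q) = X1
    generalize 1 - c2 * c3 * (Z * q * (Z * q)) = X2
    rcases eq_or_ne X1 0 with rfl | hX
    · simp
    rcases eq_or_ne X2 0 with rfl | hX
    · simp
    field_simp
  have e2 : psP q c2 c3 (q ^ (-(N+1))) (c1 * c2 * c3 * q ^ (N+1+2)) (q ^ n) * 
     ((1 - c1 * c2 * c3 * q ^ n * q ^ N * q ^ 2) * (1 - q ^ N * q)) = PhiM q c1 c2 c3 N n * (q ^ n * (1 - c1 * c2 * c3 * q ^ N * q ^ 2) * (1 - q ^ N * q / q ^ n)) := by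
    rw [PhiM_eq hq]
    simp only [psP, kap, two_mul, neg_add, zpow_add₀ hq, zpow_sub₀ hq, zpow_neg, zpow_ofNat, pow_one]
    generalize bb q c2 c3 (q ^ n) = B
    generalize q ^ n = Z at *
    generalize q ^ N = Q at *
    rw [show 1 - Q⁻¹ * q⁻¹ = -(1 - Q * q) / (Q * q) by field_simp; ring]
    generalize h1 : 1 - Q * q = X at *
    field_simp
    ring
  apply mul_right_cancel₀ (mul_ne_zero (mul_ne_zero a5 a4) a3)
  generalize Om q s c1 c2 c3 t2 N (n+1) = O1 at *
  generalize Om q s c1 c2 c3 t2 (N+1) n = O2 at *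
  generalize Om q s c1 c2 c3 t2 N n = O3 at *
  generalize PhiPp q (s * t2) c1 c2 c3 N (n+1) = A1 at *
  generalize PhiP q c1 c2 c3 N (n+1) = A2 at *
  generalize psP q c2 c3 (q ^ (-(N+1))) (c1 * c2 * c3 * q ^ (N+1+2)) (q ^ n) = A3 at *
  generalize PhiM q c1 c2 c3 N n = A4 at *
  generalize s * t2 = σ at *
  generalize 1 - c2 * c3 * q ^ n * q ^ N * q ^ 2 = W3 at *
  generalize 1 - q ^ N * q / q ^ n = W1 at *
  generalize 1 - c1 * c2 * c3 * q ^ N * q ^ 2 = W2 at *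
  generalize 1 - q ^ N * q = W4 at *
  generalize 1 - c1 * c2 * c3 * q ^ n * q ^ N * q ^ 2 = W5 at *
  generalize 1 - c1 * q ^ N * q / q ^ n = W6 at *
  generalize q ^ n = Z at *
  linear_combination O1 * W5 * W4 * e1 + σ * Z * W6 * W5 * W4 * hR - Z * A4 * hU - O2 * W3 * e2

theorem CPkM (N n : ℤ) (hN : N + 1 ≤ T)
    (h0 : 0 ≤ n) (h1 : n ≤ N + 1) :
    Om q s c1 c2 c3 t2 N (n-1) * PhiPm q (s * t2) c1 c2 c3 N (n-1) = Om q s c1 c2 c3 t2 (N+1) n *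
      psM q c2 c3 (q ^ (-(N+1))) (c1 * c2 * c3 * q ^ (N+1+2)) (q ^ n) := by
  have hq := h.hq
  have hz := z_ne hq n
  have hQ := z_ne hq N
  have c2n := h.h2
  have c3n := h.h3
  have hst := h.hst
  have hst2 := h.hst2
  rcases h0.eq_or_lt with h0 | h0
  · subst h0
    rw [Om_out _ _ _ _ _ _ N (0-1) (by omega)]
    simp [psM, dd]
  obtain ⟨a1, a2, a3, a4, a5, a6⟩ := h.U1 N (n-1) hN (by omega) (by omega)
  have hU := OmU h N (n-1) hN (by omega) (by omega)
  have hR := Om_R h (N+1) (n-1) (by omega) (by omega) (by omega)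
  rw [sub_add_cancel] at hR
  have e1 : PhiPm q (s * t2) c1 c2 c3 N (n-1) * (1 - q ^ N * q / q ^ (n-1)) * (c3 * (s * t2) * q ^ n) =
    PhiM q c1 c2 c3 (N+1) (n-1) * ((1 - c1 * c2 * c3 * q ^ (n-1) * q ^ N * q ^ 2)) * q := by
    simp only [PhiPm, PhiM, two_mul, zpow_add₀ hq, zpow_sub₀ hq, zpow_neg, zpow_ofNat, pow_one]
    generalize s * t2 = σ at *
    generalize q ^ n = Z at *
    generalize q ^ N = Q at *
    generalize 1 - c2 * c3 * (Z / q * (Z / q) * q ^ 2) = X1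
    generalize 1 - c2 * c3 * (Z / q * (Z / q) * q) = X2
    rcases eq_or_ne X1 0 with rfl | hX
    · simp
    rcases eq_or_ne X2 0 with rfl | hX
    · simp
    field_simp
    ring
  have e2 : psM q c2 c3 (q ^ (-(N+1))) (c1 * c2 * c3 * q ^ (N+1+2)) (q ^ n) * 
     ((1 - c1 * q ^ N * q / q ^ (n-1)) * (1 - q ^ N * q)) * (c2 * c3 * q ^ n) = PhiP q c1 c2 c3 (N+1) n * ((1 - c1 * c2 * c3 * q ^ N * q ^ 2) * (1 - c2 * c3 * q ^ (n-1) * q ^ N * q ^ 2)) := by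
    rw [PhiP_eq hq _ _ _ c3n]
    simp only [psM, kap, two_mul, neg_add, zpow_add₀ hq, zpow_sub₀ hq, zpow_neg, zpow_ofNat, pow_one]
    generalize dd q c2 c3 (q ^ n) = B
    generalize q ^ n = Z at *
    generalize q ^ N = Q at *
    rw [show 1 - Q⁻¹ * q⁻¹ = -(1 - Q * q) / (Q * q) by field_simp; ring]
    generalize h1 : 1 - Q * q = X at *
    field_simp
    ring
  apply mul_right_cancel₀ (mul_ne_zero (mul_ne_zero (mul_ne_zero (mul_ne_zero a4 a6) hz) a1) (mul_ne_zero (pow_ne_zero 2 hst) c3n))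
  generalize Om q s c1 c2 c3 t2 N (n-1) = O1 at *
  generalize Om q s c1 c2 c3 t2 (N+1) n = O2 at *
  generalize Om q s c1 c2 c3 t2 (N+1) (n-1) = O4 at *
  generalize PhiPm q (s * t2) c1 c2 c3 N (n-1) = A1 at *
  generalize PhiP q c1 c2 c3 (N+1) n = A2 at *
  generalize psM q c2 c3 (q ^ (-(N+1))) (c1 * c2 * c3 * q ^ (N+1+2)) (q ^ n) = A3 at *
  generalize PhiM q c1 c2 c3 (N+1) (n-1) = A4 at *
  generalize s * t2 = σ at *
  generalize 1 - c2 * c3 * q ^ (n-1) * q ^ N * q ^ 2 = W3 at *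
  generalize 1 - q ^ N * q / q ^ (n-1) = W1 at *
  generalize 1 - c1 * c2 * c3 * q ^ N * q ^ 2 = W2 at *
  generalize 1 - q ^ N * q = W4 at *
  generalize 1 - c1 * c2 * c3 * q ^ (n-1) * q ^ N * q ^ 2 = W5 at *
  generalize 1 - c1 * q ^ N * q / q ^ (n-1) = W6 at *
  generalize q ^ n = Z at *
  linear_combination O1 * W4 * W6 * σ * e1 - q * A4 * hU - q * W1 * W2 * W3 * hR - q * W1 * O2 * e2 - O2 * A3 * W1 * W6 * W4 * c3 * Z * hst2

theorem CPk0 (N n : ℤ) (hN : N + 1 ≤ T)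
    (h0 : 0 ≤ n) (h1 : n ≤ N + 1) (hN0 : 0 ≤ N) :
    Om q s c1 c2 c3 t2 N n * PhiP0 q (s * t2) c1 c2 c3 N n = Om q s c1 c2 c3 t2 (N+1) n *
      ps0 q (c1 * c2) c2 c3 (q ^ (-(N+1))) (c1 * c2 * c3 * q ^ (N+1+2)) (q ^ n) := by
  have hq := h.hq
  have hz := z_ne hq n
  have hQ := z_ne hq N
  have c1n := h.h1
  have c2n := h.h2
  have c3n := h.h3
  have hst := h.hst
  have hst2 := h.hst2
  have y0 := h.e0 n h0 (by omega)
  have y1 := h.e1 n h0 (by omega)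
  have y2 := h.e2 n h0 (by omega)
  rcases h1.eq_or_lt with h1 | h1
  · subst h1
    rw [Om_out _ _ _ _ _ _ N (N+1) (by omega)]
    obtain ⟨a1, a2, a3, a4, a5, a6⟩ := h.U1 N 0 hN (by omega) (by omega)
    simp only [ps0, psP, psM, kap, bb, dd, two_mul, neg_add, zpow_add₀ hq, zpow_sub₀ hq, zpow_neg, zpow_ofNat, pow_one] at *
    generalize q ^ N = Q at *
    rw [show 1 - Q⁻¹ * q⁻¹ = -(1 - Q * q) / (Q * q) by field_simp; ring]
    generalize s * t2 = σ at *
    generalize Om q s c1 c2 c3 t2 (N+1) (N+1) = O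
    clear a1 a2 a3 a5 a6 y2
    rw [show Q⁻¹ * q⁻¹ = (Q * q)⁻¹ by rw [mul_inv], inv_mul_cancel₀ hz]
    generalize h1 : 1 - Q * q = X1 at *
    generalize h2 : 1 - c2 * c3 * (Q * q) ^ 2 = X2 at *
    generalize h3 : 1 - c2 * c3 * q * (Q * q) ^ 2 = X3 at *
    field_simp
    subst h1 h2 h3
    ring
  replace h1 : n ≤ N := by omega
  obtain ⟨a1, a2, a3, a4, a5, a6⟩ := h.U1 N n hN h0 h1
  have hU := OmU h N n hN h0 h1
  have e : PhiP0 q (s * t2) c1 c2 c3 N n * ((1 - q ^ N * q / q ^ n) * (1 - c1 * c2 * c3 * q ^ N * q ^ 2) * (1 - c2 * c3 * q ^ n * q ^ N * q ^ 2)) = ps0 q (c1 * c2) c2 c3 (q ^ (-(N+1))) (c1 * c2 * c3 * q ^ (N+1+2)) (q ^ n) *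
     ((1 - q ^ N * q) * (1 - c1 * c2 * c3 * q ^ n * q ^ N * q ^ 2) * (1 - c1 * q ^ N * q / q ^ n) * (s * t2)) := by
    simp only [PhiP0, PhiPp, PhiPm, ps0, psP, psM, kap, bb, dd, two_mul, neg_add, zpow_add₀ hq, zpow_sub₀ hq, zpow_neg, zpow_ofNat, pow_one]
    generalize s * t2 = σ at *
    generalize q ^ n = Z at *
    generalize q ^ N = Q at *
    clear hU a1 a3 a2 a5 a6
    rw [show 1 - Q⁻¹ * q⁻¹ = -(1 - Q * q) / (Q * q) by field_simp; ring,
      (q3 q c2 c3 Z).1, (q3 q c2 c3 Z).2.1, (q3 q c2 c3 Z).2.2]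
    generalize h1 : 1 - Q * q = X1 at *
    generalize h2 : 1 - c2 * c3 * Z ^ 2 = X2 at *
    generalize h3 : 1 - c2 * c3 * q * Z ^ 2 = X3 at *
    generalize h4 : 1 - c2 * c3 * q ^ 2 * Z ^ 2 = X4 at *
    field_simp
    simp only [hst2]
    subst h1 h2 h3 h4
    ring
  apply mul_right_cancel₀ (mul_ne_zero (mul_ne_zero (mul_ne_zero a4 a5) a6) hst)
  linear_combination -PhiP0 q (s * t2) c1 c2 c3 N n * hU + Om q s c1 c2 c3 t2 (N+1) n * e

end

theorem SS_top (q c1 c2 c3 d1 d2 z w : ℂ) (M : ℕ) (h : ph q (c1 * c2) w (M+1) = 0) :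
    SS q c1 c2 c3 d1 d2 z w (M+1) = SS q c1 c2 c3 d1 d2 z w M := by
  unfold SS; rw [Finset.sum_range_succ _ (M+1), h]; ring

section
variable {q s c1 c2 c3 t2 : ℂ} {T : ℕ} (h : Gen q s c1 c2 c3 t2 T)
include h

theorem CM (N n x : ℤ) (hN : N + 1 ≤ T)
    (h0 : 0 ≤ n) (h1 : n ≤ N) :
    lamM q c1 c2 c3 (N+1) x * p q s c1 c2 c3 t2 N n x =
      PhiMp q (s * t2) c1 c2 c3 (N+1) (n+1) * p q s c1 c2 c3 t2 (N+1) (n+1) x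
      + PhiM0 q (s * t2) c1 c2 c3 (N+1) n * p q s c1 c2 c3 t2 (N+1) n x
      + PhiMm q (s * t2) c1 c2 c3 (N+1) (n-1) * p q s c1 c2 c3 t2 (N+1) (n-1) x := by
  by_cases hx : 0 ≤ x ∧ x ≤ N + 1
  swap
  · rw [p_out _ _ _ _ _ _ _ n _ (by omega), p_out _ _ _ _ _ _ (N+1) (n+1) _ (by omega),
      p_out _ _ _ _ _ _ _ (n-1) _ (by omega), p_out _ _ _ _ _ _ (N+1) n _ (by omega)]; ring
  have hq := h.hq
  have := SC q c1 c2 c3 (c1 * c2 * c3 * q ^ (N + 2)) (q ^ (-N)) (q ^ n) (q ^ x) (N+1).toNat hq (z_ne hq n) (z_ne hq x)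
    h.h3 (z_ne hq _) (hgg hq _ _ _ N) (h.e0 n h0 (by omega)) (h.e1 n h0 (by omega)) (h.e2 n h0 (by omega))
    (fun m hm => h.f1 m (by omega)) (fun m hm => h.f2 N m (by omega) (by omega))
    (fun m hm => by
      by_cases hmN : (m:ℤ) < N
      · exact Or.inl (h.f3 N m (by omega) (by omega))
      · exact Or.inr ⟨poch_q_zero hq n _ h0 (by push_cast; omega), by omega⟩) (fun m hm => h.f4 m (by omega))
    (by have := h.f3 (N+1) 0 (by push_cast; omega) hN
        rw [pow_zero, mul_one, neg_add, zpow_add₀ hq, zpow_neg_one] at this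
        exact this)
    (by simp only [cf]; rw [poch_q_zero hq n _ h0 (by omega)]; simp)
  rw [show q * q ^ n = q ^ (n+1) by rw [zpow_add_one₀ hq, mul_comm], ← zm q hq n,
    show q ^ (-N) / q = q ^ (-(N+1)) by rw [neg_add', zm q hq],
    show q * (c1 * c2 * c3 * q ^ (N+2)) = c1 * c2 * c3 * q ^ (N + 1 + 2) by
      rw [show N + 1 + 2 = N + 2 + 1 by ring, zpow_add_one₀ hq (N+2)]; ring] at this
  have hl : lamM q c1 c2 c3 (N+1) x * p q s c1 c2 c3 t2 N n x = lamM q c1 c2 c3 (N+1) x * (Om q s c1 c2 c3 t2 N n *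
      SS q c1 c2 c3 (c1 * c2 * c3 * q ^ (N + 2)) (q ^ (-N)) (q ^ n) (q ^ x) (N+1).toNat) := by
    by_cases hxN : x ≤ N
    · rw [p_eq _ _ _ _ _ _ hq N n x hx.1 hxN (N+1).toNat (by omega)]
    · obtain rfl : x = N + 1 := by omega
      simp [lamM]
  have hl2 : lamM q c1 c2 c3 (N+1) x = ((q ^ x)⁻¹ - q ^ (-(N+1))) * (1 - c1 * c2 * q ^ 2 * q ^ x / q ^ (-N)) := by
    have := z_ne hq x
    have := z_ne hq N
    simp only [lamM, neg_add, zpow_add₀ hq, zpow_sub₀ hq, zpow_neg, zpow_ofNat, pow_one]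
    field_simp
    ring
  rw [hl, p_eq _ _ _ _ _ _ hq (N+1) (n+1) x hx.1 hx.2 (N+1).toNat (by omega),
    p_eq _ _ _ _ _ _ hq (N+1) n x hx.1 hx.2 (N+1).toNat (by omega), 
    p_eq _ _ _ _ _ _ hq (N+1) (n-1) x hx.1 hx.2 (N+1).toNat (by omega), hl2]
  have k1 := CMkP h N n hN h0 h1
  have k2 := CMk0 h N n hN h0 h1
  have k3 := CMkM h N n hN h0 h1
  generalize hS1 : SS q c1 c2 c3 (c1 * c2 * c3 * q ^ (N + 1 + 2)) (q ^ (-(N+1))) (q ^ (n+1)) (q ^ x) (N+1).toNat = S1 at *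
  generalize hS2 : SS q c1 c2 c3 (c1 * c2 * c3 * q ^ (N + 1 + 2)) (q ^ (-(N+1))) (q ^ n) (q ^ x) (N+1).toNat = S2 at *
  generalize hS3 : SS q c1 c2 c3 (c1 * c2 * c3 * q ^ (N + 1 + 2)) (q ^ (-(N+1))) (q ^ (n-1)) (q ^ x) (N+1).toNat = S3 at *
  linear_combination Om q s c1 c2 c3 t2 N n * this - S1 * k1 - S2 * k2 - S3 * k3

theorem CP (N n x : ℤ) (hN : N + 1 ≤ T)
    (h0 : 0 ≤ n) (h1 : n ≤ N + 1) (h2 : -1 ≤ x) (hx1 : x ≤ N) :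
    lamP q c1 c2 c3 N x * p q s c1 c2 c3 t2 (N+1) n x =
      PhiPp q (s * t2) c1 c2 c3 N (n+1) * p q s c1 c2 c3 t2 N (n+1) x
      + PhiP0 q (s * t2) c1 c2 c3 N n * p q s c1 c2 c3 t2 N n x
      + PhiPm q (s * t2) c1 c2 c3 N (n-1) * p q s c1 c2 c3 t2 N (n-1) x := by
  rcases h2.eq_or_lt with h2 | h2
  · rw [p_out _ _ _ _ _ _ _ n _ (by omega), p_out _ _ _ _ _ _ N (n+1) _ (by omega),
      p_out _ _ _ _ _ _ _ (n-1) _ (by omega), p_out _ _ _ _ _ _ N n _ (by omega)]; ring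
  have hx : 0 ≤ x ∧ x ≤ N := ⟨by omega, hx1⟩
  have hq := h.hq
  have hend : ph q (c1 * c2) (q ^ x) (N.toNat + 1) = 0 := by rw [ph, poch_q_zero hq x _ hx.1 (by omega)]; ring
  have := SC q c1 c2 c3 (q ^ (-(N+1))) (c1 * c2 * c3 * q ^ (N + 1 + 2)) (q ^ n) (q ^ x) N.toNat hq (z_ne hq n) (z_ne hq x)
    h.h3 (mul_ne_zero (mul_ne_zero (mul_ne_zero h.h1 h.h2) h.h3) (z_ne hq _)) (by rw [hgg hq _ _ _ (N+1)]; ring) (h.e0 n h0 (by omega)) (h.e1 n h0 (by omega)) (h.e2 n h0 (by omega))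
    (fun m hm => h.f1 m (by omega)) (fun m hm => h.f3 (N+1) m (by omega) (by omega))
    (fun m hm => Or.inl (h.f2 (N+1) m (by omega) (by omega))) (fun m hm => h.f4 m (by omega))
    (by have := h.f2 N 0 (by omega) (by push_cast; omega)
        rw [pow_zero, mul_one] at this
        rw [show N + 1 + 2 = N + 2 + 1 by ring, zpow_add_one₀ hq (N+2)]
        convert this using 2; field_simp)
    (by rw [hend]; ring)
  rw [show q * q ^ n = q ^ (n+1) by rw [zpow_add_one₀ hq, mul_comm], ← zm q hq n,
    show q * q ^ (-(N+1)) = q ^ (-N) by rw [neg_add', zm q hq]; field_simp,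
    show (c1 * c2 * c3 * q ^ (N+1+2)) / q = c1 * c2 * c3 * q ^ (N + 2) by
      rw [show N + 1 + 2 = N + 2 + 1 by ring, zpow_add_one₀ hq (N+2)]; field_simp] at this
  have hl2 : lamP q c1 c2 c3 N x = ((q ^ x)⁻¹ - c1 * c2 * c3 * q ^ (N + 2)) * (1 - c1 * c2 * q ^ 2 * q ^ x / (c1 * c2 * c3 * q ^ (N+1+2))) := by
    have := z_ne hq x
    have := z_ne hq N
    have := h.h1
    have := h.h2
    have := h.h3
    simp only [lamP, neg_add, zpow_add₀ hq, zpow_sub₀ hq, zpow_neg, zpow_ofNat, pow_one]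
    field_simp
    ring
  have hT := SS_top q c1 c2 c3 (c1 * c2 * c3 * q ^ (N+1+2)) (q ^ (-(N+1))) (q ^ n) (q ^ x) N.toNat hend
  rw [p_eq _ _ _ _ _ _ hq (N+1) n x hx.1 (by omega) (N.toNat + 1) (by omega), hT,
    p_eq _ _ _ _ _ _ hq N (n+1) x hx.1 hx.2 N.toNat (by omega),
    p_eq _ _ _ _ _ _ hq N n x hx.1 hx.2 N.toNat (by omega), 
    p_eq _ _ _ _ _ _ hq N (n-1) x hx.1 hx.2 N.toNat (by omega), hl2]
  simp only [SS_swap q c1 c2 c3 (q ^ (-N)), SS_swap q c1 c2 c3 (q ^ (-(N+1)))] at this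
  have k1 := CPkP h N n hN h0 h1
  have k2 := CPk0 h N n hN h0 h1 (by omega)
  have k3 := CPkM h N n hN h0 h1
  generalize hS1 : SS q c1 c2 c3 (c1 * c2 * c3 * q ^ (N + 2)) (q ^ (-N)) (q ^ (n+1)) (q ^ x) N.toNat = S1 at *
  generalize hS2 : SS q c1 c2 c3 (c1 * c2 * c3 * q ^ (N + 2)) (q ^ (-N)) (q ^ n) (q ^ x) N.toNat = S2 at *
  generalize hS3 : SS q c1 c2 c3 (c1 * c2 * c3 * q ^ (N + 2)) (q ^ (-N)) (q ^ (n-1)) (q ^ x) N.toNat = S3 at *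
  linear_combination Om q s c1 c2 c3 t2 (N+1) n * this - S1 * k1 - S2 * k2 - S3 * k3

end

theorem kP1 (q σ c1 c2 c3 : ℂ) (N n : ℤ) (hq : q ≠ 0) (h3 : c3 ≠ 0) (hσ : σ ≠ 0) :
    PhiPm q σ c1 c2 c3 N n * (kap q (c1 * c2 * c3 * q ^ (N+2)) (q ^ (-N)) * c3 * q ^ N * q * σ) =
     -psP q c2 c3 (c1 * c2 * c3 * q ^ (N+2)) (q ^ (-N)) (q ^ n) := by
  simp only [PhiPm, psP, bb, two_mul, zpow_add₀ hq, zpow_sub₀ hq, zpow_ofNat, pow_one]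
  generalize kap q _ _ = K
  have hz := z_ne hq n
  have hQ := z_ne hq N
  generalize q ^ n = Z at *
  generalize q ^ N = Q at *
  rw [show 1 - c2 * c3 * (Z * Z * q) = 1 - c2 * c3 * q * Z ^ 2 by ring,
      show 1 - c2 * c3 * (Z * Z * q ^ 2) = 1 - c2 * c3 * q ^ 2 * Z ^ 2 by ring]
  generalize 1 - c2 * c3 * q * Z ^ 2 = X1 at *
  generalize 1 - c2 * c3 * q ^ 2 * Z ^ 2 = X2 at *
  rcases eq_or_ne X1 0 with rfl | hX
  · simp
  rcases eq_or_ne X2 0 with rfl | hX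
  · simp
  field_simp

theorem kP2 (q σ c1 c2 c3 : ℂ) (N n : ℤ) (hq : q ≠ 0) (h3 : c3 ≠ 0) (hσ : σ ^ 2 = q * c2) :
    PhiPp q σ c1 c2 c3 N n * (kap q (c1 * c2 * c3 * q ^ (N+2)) (q ^ (-N)) * c3 * q ^ N * q * σ) =
     -psM q c2 c3 (c1 * c2 * c3 * q ^ (N+2)) (q ^ (-N)) (q ^ n) := by
  simp only [PhiPp, psM, dd, two_mul, zpow_add₀ hq, zpow_sub₀ hq, zpow_ofNat, pow_one]
  generalize kap q _ _ = K
  have hz := z_ne hq n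
  have hQ := z_ne hq N
  generalize q ^ n = Z at *
  generalize q ^ N = Q at *
  rw [show 1 - c2 * c3 * (Z * Z * q) = 1 - c2 * c3 * q * Z ^ 2 by ring,
      show 1 - c2 * c3 * (Z * Z) = 1 - c2 * c3 * Z ^ 2 by ring]
  generalize 1 - c2 * c3 * q * Z ^ 2 = X1 at *
  generalize 1 - c2 * c3 * Z ^ 2 = X2 at *
  rcases eq_or_ne X1 0 with rfl | hX
  · simp
  rcases eq_or_ne X2 0 with rfl | hX
  · simp
  field_simp
  simp only [hσ]
  ring

theorem kP0 (q σ c1 c2 c3 : ℂ) (N n : ℤ) (hq : q ≠ 0) (h3 : c3 ≠ 0) (hσ : σ ^ 2 = q * c2) (h2 : c2 ≠ 0)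
    (hD : 1 - c1 * c2 * c3 * q ^ (N+2) ≠ 0) :
    PhiP0 q σ c1 c2 c3 N n * (kap q (c1 * c2 * c3 * q ^ (N+2)) (q ^ (-N)) * c3 * q ^ N * q * σ) =
     -ps0 q (c1 * c2) c2 c3 (c1 * c2 * c3 * q ^ (N+2)) (q ^ (-N)) (q ^ n) := by
  have hs0 : σ ≠ 0 := by rintro rfl; apply mul_ne_zero hq h2; rw [← hσ]; simp
  have a := kP1 q σ c1 c2 c3 N n hq h3 hs0
  have b := kP2 q σ c1 c2 c3 N n hq h3 hσ
  have c : (1 - c1 * c2 * q ^ (N + 2)) * (1 - c1 * c2 * c3 * q ^ (N + 2)) / (c3 * q ^ (N + 1) * σ) * (kap q (c1 * c2 * c3 * q ^ (N+2)) (q ^ (-N)) * c3 * q ^ N * q * σ) = (1 - q ^ (-N) / q) * (1 - (c1 * c2) * q ^ 2 / q ^ (-N)) := by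
    unfold kap
    have hQ := z_ne hq N
    simp only [zpow_add₀ hq, zpow_neg, zpow_ofNat, pow_one] at *
    generalize q ^ N = Q at *
    generalize 1 - c1 * c2 * c3 * (Q * q ^ 2) = X at *
    field_simp
  unfold PhiP0 ps0
  linear_combination -a - b - c

theorem kM1 (q σ c1 c2 c3 : ℂ) (N n : ℤ) (hq : q ≠ 0) (h3 : c3 ≠ 0) :
    PhiMm q σ c1 c2 c3 (N+1) n * kap q (q ^ (-(N+1))) (c1 * c2 * c3 * q ^ (N+1+2)) =
     -(c3 * q ^ N * q * σ) * psP q c2 c3 (q ^ (-(N+1))) (c1 * c2 * c3 * q ^ (N+1+2)) (q ^ n) := by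
  simp only [PhiMm, psP, bb]
  generalize kap q _ _ = K
  simp only [two_mul, neg_add, zpow_neg, zpow_add₀ hq, zpow_sub₀ hq, zpow_ofNat, pow_one]
  have hz := z_ne hq n
  have hQ := z_ne hq N
  generalize q ^ n = Z at *
  generalize q ^ N = Q at *
  rw [show 1 - c2 * c3 * (Z * Z * q) = 1 - c2 * c3 * q * Z ^ 2 by ring,
      show 1 - c2 * c3 * (Z * Z * q ^ 2) = 1 - c2 * c3 * q ^ 2 * Z ^ 2 by ring]
  generalize 1 - c2 * c3 * q * Z ^ 2 = X1 at *
  generalize 1 - c2 * c3 * q ^ 2 * Z ^ 2 = X2 at *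
  rcases eq_or_ne X1 0 with rfl | hX
  · simp
  rcases eq_or_ne X2 0 with rfl | hX
  · simp
  field_simp

theorem kM2 (q σ c1 c2 c3 : ℂ) (N n : ℤ) (hq : q ≠ 0) (h3 : c3 ≠ 0) :
    PhiMp q σ c1 c2 c3 (N+1) n * kap q (q ^ (-(N+1))) (c1 * c2 * c3 * q ^ (N+1+2)) =
     -(c3 * q ^ N * q * σ) * psM q c2 c3 (q ^ (-(N+1))) (c1 * c2 * c3 * q ^ (N+1+2)) (q ^ n) := by
  simp only [PhiMp, psM, dd]
  generalize kap q _ _ = K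
  simp only [two_mul, neg_add, zpow_neg, zpow_add₀ hq, zpow_sub₀ hq, zpow_ofNat, pow_one]
  have hz := z_ne hq n
  have hQ := z_ne hq N
  generalize q ^ n = Z at *
  generalize q ^ N = Q at *
  rw [show 1 - c2 * c3 * (Z * Z * q) = 1 - c2 * c3 * q * Z ^ 2 by ring,
      show 1 - c2 * c3 * (Z * Z) = 1 - c2 * c3 * Z ^ 2 by ring]
  generalize 1 - c2 * c3 * q * Z ^ 2 = X1 at *
  generalize 1 - c2 * c3 * Z ^ 2 = X2 at *
  rcases eq_or_ne X1 0 with rfl | hX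
  · simp
  rcases eq_or_ne X2 0 with rfl | hX
  · simp
  field_simp

theorem kM0 (q σ c1 c2 c3 : ℂ) (N n : ℤ) (hq : q ≠ 0) (h1 : c1 ≠ 0) (h2 : c2 ≠ 0) (h3 : c3 ≠ 0)
    (hD : 1 - q ^ N * q ≠ 0) :
    PhiM0 q σ c1 c2 c3 (N+1) n * kap q (q ^ (-(N+1))) (c1 * c2 * c3 * q ^ (N+1+2)) =
     -(c3 * q ^ N * q * σ) * ps0 q (c1 * c2) c2 c3 (q ^ (-(N+1))) (c1 * c2 * c3 * q ^ (N+1+2)) (q ^ n) := by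
  have a := kM1 q σ c1 c2 c3 N n hq h3
  have b := kM2 q σ c1 c2 c3 N n hq h3
  have c : (σ * (1 - c3 * q ^ (N+1)) * (q ^ (-(N+1)) - 1)) * kap q (q ^ (-(N+1))) (c1 * c2 * c3 * q ^ (N+1+2)) = c3 * q ^ N * q * σ * ((1 - (c1 * c2 * c3 * q ^ (N+1+2)) / q) * (1 - (c1 * c2) * q ^ 2 / (c1 * c2 * c3 * q ^ (N+1+2)))) := by
    unfold kap
    have hQ := z_ne hq N
    simp only [neg_add, zpow_add₀ hq, zpow_neg, zpow_ofNat, pow_one] at *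
    generalize q ^ N = Q at *
    rw [show 1 - Q⁻¹ * q⁻¹ = -(1 - Q * q) / (Q * q) by field_simp; ring]
    generalize hX : 1 - Q * q = X at *
    field_simp
    subst hX
    ring
  unfold PhiM0 ps0
  linear_combination -a - b - c

theorem PhiM0_top (q σ c1 c2 c3 : ℂ) (N : ℤ) (hq : q ≠ 0) 
   (e0 : 1 - c2 * c3 * (q ^ N) ^ 2 ≠ 0) (e1 : 1 - c2 * c3 * q * (q ^ N) ^ 2 ≠ 0) :
    PhiM0 q σ c1 c2 c3 N N = 0 := by
  have hQ := z_ne hq N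
  simp only [PhiM0, PhiMp, PhiMm, two_mul, zpow_add₀ hq, zpow_sub₀ hq, zpow_neg, zpow_ofNat, pow_one]
  generalize q ^ N = Z at *
  rw [show 1 - c2 * c3 * (Z * Z * q) = 1 - c2 * c3 * q * Z ^ 2 by ring,
      show 1 - c2 * c3 * (Z * Z) = 1 - c2 * c3 * Z ^ 2 by ring, div_self hQ]
  generalize h1 : 1 - c2 * c3 * q * Z ^ 2 = X1 at *
  generalize h2 : 1 - c2 * c3 * Z ^ 2 = X2 at *
  field_simp
  subst h1 h2
  ring

section
variable {q s c1 c2 c3 t2 : ℂ} {T : ℕ} (h : Gen q s c1 c2 c3 t2 T)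
include h

theorem DM (N n x : ℤ) (hN : N + 1 ≤ T) (hN0 : 0 ≤ N)
    (h0 : 0 ≤ x) (h1 : x ≤ N + 1) :
    -(q ^ N * q)⁻¹ * ((1 - q ^ N * q / q ^ n) * (1 - c2 * c3 * q ^ n * q ^ N * q ^ 2)) * p q s c1 c2 c3 t2 (N+1) n x =
      PhiMm q (s * t2) c3 c2 c1 (N+1) x * p q s c1 c2 c3 t2 N n (x+1)
      + PhiM0 q (s * t2) c3 c2 c1 (N+1) x * p q s c1 c2 c3 t2 N n x
      + PhiMp q (s * t2) c3 c2 c1 (N+1) x * p q s c1 c2 c3 t2 N n (x-1) := by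
  have hq := h.hq
  by_cases hn : 0 ≤ n ∧ n ≤ N
  swap
  · rw [p_out _ _ _ _ _ _ N n _ (by omega), p_out _ _ _ _ _ _ N n _ (by omega), p_out _ _ _ _ _ _ N n _ (by omega)]
    by_cases hn1 : n = N + 1
    · rw [hn1, zpow_add_one₀ hq, div_self (by have := z_ne hq N; positivity)]; ring
    · rw [p_out _ _ _ _ _ _ (N+1) n _ (by omega)]; ring
  have g := h.symm
  have hend : ph q (c3 * c2) (q ^ n) (N.toNat + 1) = 0 := by rw [ph, poch_q_zero hq n _ hn.1 (by omega)]; ring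
  have := SC q c3 c2 c1 (q ^ (-(N+1))) (c3 * c2 * c1 * q ^ (N + 1 + 2)) (q ^ x) (q ^ n) N.toNat hq (z_ne hq x) (z_ne hq n)
    g.h3 (mul_ne_zero (mul_ne_zero (mul_ne_zero g.h1 g.h2) g.h3) (z_ne hq _)) (by rw [hgg hq _ _ _ (N+1)]; ring) (g.e0 x h0 (by omega)) (g.e1 x h0 (by omega)) (g.e2 x h0 (by omega))
    (fun m hm => g.f1 m (by omega)) (fun m hm => g.f3 (N+1) m (by omega) (by omega))
    (fun m hm => Or.inl (g.f2 (N+1) m (by omega) (by omega))) (fun m hm => g.f4 m (by omega))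
    (by have := g.f2 N 0 (by omega) (by push_cast; omega)
        rw [pow_zero, mul_one] at this
        rw [show N + 1 + 2 = N + 2 + 1 by ring, zpow_add_one₀ hq (N+2)]
        convert this using 2; field_simp)
    (by rw [hend]; ring)
  rw [show q * q ^ x = q ^ (x+1) by rw [zpow_add_one₀ hq, mul_comm], ← zm q hq x,
    show q * q ^ (-(N+1)) = q ^ (-N) by rw [neg_add', zm q hq]; field_simp,
    show (c3 * c2 * c1 * q ^ (N+1+2)) / q = c3 * c2 * c1 * q ^ (N + 2) by
      rw [show N + 1 + 2 = N + 2 + 1 by ring, zpow_add_one₀ hq (N+2)]; field_simp] at this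
  have hT := SS_top q c3 c2 c1 (c3 * c2 * c1 * q ^ (N+1+2)) (q ^ (-(N+1))) (q ^ x) (q ^ n) N.toNat hend
  obtain ⟨a1, a2, a3, a4, a5, a6⟩ := h.U1 N n hN hn.1 hn.2
  have k1 := kM1 q (s * t2) c3 c2 c1 N x hq g.h3
  have k2 := kM2 q (s * t2) c3 c2 c1 N x hq g.h3
  have k0 := kM0 q (s * t2) c3 c2 c1 N x hq g.h1 g.h2 g.h3 a4
  have hU := OmU h N n hN hn.1 hn.2
  have P := fun x h0 h1 => p_eq q s c1 c2 c3 t2 hq N n x h0 h1 N.toNat (by omega)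
  have P1 : PhiMm q (s * t2) c3 c2 c1 (N+1) x * p q s c1 c2 c3 t2 N n (x+1) = PhiMm q (s * t2) c3 c2 c1 (N+1) x * (Om q s c1 c2 c3 t2 N n *
      SS q c1 c2 c3 (c1 * c2 * c3 * q ^ (N + 2)) (q ^ (-N)) (q ^ n) (q ^ (x+1)) N.toNat) := by
    rcases h1.eq_or_lt with h1 | h1
    · subst h1; simp [PhiMm]
    · by_cases hh : x = N
      · subst hh; simp [PhiMm]
      rw [P (x+1) (by omega) (by omega)]
  have P0 : PhiM0 q (s * t2) c3 c2 c1 (N+1) x * p q s c1 c2 c3 t2 N n x = PhiM0 q (s * t2) c3 c2 c1 (N+1) x * (Om q s c1 c2 c3 t2 N n *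
      SS q c1 c2 c3 (c1 * c2 * c3 * q ^ (N + 2)) (q ^ (-N)) (q ^ n) (q ^ x) N.toNat) := by
    rcases h1.eq_or_lt with h1 | h1
    · subst h1; rw [PhiM0_top _ _ _ _ _ _ hq (g.e0 _ h0 (by omega)) (g.e1 _ h0 (by omega))]; ring
    · rw [P x (by omega) (by omega)]
  have P2 : PhiMp q (s * t2) c3 c2 c1 (N+1) x * p q s c1 c2 c3 t2 N n (x-1) = PhiMp q (s * t2) c3 c2 c1 (N+1) x * (Om q s c1 c2 c3 t2 N n *
      SS q c1 c2 c3 (c1 * c2 * c3 * q ^ (N + 2)) (q ^ (-N)) (q ^ n) (q ^ (x-1)) N.toNat) := by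
    rcases h0.eq_or_lt with h0 | h0
    · subst h0; simp [PhiMp]
    · rw [P (x-1) (by omega) (by omega)]
  rw [SS_dual] at hT
  rw [P1, P2, P0, p_eq _ _ _ _ _ _ hq (N+1) n x h0 h1 (N.toNat+1) (by omega), show c1 * c2 * c3 = c3 * c2 * c1 by ring, hT, ← SS_dual]
  simp only [SS_swap q c3 c2 c1 (q ^ (-N)), SS_swap q c3 c2 c1 (q ^ (-(N+1)))] at this
  simp only [SS_dual q c1 c2 c3]
  generalize hS1 : SS q c3 c2 c1 (c3 * c2 * c1 * q ^ (N + 2)) (q ^ (-N)) (q ^ (x+1)) (q ^ n) N.toNat = S1 at *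
  generalize hS2 : SS q c3 c2 c1 (c3 * c2 * c1 * q ^ (N + 2)) (q ^ (-N)) (q ^ x) (q ^ n) N.toNat = S2 at *
  generalize hS3 : SS q c3 c2 c1 (c3 * c2 * c1 * q ^ (N + 2)) (q ^ (-N)) (q ^ (x-1)) (q ^ n) N.toNat = S3 at *
  generalize hS4 : SS q c3 c2 c1 (c3 * c2 * c1 * q ^ (N + 1 + 2)) (q ^ (-(N+1))) (q ^ x) (q ^ n) N.toNat = S4 at *
  have hz := z_ne hq n
  have hQ := z_ne hq N
  have c1n := h.h1
  have c2n := h.h2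
  have c3n := h.h3
  have hK : kap q (q ^ (-(N+1))) (c3 * c2 * c1 * q ^ (N+1+2)) * (1 - q ^ N * q) = -(1 - c1 * c2 * c3 * q ^ N * q ^ 2) * q ^ N * q := by
    unfold kap
    simp only [neg_add, zpow_add₀ hq, zpow_neg, zpow_ofNat, pow_one]
    generalize q ^ N = Q at *
    rw [show 1 - Q⁻¹ * q⁻¹ = -(1 - Q * q) / (Q * q) by field_simp; ring]
    generalize 1 - Q * q = X at *
    field_simp
  have hKn : kap q (q ^ (-(N+1))) (c3 * c2 * c1 * q ^ (N+1+2)) ≠ 0 := by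
    intro h0; rw [h0, zero_mul] at hK
    have : -(1 - c1 * c2 * c3 * q ^ N * q ^ 2) * q ^ N * q ≠ 0 := mul_ne_zero (mul_ne_zero (neg_ne_zero.2 a2) hQ) hq
    exact this hK.symm
  have hL : c1 * q ^ N * q * (((q ^ n)⁻¹ - c3 * c2 * c1 * q ^ (N + 2)) * (1 - c3 * c2 * q ^ 2 * q ^ n / (c3 * c2 * c1 * q ^ (N+1+2)))) = -(1 - c1 * c2 * c3 * q ^ n * q ^ N * q ^ 2) * (1 - c1 * q ^ N * q / q ^ n) := by
    simp only [neg_add, zpow_add₀ hq, zpow_neg, zpow_ofNat, pow_one]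
    generalize q ^ N = Q at *
    generalize q ^ n = Z at *
    field_simp
    ring
  have hi : (q ^ N * q)⁻¹ * (q ^ N * q) = 1 := inv_mul_cancel₀ (mul_ne_zero hQ hq)
  apply mul_left_cancel₀ (mul_ne_zero hKn a4)
  generalize kap q (q ^ (-(N+1))) (c3 * c2 * c1 * q ^ (N+1+2)) = K at *
  generalize ((q ^ n)⁻¹ - c3 * c2 * c1 * q ^ (N + 2)) * (1 - c3 * c2 * q ^ 2 * q ^ n / (c3 * c2 * c1 * q ^ (N+1+2))) = L at *
  generalize (q ^ N * q)⁻¹ = I at *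
  generalize Om q s c1 c2 c3 t2 (N+1) n = O2 at *
  generalize Om q s c1 c2 c3 t2 N n = O3 at *
  generalize s * t2 = σ at *
  generalize 1 - c2 * c3 * q ^ n * q ^ N * q ^ 2 = W3 at *
  generalize 1 - q ^ N * q / q ^ n = W1 at *
  generalize 1 - c1 * c2 * c3 * q ^ N * q ^ 2 = W2 at *
  generalize 1 - q ^ N * q = W4 at *
  generalize 1 - c1 * c2 * c3 * q ^ n * q ^ N * q ^ 2 = W5 at *
  generalize 1 - c1 * q ^ N * q / q ^ n = W6 at *
  generalize q ^ N = Q at *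
  linear_combination -O3 * W4 * S1 * k1 - O3 * W4 * S2 * k0 - O3 * W4 * S3 * k2 - I * W1 * W3 * O2 * S4 * hK + W1 * W2 * W3 * O2 * S4 * hi + S4 * hU - c1 * Q * q * σ * O3 * W4 * this + (σ * O3 * W4 * S4) * hL

theorem DP (N n x : ℤ) (hN : N + 1 ≤ T)
    (h0 : 0 ≤ x) (h1 : x ≤ N) :
    -(q ^ N * q)⁻¹ / c1 * ((1 - c1 * c2 * c3 * q ^ n * q ^ N * q ^ 2) * (1 - c1 * q ^ N * q / q ^ n)) * p q s c1 c2 c3 t2 N n x =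
      PhiPm q (s * t2) c3 c2 c1 N x * p q s c1 c2 c3 t2 (N+1) n (x+1)
      + PhiP0 q (s * t2) c3 c2 c1 N x * p q s c1 c2 c3 t2 (N+1) n x
      + PhiPp q (s * t2) c3 c2 c1 N x * p q s c1 c2 c3 t2 (N+1) n (x-1) := by
  have hq := h.hq
  by_cases hn : 0 ≤ n ∧ n ≤ N + 1
  swap
  · rw [p_out _ _ _ _ _ _ N n _ (by omega), p_out _ _ _ _ _ _ (N+1) n _ (by omega), p_out _ _ _ _ _ _ (N+1) n _ (by omega), p_out _ _ _ _ _ _ (N+1) n _ (by omega)]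
    ring
  have g := h.symm
  have hend : poch q (q ^ x)⁻¹ ((N+1).toNat) = 0 := by rw [poch_q_zero hq x _ h0 (by omega)]
  have := SC q c3 c2 c1 (c3 * c2 * c1 * q ^ (N + 2)) (q ^ (-N)) (q ^ x) (q ^ n) (N+1).toNat hq (z_ne hq x) (z_ne hq n)
    g.h3 (z_ne hq _) (hgg hq _ _ _ N) (g.e0 x h0 (by omega)) (g.e1 x h0 (by omega)) (g.e2 x h0 (by omega))
    (fun m hm => g.f1 m (by omega)) (fun m hm => g.f2 N m (by omega) (by omega))
    (fun m hm => by
      by_cases hmN : (m:ℤ) < N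
      · exact Or.inl (g.f3 N m (by omega) (by omega))
      · exact Or.inr ⟨poch_q_zero hq x _ h0 (by push_cast; omega), by omega⟩) (fun m hm => g.f4 m (by omega))
    (by have := g.f3 (N+1) 0 (by push_cast; omega) hN
        rw [pow_zero, mul_one, neg_add, zpow_add₀ hq, zpow_neg_one] at this
        exact this)
    (by simp only [cf]; rw [hend]; simp)
  rw [show q * q ^ x = q ^ (x+1) by rw [zpow_add_one₀ hq, mul_comm], ← zm q hq x,
    show q ^ (-N) / q = q ^ (-(N+1)) by rw [neg_add', zm q hq],
    show q * (c3 * c2 * c1 * q ^ (N+2)) = c3 * c2 * c1 * q ^ (N + 1 + 2) by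
      rw [show N + 1 + 2 = N + 2 + 1 by ring, zpow_add_one₀ hq (N+2)]; ring] at this
  obtain ⟨a1, a2, a3, a4, a5, a6⟩ := h.U1 N 0 hN (by omega) (by omega)
  have hD : 1 - c3 * c2 * c1 * q ^ (N+2) ≠ 0 := by
    rw [zpow_add₀ hq, zpow_ofNat]; convert a2 using 2; ring
  have k1 := kP1 q (s * t2) c3 c2 c1 N x hq g.h3 h.hst
  have k2 := kP2 q (s * t2) c3 c2 c1 N x hq g.h3 h.hst2
  have k0 := kP0 q (s * t2) c3 c2 c1 N x hq g.h3 h.hst2 h.h2 hD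
  have P := fun x h0 h1 => p_eq q s c1 c2 c3 t2 hq (N+1) n x h0 h1 (N+1).toNat (by omega)
  have P2 : PhiPp q (s * t2) c3 c2 c1 N x * p q s c1 c2 c3 t2 (N+1) n (x-1) = PhiPp q (s * t2) c3 c2 c1 N x * (Om q s c1 c2 c3 t2 (N+1) n *
      SS q c1 c2 c3 (c1 * c2 * c3 * q ^ (N + 1 + 2)) (q ^ (-(N+1))) (q ^ n) (q ^ (x-1)) (N+1).toNat) := by
    rcases h0.eq_or_lt with h0 | h0
    · subst h0; simp [PhiPp]
    · rw [P (x-1) (by omega) (by omega)]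
  rw [P2, P x (by omega) (by omega), P (x+1) (by omega) (by omega), p_eq _ _ _ _ _ _ hq N n x h0 h1 (N+1).toNat (by omega)]
  simp only [SS_dual q c1 c2 c3]
  have hD3 : c3 * c2 * c1 = c1 * c2 * c3 := by ring
  simp only [hD3] at *
  have hz := z_ne hq n
  have hQ := z_ne hq N
  have c1n := h.h1
  have c2n := h.h2
  have c3n := h.h3
  have hK : kap q (c1 * c2 * c3 * q ^ (N+2)) (q ^ (-N)) * (1 - c1 * c2 * c3 * q ^ N * q ^ 2) = -(1 - q ^ N * q) * (q ^ N * q)⁻¹ := by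
    unfold kap
    simp only [neg_add, zpow_add₀ hq, zpow_neg, zpow_ofNat, pow_one]
    generalize q ^ N = Q at *
    rw [show c1 * c2 * c3 * (Q * q ^ 2) = c1 * c2 * c3 * Q * q ^ 2 by ring]
    generalize 1 - c1 * c2 * c3 * Q * q ^ 2 = X at *
    field_simp
    ring
  have hKn : kap q (c1 * c2 * c3 * q ^ (N+2)) (q ^ (-N)) ≠ 0 := by
    intro h0; rw [h0, zero_mul] at hK
    have : -(1 - q ^ N * q) * (q ^ N * q)⁻¹ ≠ 0 := mul_ne_zero (neg_ne_zero.2 a4) (inv_ne_zero (mul_ne_zero hQ hq))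
    exact this hK.symm
  have hL : (((q ^ n)⁻¹ - q ^ (-(N+1))) * (1 - c3 * c2 * q ^ 2 * q ^ n / q ^ (-N))) = -(q ^ N * q)⁻¹ * ((1 - q ^ N * q / q ^ n) * (1 - c2 * c3 * q ^ n * q ^ N * q ^ 2)) := by
    simp only [neg_add, zpow_add₀ hq, zpow_neg, zpow_ofNat, pow_one]
    generalize q ^ N = Q at *
    generalize q ^ n = Z at *
    field_simp
    ring
  rw [hL] at this
  have hU : Om q s c1 c2 c3 t2 (N+1) n * ((1 - q ^ N * q / q ^ n) * (1 - c1 * c2 * c3 * q ^ N * q ^ 2) * (1 - c2 * c3 * q ^ n * q ^ N * q ^ 2)) =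
    Om q s c1 c2 c3 t2 N n * ((1 - q ^ N * q) * (1 - c1 * c2 * c3 * q ^ n * q ^ N * q ^ 2) * (1 - c1 * q ^ N * q / q ^ n) * (s * t2)) := by
    by_cases hn1 : n = N + 1
    · rw [hn1, Om_out _ _ _ _ _ _ N (N+1) (by omega), zpow_add_one₀ hq, div_self (mul_ne_zero hQ hq)]; ring
    · exact OmU h N n hN hn.1 (by omega)
  have hst := h.hst
  apply mul_left_cancel₀ (mul_ne_zero (mul_ne_zero (mul_ne_zero (mul_ne_zero hKn hst) (mul_ne_zero hQ hq)) c1n) a2)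
  have hi : (q ^ N * q)⁻¹ * (q ^ N * q) = 1 := inv_mul_cancel₀ (mul_ne_zero hQ hq)
  have hci : c1 / c1 = 1 := div_self c1n
  generalize kap q (c1 * c2 * c3 * q ^ (N+2)) (q ^ (-N)) = K at *
  generalize (q ^ N * q)⁻¹ = I at *
  generalize Om q s c1 c2 c3 t2 (N+1) n = O2 at *
  generalize Om q s c1 c2 c3 t2 N n = O3 at *
  generalize s * t2 = σ at *
  generalize 1 - c2 * c3 * q ^ n * q ^ N * q ^ 2 = W3 at *
  generalize 1 - q ^ N * q / q ^ n = W1 at *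
  generalize 1 - c1 * c2 * c3 * q ^ N * q ^ 2 = W2 at *
  generalize 1 - q ^ N * q = W4 at *
  generalize 1 - c1 * c2 * c3 * q ^ n * q ^ N * q ^ 2 = W5 at *
  generalize 1 - c1 * q ^ N * q / q ^ n = W6 at *
  generalize hS1 : SS q c3 c2 c1 (c1 * c2 * c3 * q ^ (N + 1 + 2)) (q ^ (-(N+1))) (q ^ (x+1)) (q ^ n) (N+1).toNat = S1 at *
  generalize hS2 : SS q c3 c2 c1 (c1 * c2 * c3 * q ^ (N + 1 + 2)) (q ^ (-(N+1))) (q ^ x) (q ^ n) (N+1).toNat = S2 at *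
  generalize hS3 : SS q c3 c2 c1 (c1 * c2 * c3 * q ^ (N + 1 + 2)) (q ^ (-(N+1))) (q ^ (x-1)) (q ^ n) (N+1).toNat = S3 at *
  generalize hS4 : SS q c3 c2 c1 (c1 * c2 * c3 * q ^ (N + 2)) (q ^ (-N)) (q ^ x) (q ^ n) (N+1).toNat = S4 at *
  generalize q ^ N = Q at *
  have z1 : K * σ * (Q * q) * c1 * W2 * (-I / c1 * (W5 * W6) * (O3 * S4)) = I * (O2 * (W1 * W2 * W3)) * S4 := by
    have : K * σ * (Q * q) * c1 * W2 * (-I / c1 * (W5 * W6) * (O3 * S4)) = -(K * W2) * (I * (Q * q)) * (c1 / c1) * σ * W5 * W6 * O3 * S4 := by ring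
    rw [this, hK, hi, hci, hU]; ring
  rw [z1]
  linear_combination -O2 * W2 * S1 * k1 - O2 * W2 * S2 * k0 - O2 * W2 * S3 * k2 - O2 * W2 * this

end

def FF (q c1 c2 : ℂ) (x : ℤ) : ℂ := Fp q c1 c2 x + Fm q c1 c2 x

theorem Eabs {iq A E Th bt dt bs ds l0 lp lm Lp L0 Lm S0 Sp Sm TP T0 TM TPp T0p TMp TPm T0m TMm yP y0 yM a b c z0 zp zm : ℂ}
   (hC0 : L0 * S0 = yP * TP + y0 * T0 + yM * TM)
   (hCp : bt * (Lp * Sp) = bt * (yP * TPp + y0 * T0p + yM * TMp))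
   (hCm : dt * (Lm * Sm) = dt * (yP * TPm + y0 * T0m + yM * TMm))
   (h1 : lp * TP = bt * (TPp - TP) + dt * (TPm - TP))
   (h2 : l0 * T0 = bt * (T0p - T0) + dt * (T0m - T0))
   (h3 : lm * TM = bt * (TMp - TM) + dt * (TMm - TM))
   (h4 : L0 * (l0 * S0) = L0 * (bs * (Sp - S0) + ds * (Sm - S0)))
   (h5 : Th * T0 = zp * Sp + z0 * S0 + zm * Sm)
   (ha : bt * Lp - bs * L0 * iq + E * zp = a)
   (hb : -(bt + dt) * L0 + (bs + ds) * L0 * iq + A * L0 + E * z0 = b)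
   (hc : dt * Lm - ds * L0 * iq + E * zm = c) :
   a * Sp + b * S0 + c * Sm = yP * (lp - l0 * iq + A) * TP + (y0 * (l0 - l0 * iq + A) + E * Th) * T0
     + yM * (lm - l0 * iq + A) * TM := by
  subst ha hb hc
  linear_combination hCp + hCm + (-(bt+dt) + A - l0 * iq) * hC0 - yP * h1 - y0 * h2 - yM * h3 + iq * h4 - E * h5

theorem lamA {q : ℂ} (hq : q ≠ 0) (c : ℂ) (n : ℤ) : lam q c (n+1) - lam q c n * q⁻¹ + (1 + c * q) * (1 - q⁻¹) = (q^2-1) * (c * q ^ n) := by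
  have := z_ne hq n
  rw [lam_eq hq, lam_eq hq, zp q hq]; field_simp; ring
theorem lamB {q : ℂ} (hq : q ≠ 0) (c : ℂ) (n : ℤ) : lam q c (n-1) - lam q c n * q⁻¹ + (1 + c * q) * (1 - q⁻¹) = (q^2-1) * (q * q ^ n)⁻¹ := by
  have := z_ne hq n
  rw [lam_eq hq, lam_eq hq, zm q hq]; field_simp; ring

def AH (q c1 c2 c3 Q : ℂ) : ℂ := c2 * q * (1 + c1) * (1 + c3) + (1 + c2) * (1 / Q + c1 * c2 * c3 * Q * q ^ 2)
def LH (q c1 c2 c3 Q X : ℂ) : ℂ :=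
  X * (AH q c1 c2 c3 Q * c1 * c2 * (1 + q) * X
      - (c1 * c2 * q * (1 + c2) * (1 + c3) + c2 * (1 + c1) * (1 / Q + c1 * c2 * c3 * Q * q ^ 2)) * (1 + c1 * c2 * q * X ^ 2))
    / (q * ((1 - c1 * c2 * X ^ 2) * (1 - c1 * c2 * q ^ 2 * X ^ 2)))
def KH (q c1 c2 c3 Q : ℂ) : ℂ := (1 + c1 * c2 * q) * (1 + c2 * c3 * q) - AH q c1 c2 c3 Q

section
variable (q σ c1 c2 c3 : ℂ) (M x : ℤ) (hq : q ≠ 0) (h1 : c1 ≠ 0) (h2 : c2 ≠ 0) (h3 : c3 ≠ 0) (hσ : σ ≠ 0) (hσ2 : σ ^ 2 = q * c2)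
    (e0 : 1 - c2 * c1 * (q ^ x) ^ 2 ≠ 0) (e1 : 1 - c2 * c1 * q * (q ^ x) ^ 2 ≠ 0) (e2 : 1 - c2 * c1 * q ^ 2 * (q ^ x) ^ 2 ≠ 0)
include hq h1 h2 h3 hσ hσ2 e0 e1 e2

theorem EA :
    (PhiM q c3 c2 c1 (M+1) x * lamM q c1 c2 c3 (M+1) (x+1) - PhiM q c3 c2 c1 (M) x * lamM q c1 c2 c3 (M+1) x * q⁻¹ + (-(1-q⁻¹)*(1+c3)*σ) * PhiMm q σ c3 c2 c1 (M+1) x = (q^2-1) * (-σ*c1*c2*c3*q^(M+1)*q^x*PhiMm q σ c3 c2 c1 (M+1) x)) ∧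
    (-(PhiM q c3 c2 c1 (M+1) x + PhiP q c3 c2 c1 (M+1) x) * lamM q c1 c2 c3 (M+1) x + (PhiM q c3 c2 c1 (M) x + PhiP q c3 c2 c1 (M) x) * lamM q c1 c2 c3 (M+1) x * q⁻¹ + (1 + c3 * c2 * q) * (1 - q⁻¹) * lamM q c1 c2 c3 (M+1) x + (-(1-q⁻¹)*(1+c3)*σ) * PhiM0 q σ c3 c2 c1 (M+1) x = (q^2-1) * (c3*q^M/q^x*FF q c1 c2 x*(1-q^x/q^(M+1))*(1-c1*c2*q^(M+1)*q*q^x))) ∧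
    (PhiP q c3 c2 c1 (M+1) x * lamM q c1 c2 c3 (M+1) (x-1) - PhiP q c3 c2 c1 (M) x * lamM q c1 c2 c3 (M+1) x * q⁻¹ + (-(1-q⁻¹)*(1+c3)*σ) * PhiMp q σ c3 c2 c1 (M+1) x = (q^2-1) * (-σ*c3*q^M/q^x*PhiMp q σ c3 c2 c1 (M+1) x)) ∧
    (PhiM q c3 c2 c1 (M) x * lamP q c1 c2 c3 M (x+1) - PhiM q c3 c2 c1 (M+1) x * lamP q c1 c2 c3 M x * q⁻¹ + (-(1-q⁻¹)*(1+c3)*σ*c1/c3) * PhiPm q σ c3 c2 c1 M x = (q^2-1) * (-σ*c1*q^x/(c3*q^M*q^2)*PhiPm q σ c3 c2 c1 M x)) ∧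
    (-(PhiM q c3 c2 c1 (M) x + PhiP q c3 c2 c1 (M) x) * lamP q c1 c2 c3 M x + (PhiM q c3 c2 c1 (M+1) x + PhiP q c3 c2 c1 (M+1) x) * lamP q c1 c2 c3 M x * q⁻¹ + (1 + c3 * c2 * q) * (1 - q⁻¹) * lamP q c1 c2 c3 M x + (-(1-q⁻¹)*(1+c3)*σ*c1/c3) * PhiP0 q σ c3 c2 c1 M x = (q^2-1) * (-1/(c1*c2*c3*(q^M)^2*q^4)*FF q c1 c2 x*(1-c3*q^M*q/q^x)*(1-c1*c2*c3*q^M*q^2*q^x))) ∧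
    (PhiP q c3 c2 c1 (M) x * lamP q c1 c2 c3 M (x-1) - PhiP q c3 c2 c1 (M+1) x * lamP q c1 c2 c3 M x * q⁻¹ + (-(1-q⁻¹)*(1+c3)*σ*c1/c3) * PhiPp q σ c3 c2 c1 M x = (q^2-1) * (-1/(σ*c3*q^M*q^2*q^x)*PhiPp q σ c3 c2 c1 M x)) ∧
    (PhiM0 q σ c3 c2 c1 (M+1) x * (lam q (c1*c2) x - lam q (c1*c2) x * q⁻¹ + (1 + c1 * c2 * q) * (1 - q⁻¹)) + (-(1-q⁻¹)*(1+c1)*σ) * (-(q ^ M * q)⁻¹ * ((1 - q ^ M * q / q ^ x) * (1 - c2 * c1 * q ^ x * q ^ M * q ^ 2))) = (q^2-1) * (-FF q c1 c2 x * (1 - q^x/q^(M+1)) * (1-c1*c2*q^(M+1)*q*q^x)/(σ*q*q^x))) ∧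
    (PhiP0 q σ c3 c2 c1 M x * (lam q (c1*c2) x - lam q (c1*c2) x * q⁻¹ + (1 + c1 * c2 * q) * (1 - q⁻¹)) + (-(1-q⁻¹)*(1+c1)*σ*c3/c1) * (-(q ^ M * q)⁻¹ / c3 * ((1 - c3 * c2 * c1 * q ^ x * q ^ M * q ^ 2) * (1 - c3 * q ^ M * q / q ^ x))) = (q^2-1) * (FF q c1 c2 x * (1 - c3*q^M*q/q^x) * (1-c1*c2*c3*q^M*q^2*q^x)/(σ*c1*q^M*q^2))) := by
  refine ⟨?_, ?_, ?_, ?_, ?_, ?_, ?_, ?_⟩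
  all_goals
    have hX := z_ne hq x
    have hQ := z_ne hq M
    simp only [FF, Fp, Fm, PhiM, PhiP, lamM, lamP, lam, PhiPm, PhiPp, PhiP0, PhiMm, PhiMp, PhiM0, two_mul, neg_add, neg_sub, zpow_add₀ hq, zpow_sub₀ hq, zpow_neg, zpow_ofNat, zpow_one, pow_one]
    generalize q ^ x = X at *
    generalize q ^ M = Q at *
    simp only [q3 q c2 c1 X,
      r3 q c1 c2 X]
    generalize g0 : 1 - c2 * c1 * X ^ 2 = X0 at *
    generalize g1 : 1 - c2 * c1 * q * X ^ 2 = X1 at *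
    generalize g2 : 1 - c2 * c1 * q ^ 2 * X ^ 2 = X2 at *
    field_simp
    try simp only [hσ2, pw hσ2]
    subst g0 g1 g2
    ring

theorem EB :
    (PhiM q c3 c2 c1 (M) x * lam q (c1*c2) (x+1) - PhiM q c3 c2 c1 (M) x * lam q (c1*c2) x * q⁻¹ + ((1-q⁻¹)*(1+c1*c2*q)) * PhiM q c3 c2 c1 M x = (q^2-1) * (c1*c2*q^x*PhiM q c3 c2 c1 M x)) ∧
    (-(PhiM q c3 c2 c1 (M) x + PhiP q c3 c2 c1 (M) x) * lam q (c1*c2) x + (PhiM q c3 c2 c1 (M) x + PhiP q c3 c2 c1 (M) x) * lam q (c1*c2) x * q⁻¹ + (1 + c3 * c2 * q) * (1 - q⁻¹) * lam q (c1*c2) x + ((1-q⁻¹)*(1+c1*c2*q)) * (-PhiP q c3 c2 c1 M x - PhiM q c3 c2 c1 M x) = (q^2-1) * LH q c1 c2 c3 (q^M) (q^x) - (1-q⁻¹) * KH q c1 c2 c3 (q^M)) ∧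
    (PhiP q c3 c2 c1 (M) x * lam q (c1*c2) (x-1) - PhiP q c3 c2 c1 (M) x * lam q (c1*c2) x * q⁻¹ + ((1-q⁻¹)*(1+c1*c2*q)) * PhiP q c3 c2 c1 M x = (q^2-1) * (1/(q*q^x)*PhiP q c3 c2 c1 M x)) ∧
    ((-PhiP q c3 c2 c1 M x - PhiM q c3 c2 c1 M x) * (lam q (c1*c2) x - lam q (c1*c2) x * q⁻¹ + (1 + c1 * c2 * q) * (1 - q⁻¹)) + ((1-q⁻¹)*(1+c3*c2*q)) * lam q (c1*c2) x = (q^2-1) * LH q c1 c2 c3 (q^M) (q^x) - (1-q⁻¹) * KH q c1 c2 c3 (q^M)) := by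
  refine ⟨?_, ?_, ?_, ?_⟩
  all_goals
    have hX := z_ne hq x
    have hQ := z_ne hq M
    simp only [FF, Fp, Fm, PhiM, PhiP, LH, KH, AH, lamM, lamP, lam, PhiPm, PhiPp, PhiP0, PhiMm, PhiMp, PhiM0, two_mul, neg_add, neg_sub, zpow_add₀ hq, zpow_sub₀ hq, zpow_neg, zpow_ofNat, zpow_one, pow_one]
    generalize q ^ x = X at *
    generalize q ^ M = Q at *
    simp only [show 1 - c1 * c2 * X ^ 2 = 1 - c2 * c1 * X ^ 2 by ring, show 1 - c1 * c2 * q ^ 2 * X ^ 2 = 1 - c2 * c1 * q ^ 2 * X ^ 2 by ring, q3 q c2 c1 X,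
      r3 q c1 c2 X]
    generalize g0 : 1 - c2 * c1 * X ^ 2 = X0 at *
    generalize g1 : 1 - c2 * c1 * q * X ^ 2 = X1 at *
    generalize g2 : 1 - c2 * c1 * q ^ 2 * X ^ 2 = X2 at *
    field_simp
    try simp only [hσ2, pw hσ2]
    subst g0 g1 g2
    ring

end

theorem KH_symm (q c1 c2 c3 Q : ℂ) : KH q c3 c2 c1 Q = KH q c1 c2 c3 Q := by simp only [KH, AH]; ring

theorem lamM_self (q c1 c2 c3 : ℂ) (N : ℤ) : lamM q c1 c2 c3 N N = 0 := by simp [lamM]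
theorem PhiM_self (q c1 c2 c3 : ℂ) (N : ℤ) : PhiM q c1 c2 c3 N N = 0 := by simp [PhiM]

section
variable {q s c1 c2 c3 t2 : ℂ} {T : ℕ} (h : Gen q s c1 c2 c3 t2 T)
include h

theorem EM (M n x : ℤ) (hM : M + 1 ≤ T)
    (h0 : 0 ≤ n) (h1 : n ≤ M) (h2 : 0 ≤ x) (h3 : x ≤ M + 1) : (q^2-1) * (
    -(s*t2)*c1*c2*c3*q^(M+1)*q^x*PhiMm q (s*t2) c3 c2 c1 (M+1) x * p q s c1 c2 c3 t2 M n (x+1)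
    + c3*q^M/q^x*FF q c1 c2 x*(1-q^x/q^(M+1))*(1-c1*c2*q^(M+1)*q*q^x) * p q s c1 c2 c3 t2 M n x
    + -(s*t2)*c3*q^M/q^x*PhiMp q (s*t2) c3 c2 c1 (M+1) x * p q s c1 c2 c3 t2 M n (x-1)) =
    (q^2-1) * (PhiMp q (s*t2) c1 c2 c3 (M+1) (n+1) * (c3 * c2 * q ^ n) * p q s c1 c2 c3 t2 (M+1) (n+1) x
    + -FF q c3 c2 n * (1 - q^n/q^(M+1)) * (1-c3*c2*q^(M+1)*q*q^n)/((s*t2)*q*q^n) * p q s c1 c2 c3 t2 (M+1) n x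
    + PhiMm q (s*t2) c1 c2 c3 (M+1) (n-1) * (q * q ^ n)⁻¹ * p q s c1 c2 c3 t2 (M+1) (n-1) x) := by
  have hq := h.hq
  have g := h.symm
  have D := fun n => Dp h (M+1) n x (by omega) h2 (by omega)
  have D4 : lamM q c1 c2 c3 (M+1) x * (lam q (c3 * c2) n * p q s c1 c2 c3 t2 M n x) = lamM q c1 c2 c3 (M+1) x * (
      PhiM q c3 c2 c1 M x * (p q s c1 c2 c3 t2 M n (x+1) - p q s c1 c2 c3 t2 M n x)
      + PhiP q c3 c2 c1 M x * (p q s c1 c2 c3 t2 M n (x-1) - p q s c1 c2 c3 t2 M n x)) := by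
    rcases h3.eq_or_lt with h3 | h3
    · rw [h3, lamM_self]; ring
    · rw [Dp h M n x (by omega) h2 (by omega)]
  have e0 := g.e0 x h2 (by omega)
  have e1 := g.e1 x h2 (by omega)
  have e2 := g.e2 x h2 (by omega)
  have f0 := h.e0 n h0 (by omega)
  have f1 := h.e1 n h0 (by omega)
  have f2 := h.e2 n h0 (by omega)
  have key := Eabs (iq := q⁻¹) (A := (1 + c3 * c2 * q) * (1 - q⁻¹))
    (CM h M n x hM h0 h1) (congrArg (PhiM q c3 c2 c1 (M+1) x * ·) (CM h M n (x+1) hM h0 h1))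
    (congrArg (PhiP q c3 c2 c1 (M+1) x * ·) (CM h M n (x-1) hM h0 h1)) (D (n+1)) (D n) (D (n-1)) D4
    (DM h M n x hM (by omega) h2 h3)
    (EA q (s*t2) c1 c2 c3 M x hq h.h1 h.h2 h.h3 h.hst h.hst2 e0 e1 e2).1
    (EA q (s*t2) c1 c2 c3 M x hq h.h1 h.h2 h.h3 h.hst h.hst2 e0 e1 e2).2.1
    (EA q (s*t2) c1 c2 c3 M x hq h.h1 h.h2 h.h3 h.hst h.hst2 e0 e1 e2).2.2.1
  rw [lamA hq, lamB hq, (EA q (s*t2) c3 c2 c1 M n hq h.h3 h.h2 h.h1 h.hst h.hst2 f0 f1 f2).2.2.2.2.2.2.1] at key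
  linear_combination key

theorem EP (M n x : ℤ) (hM : M + 1 ≤ T)
    (h0 : 0 ≤ n) (h1 : n ≤ M + 1) (h2 : 0 ≤ x) (h3 : x ≤ M) : (q^2-1) * (
    -(s*t2)*c1*q^x/(c3*q^M*q^2)*PhiPm q (s*t2) c3 c2 c1 M x * p q s c1 c2 c3 t2 (M+1) n (x+1)
    + -1/(c1*c2*c3*(q^M)^2*q^4)*FF q c1 c2 x*(1-c3*q^M*q/q^x)*(1-c1*c2*c3*q^M*q^2*q^x) * p q s c1 c2 c3 t2 (M+1) n x
    + -1/((s*t2)*c3*q^M*q^2*q^x)*PhiPp q (s*t2) c3 c2 c1 M x * p q s c1 c2 c3 t2 (M+1) n (x-1)) =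
    (q^2-1) * (PhiPp q (s*t2) c1 c2 c3 M (n+1) * (c3 * c2 * q ^ n) * p q s c1 c2 c3 t2 M (n+1) x
    + FF q c3 c2 n * (1 - c1*q^M*q/q^n) * (1-c3*c2*c1*q^M*q^2*q^n)/((s*t2)*c3*q^M*q^2) * p q s c1 c2 c3 t2 M n x
    + PhiPm q (s*t2) c1 c2 c3 M (n-1) * (q * q ^ n)⁻¹ * p q s c1 c2 c3 t2 M (n-1) x) := by
  have hq := h.hq
  have g := h.symm
  have D := fun n => Dp h M n x (by omega) h2 (by omega)
  have D4 := congrArg (lamP q c1 c2 c3 M x * ·) (Dp h (M+1) n x (by omega) h2 (by omega))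
  have C1 : PhiM q c3 c2 c1 M x * (lamP q c1 c2 c3 M (x+1) * p q s c1 c2 c3 t2 (M+1) n (x+1)) = PhiM q c3 c2 c1 M x * (
      PhiPp q (s * t2) c1 c2 c3 M (n+1) * p q s c1 c2 c3 t2 M (n+1) (x+1)
      + PhiP0 q (s * t2) c1 c2 c3 M n * p q s c1 c2 c3 t2 M n (x+1)
      + PhiPm q (s * t2) c1 c2 c3 M (n-1) * p q s c1 c2 c3 t2 M (n-1) (x+1)) := by
    rcases h3.eq_or_lt with h3 | h3
    · rw [h3, PhiM_self]; ring
    · rw [CP h M n (x+1) hM h0 h1 (by omega) (by omega)]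
  have e0 := g.e0 x h2 (by omega)
  have e1 := g.e1 x h2 (by omega)
  have e2 := g.e2 x h2 (by omega)
  have f0 := h.e0 n h0 (by omega)
  have f1 := h.e1 n h0 (by omega)
  have f2 := h.e2 n h0 (by omega)
  have key := Eabs (iq := q⁻¹) (A := (1 + c3 * c2 * q) * (1 - q⁻¹))
    (CP h M n x hM h0 h1 (by omega) h3) C1
    (congrArg (PhiP q c3 c2 c1 M x * ·) (CP h M n (x-1) hM h0 h1 (by omega) (by omega))) (D (n+1)) (D n) (D (n-1)) D4
    (DP h M n x hM h2 h3)
    (EA q (s*t2) c1 c2 c3 M x hq h.h1 h.h2 h.h3 h.hst h.hst2 e0 e1 e2).2.2.2.1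
    (EA q (s*t2) c1 c2 c3 M x hq h.h1 h.h2 h.h3 h.hst h.hst2 e0 e1 e2).2.2.2.2.1
    (EA q (s*t2) c1 c2 c3 M x hq h.h1 h.h2 h.h3 h.hst h.hst2 e0 e1 e2).2.2.2.2.2.1
  rw [lamA hq, lamB hq, (EA q (s*t2) c3 c2 c1 M n hq h.h3 h.h2 h.h1 h.hst h.hst2 f0 f1 f2).2.2.2.2.2.2.2] at key
  linear_combination key

theorem EZ (M n x : ℤ) (hM : M ≤ T)
    (h0 : 0 ≤ n) (h1 : n ≤ M) (h2 : 0 ≤ x) (h3 : x ≤ M) : (q^2-1) * (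
    c1*c2*q^x*PhiM q c3 c2 c1 M x * p q s c1 c2 c3 t2 M n (x+1)
    + LH q c1 c2 c3 (q^M) (q^x) * p q s c1 c2 c3 t2 M n x
    + 1/(q*q^x)*PhiP q c3 c2 c1 M x * p q s c1 c2 c3 t2 M n (x-1)) =
    (q^2-1) * (PhiP q c1 c2 c3 M (n+1) * (c3 * c2 * q ^ n) * p q s c1 c2 c3 t2 M (n+1) x
    + LH q c3 c2 c1 (q^M) (q^n) * p q s c1 c2 c3 t2 M n x
    + PhiM q c1 c2 c3 M (n-1) * (q * q ^ n)⁻¹ * p q s c1 c2 c3 t2 M (n-1) x) := by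
  have hq := h.hq
  have g := h.symm
  have D := fun n => Dp h M n x (by omega) h2 (by omega)
  have D4 := congrArg (lam q (c1*c2) x * ·) (D n)
  have D5 : lam q (c3 * c2) n * p q s c1 c2 c3 t2 M n x =
      PhiM q c3 c2 c1 M x * p q s c1 c2 c3 t2 M n (x+1) + (-PhiP q c3 c2 c1 M x - PhiM q c3 c2 c1 M x) * p q s c1 c2 c3 t2 M n x
      + PhiP q c3 c2 c1 M x * p q s c1 c2 c3 t2 M n (x-1) := by linear_combination D n
  have e0 := g.e0 x h2 (by omega)
  have e1 := g.e1 x h2 (by omega)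
  have e2 := g.e2 x h2 (by omega)
  have f0 := h.e0 n h0 (by omega)
  have f1 := h.e1 n h0 (by omega)
  have f2 := h.e2 n h0 (by omega)
  have key := Eabs (iq := q⁻¹) (A := (1 + c3 * c2 * q) * (1 - q⁻¹))
    (Rp h M n x hM h0 h1) (congrArg (PhiM q c3 c2 c1 M x * ·) (Rp h M n (x+1) hM h0 h1))
    (congrArg (PhiP q c3 c2 c1 M x * ·) (Rp h M n (x-1) hM h0 h1)) (D (n+1)) (D n) (D (n-1)) D4
    D5
    (EB q (s*t2) c1 c2 c3 M x hq h.h1 h.h2 h.h3 h.hst h.hst2 e0 e1 e2).1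
    (EB q (s*t2) c1 c2 c3 M x hq h.h1 h.h2 h.h3 h.hst h.hst2 e0 e1 e2).2.1
    (EB q (s*t2) c1 c2 c3 M x hq h.h1 h.h2 h.h3 h.hst h.hst2 e0 e1 e2).2.2.1
  rw [lamA hq, lamB hq, (EB q (s*t2) c3 c2 c1 M n hq h.h3 h.h2 h.h1 h.hst h.hst2 f0 f1 f2).2.2.2, KH_symm] at key
  linear_combination key

end

theorem p000 (q s c1 c2 c3 t2 : ℂ) (h : 1 - c2 * c3 * q ≠ 0) : p q s c1 c2 c3 t2 0 0 0 = 1 := by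
  simp [p, Om, binom, poch, h]
theorem p10 (q s c1 c2 c3 t2 : ℂ) (x : ℤ) (hx : 0 ≤ x ∧ x ≤ 1) (hq1 : 1 - q ≠ 0) (h : 1 - c2 * c3 * q ≠ 0) (h2 : 1 - c2 * c3 * q ^ 2 ≠ 0) :
    p q s c1 c2 c3 t2 1 0 x = (1 - q * c1) * (s * t2) / (1 - c2 * c3 * q ^ 2) := by
  rw [p, if_pos ⟨by norm_num, by norm_num, hx⟩]
  simp [Om, binom, poch, Finset.prod_range_succ, hq1]
  have h2' : 1 - c2 * c3 * q * q ≠ 0 := by convert h2 using 2; ring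
  rw [show 1 - c2 * c3 * q ^ 2 = 1 - c2 * c3 * q * q by ring]
  field_simp
theorem p11 (q s c1 c2 c3 t2 : ℂ) (hq : q ≠ 0) (hq1 : 1 - q ≠ 0) (h : 1 - c2 * c3 * q ^ 3 ≠ 0) (h2 : 1 - c2 * c3 * q ^ 2 ≠ 0) :
    p q s c1 c2 c3 t2 1 1 0 = (1 - q * c2) * (1 - c1 * c2 * c3 * q ^ 3) / ((s * t2) * (1 - c2 * c3 * q ^ 2) * (1 - q * c3)) := by
  rw [p, if_pos ⟨by norm_num, by norm_num, by norm_num, by norm_num⟩]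
  simp [Om, binom, poch, Finset.prod_range_succ, hq1, Finset.sum_range_succ]
  simp only [← zpow_natCast, show (3 : ℤ) = ((3:ℕ) : ℤ) from rfl]
  simp only [zpow_natCast, zpow_ofNat]
  rw [show 1 - c2 * c3 * q ^ 2 * q = 1 - c2 * c3 * q ^ 3 by ring]
  generalize 1 - c2 * c3 * q ^ 3 = A at *
  field_simp
theorem p11' (q s c1 c2 c3 t2 : ℂ) (hq : q ≠ 0) (hq1 : 1 - q ≠ 0) (h : 1 - c2 * c3 * q ^ 3 ≠ 0) (h2 : 1 - c2 * c3 * q ^ 2 ≠ 0)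
   (h3 : 1 - q * c2 ≠ 0) (h4 : 1 - c1 * c2 * c3 * q ^ 3 ≠ 0) :
    p q s c1 c2 c3 t2 1 1 1 = ((1 - q * c2) * (1 - c1 * c2 * c3 * q ^ 3) - (1 - c2 * c3 * q ^ 2) * (1 - c1 * c2 * q ^ 2)) / ((s * t2) * (1 - c2 * c3 * q ^ 2) * (1 - q * c3)) := by
  have e : 1 - q⁻¹ ≠ 0 := by
    intro h; apply hq1; field_simp at h; linear_combination -h
  rw [p, if_pos ⟨by norm_num, by norm_num, by norm_num, by norm_num⟩]
  simp [Om, binom, poch, Finset.prod_range_succ, hq1, Finset.sum_range_succ]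
  simp only [← zpow_natCast, show (3 : ℤ) = ((3:ℕ) : ℤ) from rfl]
  simp only [zpow_natCast, zpow_ofNat]
  rw [show 1 - c2 * c3 * q ^ 2 * q = 1 - c2 * c3 * q ^ 3 by ring]
  generalize 1 - c2 * c3 * q ^ 3 = A at *
  generalize 1 - c2 * c3 * q ^ 2 = A at *
  generalize 1 - c1 * c2 * c3 * q ^ 3 = A at *
  rw [show q⁻¹ = (1 - q) / q + 1 by field_simp; ring]
  generalize hh : 1 - q = B at *
  generalize 1 - q * c2 = A at *
  generalize 1 - c1 * c2 * q ^ 2 = A at *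
  rcases eq_or_ne (1 - q * c3) 0 with h | h
  · rw [h]; simp
  generalize 1 - q * c3 = A at *
  rcases eq_or_ne (s * t2) 0 with h | h
  · rw [h]; simp
  generalize s * t2 = A at *
  field_simp
  ring

theorem EZ00 (q c1 c2 c3 : ℂ) (hq : q ≠ 0) (h1 : 1 - c1 * c2 ≠ 0)  (h2 : 1 - c1 * c2 * q ^ 2 ≠ 0) (h3 : 1 - c3 * c2 ≠ 0)  (h4 : 1 - c3 * c2 * q ^ 2 ≠ 0) :
    LH q c1 c2 c3 1 1 = LH q c3 c2 c1 1 1 := by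
  simp only [LH, AH, one_pow, mul_one, one_mul]
  generalize g1 : 1 - c1 * c2 = A at *
  generalize g2 : 1 - c1 * c2 * q ^ 2 = A at *
  generalize g3 : 1 - c3 * c2 = A at *
  generalize g4 : 1 - c3 * c2 * q ^ 2 = A at *
  field_simp
  subst g1 g2 g3 g4
  ring

section
variable {q s c1 c2 c3 t2 : ℂ} {T : ℕ} (h : Gen q s c1 c2 c3 t2 T)
include h

theorem EM' (M n x : ℤ) (hM : M + 1 ≤ T)
    (h0 : 0 ≤ n) (h1 : n ≤ M) (h2 : 0 ≤ x) (h3 : x ≤ M + 1) : (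
    -(s*t2)*c1*c2*c3*q^(M+1)*q^x*PhiMm q (s*t2) c3 c2 c1 (M+1) x * p q s c1 c2 c3 t2 M n (x+1)
    + c3*q^M/q^x*FF q c1 c2 x*(1-q^x/q^(M+1))*(1-c1*c2*q^(M+1)*q*q^x) * p q s c1 c2 c3 t2 M n x
    + -(s*t2)*c3*q^M/q^x*PhiMp q (s*t2) c3 c2 c1 (M+1) x * p q s c1 c2 c3 t2 M n (x-1)) =
    (PhiMp q (s*t2) c1 c2 c3 (M+1) (n+1) * (c3 * c2 * q ^ n) * p q s c1 c2 c3 t2 (M+1) (n+1) x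
    + -FF q c3 c2 n * (1 - q^n/q^(M+1)) * (1-c3*c2*q^(M+1)*q*q^n)/((s*t2)*q*q^n) * p q s c1 c2 c3 t2 (M+1) n x
    + PhiMm q (s*t2) c1 c2 c3 (M+1) (n-1) * (q * q ^ n)⁻¹ * p q s c1 c2 c3 t2 (M+1) (n-1) x) := by
  rcases eq_or_ne (q^2-1) 0 with hq2 | hq2
  swap
  · exact mul_left_cancel₀ hq2 (EM h M n x hM h0 h1 h2 h3)
  have hT : ¬ (2 ≤ T) := fun hT => h.hk 2 (by norm_num) hT (by linear_combination -hq2)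
  have hst := h.hst
  have hst2 := h.hst2
  obtain rfl : M = 0 := by omega
  obtain rfl : n = 0 := by omega
  have hqm : q = -1 := by
    have := h.hk 1 le_rfl (by omega)
    rw [pow_one] at this
    apply mul_left_cancel₀ this
    linear_combination -hq2
  have a1 := h.g1 1 (by omega)
  have b1 := h.g2 1 (by omega)
  have d1 := h.g3 1 (by omega)
  have u0 := h.g12 0 (by omega)
  have u1 := h.g12 1 (by omega)
  have v0 := h.g23 0 (by omega)
  have v1 := h.g23 1 (by omega)
  have w1 := h.g123 1 (by omega)
  have c1z := h.h1
  have c2z := h.h2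
  have c3z := h.h3
  have X0 := p000 q s c1 c2 c3 t2 (po (h.g23 1 (by omega)))
  have X1 := fun x hx => p10 q s c1 c2 c3 t2 x hx (pk (h.hk 1 le_rfl (by omega))) (po (h.g23 1 (by omega))) (h.g23 2 (by omega))
  have X10 := X1 0 (by norm_num)
  have X11 := X1 1 (by norm_num)
  have X2 := p11 q s c1 c2 c3 t2 h.hq (pk (h.hk 1 le_rfl (by omega))) (h.g23 3 (by omega)) (h.g23 2 (by omega))
  have X3 := p11' q s c1 c2 c3 t2 h.hq (pk (h.hk 1 le_rfl (by omega))) (h.g23 3 (by omega)) (h.g23 2 (by omega))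
     (by rw [mul_comm]; simpa using b1) (h.g123 3 (by omega))
  clear h X1 hq2
  subst hqm
  have hx : x = 0 ∨ x = 1 := by omega
  rcases hx with rfl | rfl
  all_goals
    obtain ⟨e1, e2, e3, e4⟩ := m3
    simp only [zpow_neg, FF, Fp, Fm, LH, AH, PhiM, PhiP, PhiPm, PhiPp, PhiP0, PhiMm, PhiMp, PhiM0, X0, X10, X11, X2, X3]
    simp [p_out, X0, X10, X11, X2, X3, e1, e2, e3, e4]
    simp only [pow_zero, pow_one, mul_one, mul_neg, sub_neg_eq_add] at a1 b1 d1 u0 u1 v0 v1 w1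
    simp only [mul_neg, sub_neg_eq_add, mul_one, e1, e2, e3, e4, mul_comm c2 c1, mul_comm c3 c2, show c1 * c2 - 1 = -(1 - c1*c2) by ring, show c2 * c3 - 1 = -(1 - c2*c3) by ring, show c2 * c3 + 1 = (1 + c2*c3) by ring, show c1 * c2 + 1 = (1 + c1*c2) by ring, show c3 * c1 * c2 = c1 * c2 * c3 by ring, show c3 * (c1 * c2) = c1 * c2 * c3 by ring]
    generalize s * t2 = σ at *
    generalize g1 : 1 + c1 = A1 at *
    generalize g2 : 1 + c3 = A3 at *
    generalize g3 : 1 - c1 * c2 = U0 at *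
    generalize g4 : 1 + c1 * c2 = U1 at *
    generalize g5 : 1 - c2 * c3 = V0 at *
    generalize g6 : 1 + c2 * c3 = V1 at *
    field_simp
    try simp only [hst2, pw hst2]
    subst g1 g2 g3 g4 g5 g6
    ring

theorem EP' (M n x : ℤ) (hM : M + 1 ≤ T)
    (h0 : 0 ≤ n) (h1 : n ≤ M + 1) (h2 : 0 ≤ x) (h3 : x ≤ M) : (
    -(s*t2)*c1*q^x/(c3*q^M*q^2)*PhiPm q (s*t2) c3 c2 c1 M x * p q s c1 c2 c3 t2 (M+1) n (x+1)
    + -1/(c1*c2*c3*(q^M)^2*q^4)*FF q c1 c2 x*(1-c3*q^M*q/q^x)*(1-c1*c2*c3*q^M*q^2*q^x) * p q s c1 c2 c3 t2 (M+1) n x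
    + -1/((s*t2)*c3*q^M*q^2*q^x)*PhiPp q (s*t2) c3 c2 c1 M x * p q s c1 c2 c3 t2 (M+1) n (x-1)) =
    (PhiPp q (s*t2) c1 c2 c3 M (n+1) * (c3 * c2 * q ^ n) * p q s c1 c2 c3 t2 M (n+1) x
    + FF q c3 c2 n * (1 - c1*q^M*q/q^n) * (1-c3*c2*c1*q^M*q^2*q^n)/((s*t2)*c3*q^M*q^2) * p q s c1 c2 c3 t2 M n x
    + PhiPm q (s*t2) c1 c2 c3 M (n-1) * (q * q ^ n)⁻¹ * p q s c1 c2 c3 t2 M (n-1) x) := by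
  rcases eq_or_ne (q^2-1) 0 with hq2 | hq2
  swap
  · exact mul_left_cancel₀ hq2 (EP h M n x hM h0 h1 h2 h3)
  have hT : ¬ (2 ≤ T) := fun hT => h.hk 2 (by norm_num) hT (by linear_combination -hq2)
  have hst := h.hst
  have hst2 := h.hst2
  obtain rfl : M = 0 := by omega
  obtain rfl : x = 0 := by omega
  have hqm : q = -1 := by
    have := h.hk 1 le_rfl (by omega)
    rw [pow_one] at this
    apply mul_left_cancel₀ this
    linear_combination -hq2
  have a1 := h.g1 1 (by omega)
  have b1 := h.g2 1 (by omega)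
  have d1 := h.g3 1 (by omega)
  have u0 := h.g12 0 (by omega)
  have u1 := h.g12 1 (by omega)
  have v0 := h.g23 0 (by omega)
  have v1 := h.g23 1 (by omega)
  have w1 := h.g123 1 (by omega)
  have c1z := h.h1
  have c2z := h.h2
  have c3z := h.h3
  have X0 := p000 q s c1 c2 c3 t2 (po (h.g23 1 (by omega)))
  have X1 := fun x hx => p10 q s c1 c2 c3 t2 x hx (pk (h.hk 1 le_rfl (by omega))) (po (h.g23 1 (by omega))) (h.g23 2 (by omega))
  have X10 := X1 0 (by norm_num)
  have X11 := X1 1 (by norm_num)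
  have X2 := p11 q s c1 c2 c3 t2 h.hq (pk (h.hk 1 le_rfl (by omega))) (h.g23 3 (by omega)) (h.g23 2 (by omega))
  have X3 := p11' q s c1 c2 c3 t2 h.hq (pk (h.hk 1 le_rfl (by omega))) (h.g23 3 (by omega)) (h.g23 2 (by omega))
     (by rw [mul_comm]; simpa using b1) (h.g123 3 (by omega))
  clear h X1 hq2
  subst hqm
  have hx : n = 0 ∨ n = 1 := by omega
  rcases hx with rfl | rfl
  all_goals
    obtain ⟨e1, e2, e3, e4⟩ := m3
    simp only [zpow_neg, FF, Fp, Fm, LH, AH, PhiM, PhiP, PhiPm, PhiPp, PhiP0, PhiMm, PhiMp, PhiM0, X0, X10, X11, X2, X3]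
    simp [p_out, X0, X10, X11, X2, X3, e1, e2, e3, e4]
    simp only [pow_zero, pow_one, mul_one, mul_neg, sub_neg_eq_add] at a1 b1 d1 u0 u1 v0 v1 w1
    simp only [mul_neg, sub_neg_eq_add, mul_one, e1, e2, e3, e4, mul_comm c2 c1, mul_comm c3 c2, show c1 * c2 - 1 = -(1 - c1*c2) by ring, show c2 * c3 - 1 = -(1 - c2*c3) by ring, show c2 * c3 + 1 = (1 + c2*c3) by ring, show c1 * c2 + 1 = (1 + c1*c2) by ring, show c3 * c1 * c2 = c1 * c2 * c3 by ring, show c3 * (c1 * c2) = c1 * c2 * c3 by ring]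
    generalize s * t2 = σ at *
    generalize g1 : 1 + c1 = A1 at *
    generalize g2 : 1 + c3 = A3 at *
    generalize g3 : 1 - c1 * c2 = U0 at *
    generalize g4 : 1 + c1 * c2 = U1 at *
    generalize g5 : 1 - c2 * c3 = V0 at *
    generalize g6 : 1 + c2 * c3 = V1 at *
    field_simp
    try simp only [hst2, pw hst2]
    subst g1 g2 g3 g4 g5 g6
    ring

theorem EZ' (M n x : ℤ) (hM : M ≤ T)
    (h0 : 0 ≤ n) (h1 : n ≤ M) (h2 : 0 ≤ x) (h3 : x ≤ M) : (
    c1*c2*q^x*PhiM q c3 c2 c1 M x * p q s c1 c2 c3 t2 M n (x+1)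
    + LH q c1 c2 c3 (q^M) (q^x) * p q s c1 c2 c3 t2 M n x
    + 1/(q*q^x)*PhiP q c3 c2 c1 M x * p q s c1 c2 c3 t2 M n (x-1)) =
    (PhiP q c1 c2 c3 M (n+1) * (c3 * c2 * q ^ n) * p q s c1 c2 c3 t2 M (n+1) x
    + LH q c3 c2 c1 (q^M) (q^n) * p q s c1 c2 c3 t2 M n x
    + PhiM q c1 c2 c3 M (n-1) * (q * q ^ n)⁻¹ * p q s c1 c2 c3 t2 M (n-1) x) := by
  rcases eq_or_ne (q^2-1) 0 with hq2 | hq2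
  swap
  · exact mul_left_cancel₀ hq2 (EZ h M n x hM h0 h1 h2 h3)
  have hT : ¬ (2 ≤ T) := fun hT => h.hk 2 (by norm_num) hT (by linear_combination -hq2)
  have hst := h.hst
  have hst2 := h.hst2
  rcases lt_or_ge 0 M with hM0 | hM0
  swap
  · obtain rfl : M = 0 := by omega
    obtain rfl : x = 0 := by omega
    obtain rfl : n = 0 := by omega
    have := EZ00 q c1 c2 c3 h.hq (by simpa using h.g12 0 (by omega)) (h.g12 2 (by omega)) (by rw [mul_comm c3 c2]; simpa using h.g23 0 (by omega)) (by rw [mul_comm c3 c2]; exact h.g23 2 (by omega))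
    simp [p_out, this]
  obtain rfl : M = 1 := by omega
  have hqm : q = -1 := by
    have := h.hk 1 le_rfl (by omega)
    rw [pow_one] at this
    apply mul_left_cancel₀ this
    linear_combination -hq2
  have a1 := h.g1 1 (by omega)
  have b1 := h.g2 1 (by omega)
  have d1 := h.g3 1 (by omega)
  have u0 := h.g12 0 (by omega)
  have u1 := h.g12 1 (by omega)
  have v0 := h.g23 0 (by omega)
  have v1 := h.g23 1 (by omega)
  have w1 := h.g123 1 (by omega)
  have c1z := h.h1
  have c2z := h.h2
  have c3z := h.h3
  have X0 := p000 q s c1 c2 c3 t2 (po (h.g23 1 (by omega)))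
  have X1 := fun x hx => p10 q s c1 c2 c3 t2 x hx (pk (h.hk 1 le_rfl (by omega))) (po (h.g23 1 (by omega))) (h.g23 2 (by omega))
  have X10 := X1 0 (by norm_num)
  have X11 := X1 1 (by norm_num)
  have X2 := p11 q s c1 c2 c3 t2 h.hq (pk (h.hk 1 le_rfl (by omega))) (h.g23 3 (by omega)) (h.g23 2 (by omega))
  have X3 := p11' q s c1 c2 c3 t2 h.hq (pk (h.hk 1 le_rfl (by omega))) (h.g23 3 (by omega)) (h.g23 2 (by omega))
     (by rw [mul_comm]; simpa using b1) (h.g123 3 (by omega))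
  clear h X1 hq2
  subst hqm
  have hx : x = 0 ∨ x = 1 := by omega
  have hy : n = 0 ∨ n = 1 := by omega
  rcases hy with rfl | rfl <;> rcases hx with rfl | rfl
  all_goals
    obtain ⟨e1, e2, e3, e4⟩ := m3
    simp only [zpow_neg, FF, Fp, Fm, LH, AH, PhiM, PhiP, PhiPm, PhiPp, PhiP0, PhiMm, PhiMp, PhiM0, X0, X10, X11, X2, X3]
    simp [p_out, X0, X10, X11, X2, X3, e1, e2, e3, e4]
    simp only [pow_zero, pow_one, mul_one, mul_neg, sub_neg_eq_add] at a1 b1 d1 u0 u1 v0 v1 w1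
    simp only [mul_neg, sub_neg_eq_add, mul_one, e1, e2, e3, e4, mul_comm c2 c1, mul_comm c3 c2, show c1 * c2 - 1 = -(1 - c1*c2) by ring, show c2 * c3 - 1 = -(1 - c2*c3) by ring, show c2 * c3 + 1 = (1 + c2*c3) by ring, show c1 * c2 + 1 = (1 + c1*c2) by ring, show c3 * c1 * c2 = c1 * c2 * c3 by ring, show c3 * (c1 * c2) = c1 * c2 * c3 by ring]
    generalize s * t2 = σ at *
    generalize g1 : 1 + c1 = A1 at *
    generalize g2 : 1 + c3 = A3 at *
    generalize g3 : 1 - c1 * c2 = U0 at *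
    generalize g4 : 1 + c1 * c2 = U1 at *
    generalize g5 : 1 - c2 * c3 = V0 at *
    generalize g6 : 1 + c2 * c3 = V1 at *
    field_simp
    try simp only [hst2, pw hst2]
    subst g1 g2 g3 g4 g5 g6
    ring

end

section
variable {q s c1 c2 c3 c4 c0 t2 : ℂ} {N : ℤ}

theorem App (hc0 : (q ^ (2 * N + 3) * c1 * c2 * c3 * c4)⁻¹ = c0) (i j : ℤ) : A q s c1 c2 c3 c4 t2 N 1 1 i j = -c3 * q ^ (N+1) * Fp q c4 c0 j * PhiPp q (s*t2) c1 c2 c3 (N-j) i := by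
  simp [A, Aaux, hc0, PhiC]
theorem A0p (hc0 : (q ^ (2 * N + 3) * c1 * c2 * c3 * c4)⁻¹ = c0) (i j : ℤ) : A q s c1 c2 c3 c4 t2 N 0 1 i j = -c3 * q ^ (N+1) * Fp q c4 c0 j * PhiP0 q (s*t2) c1 c2 c3 (N-j) i := by
  simp [A, Aaux, hc0, PhiC]
theorem Amp (hc0 : (q ^ (2 * N + 3) * c1 * c2 * c3 * c4)⁻¹ = c0) (i j : ℤ) : A q s c1 c2 c3 c4 t2 N (-1) 1 i j = -c3 * q ^ (N+1) * Fp q c4 c0 j * PhiPm q (s*t2) c1 c2 c3 (N-j) i := by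
  simp [A, Aaux, hc0, PhiC]
theorem Apm (hc0 : (q ^ (2 * N + 3) * c1 * c2 * c3 * c4)⁻¹ = c0) (i j : ℤ) : A q s c1 c2 c3 c4 t2 N 1 (-1) i j = -c3 * q ^ (N+1) * Fm q c4 c0 j * PhiMp q (s*t2) c1 c2 c3 (N-j) i := by
  simp [A, Aaux, hc0, PhiC]
theorem A0m (hc0 : (q ^ (2 * N + 3) * c1 * c2 * c3 * c4)⁻¹ = c0) (i j : ℤ) : A q s c1 c2 c3 c4 t2 N 0 (-1) i j = -c3 * q ^ (N+1) * Fm q c4 c0 j * PhiM0 q (s*t2) c1 c2 c3 (N-j) i := by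
  simp [A, Aaux, hc0, PhiC]
theorem Amm (hc0 : (q ^ (2 * N + 3) * c1 * c2 * c3 * c4)⁻¹ = c0) (i j : ℤ) : A q s c1 c2 c3 c4 t2 N (-1) (-1) i j = -c3 * q ^ (N+1) * Fm q c4 c0 j * PhiMm q (s*t2) c1 c2 c3 (N-j) i := by
  simp [A, Aaux, hc0, PhiC]
theorem Ap0 (hc0 : (q ^ (2 * N + 3) * c1 * c2 * c3 * c4)⁻¹ = c0) (i j : ℤ) : A q s c1 c2 c3 c4 t2 N 1 0 i j = c3 * q ^ (N+1) * FF q c4 c0 j * PhiP q c1 c2 c3 (N-j) i := by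
  simp [A, Aaux, hc0, Phi, FF]
theorem Am0 (hc0 : (q ^ (2 * N + 3) * c1 * c2 * c3 * c4)⁻¹ = c0) (i j : ℤ) : A q s c1 c2 c3 c4 t2 N (-1) 0 i j = c3 * q ^ (N+1) * FF q c4 c0 j * PhiM q c1 c2 c3 (N-j) i := by
  simp [A, Aaux, hc0, Phi, FF]
theorem A00 (hc0 : (q ^ (2 * N + 3) * c1 * c2 * c3 * c4)⁻¹ = c0) (i j : ℤ) (hq : q ≠ 0) (h3 : c3 ≠ 0) (hst : s * t2 ≠ 0) (n1 : 1 - c1*c2*q^(N+2-j) ≠ 0) (n2 : 1 - c3*q^(N-j) ≠ 0) :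
    A q s c1 c2 c3 c4 t2 N 0 0 i j = c3 * q ^ (N+1) * FF q c4 c0 j * (-PhiP q c1 c2 c3 (N-j) i - PhiM q c1 c2 c3 (N-j) i)
     + c3 * q ^ (N+1) * (Fp q c4 c0 j * lamP q c1 c2 c3 (N-j) 0 + Fm q c4 c0 j * lamM q c1 c2 c3 (N-j) 0) := by
  have e : ∀ f : ℤ → ℂ, ∑ e ∈ ({-1, 0, 1} : Finset ℤ), f e = f (-1) + f 0 + f 1 := by
    intro f; rw [Finset.sum_insert (by decide), Finset.sum_insert (by decide), Finset.sum_singleton]; ring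
  have e' : ∀ f : ℤ → ℂ, ∑ e ∈ ({-1, 1} : Finset ℤ), f e = f (-1) + f 1 := by
    intro f; rw [Finset.sum_insert (by decide), Finset.sum_singleton]
  rw [A, if_pos ⟨rfl, rfl⟩, e, e, e']
  simp only [Aaux, hc0, PhiC, Phi, PhiP0, PhiM0, FF]
  simp only [true_or, or_true, if_true, if_false, show ¬ ((-1:ℤ) = 1) by decide, show ¬ ((0:ℤ) = 1) by decide, show ¬ ((0:ℤ) = -1) by decide, or_self]
  simp only [lamP, lamM]
  have hZ := z_ne hq j
  have hQ := z_ne hq N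
  generalize PhiPp q (s*t2) c1 c2 c3 (N-j) i = a1
  generalize PhiPm q (s*t2) c1 c2 c3 (N-j) i = a2
  generalize PhiMp q (s*t2) c1 c2 c3 (N-j) i = a3
  generalize PhiMm q (s*t2) c1 c2 c3 (N-j) i = a4
  generalize PhiP q c1 c2 c3 (N-j) i = a5
  generalize PhiM q c1 c2 c3 (N-j) i = a6
  generalize Fp q c4 c0 j = f1
  generalize Fm q c4 c0 j = f2
  rw [show N - j + 2 = N + 2 - j by ring]
  generalize g1 : 1 - c1 * c2 * q ^ (N+2-j) = U at *
  generalize g2 : 1 - c3 * q ^ (N-j) = V at *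
  simp only [two_mul, neg_add, neg_sub, zpow_add₀ hq, zpow_sub₀ hq, zpow_neg, zpow_ofNat, zpow_one, pow_one, zpow_zero] at *
  generalize q ^ j = Z at *
  generalize q ^ N = Q at *
  generalize s * t2 = σ at *
  field_simp
  subst g1 g2
  field_simp
  ring
end

theorem KP {q c1 c2 c3 c4 c0 : ℂ} (hq : q ≠ 0) (h1 : c1 ≠ 0) (h2 : c2 ≠ 0) (h3 : c3 ≠ 0) (h4 : c4 ≠ 0) (h0 : c0 ≠ 0) (N n a : ℤ)
    (hp : c0 * c1 * c2 * c3 * c4 * (q ^ N) ^ 2 * q ^ 3 = 1) :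
    PhiP q c3 c0 c4 (N-a) n = -c3 * q ^ (N+1) * Fp q c4 c0 n * lamP q c1 c2 c3 (N-n) a := by
  simp only [PhiP, Fp, lamP]
  rw [mul_comm c4 c0]
  generalize (1 - c0 * c4 * q ^ (2 * n)) * (1 - c0 * c4 * q ^ (2 * n + 1)) = D
  rcases eq_or_ne D 0 with rfl | hD
  · simp
  have hZ := z_ne hq n
  have hQ := z_ne hq N
  have hA := z_ne hq a
  simp only [two_mul, neg_add, neg_sub, zpow_add₀ hq, zpow_sub₀ hq, zpow_neg, zpow_ofNat, zpow_one, pow_one, zpow_zero] at *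
  generalize q ^ n = Z at *
  generalize q ^ N = Q at *
  generalize q ^ a = X at *
  obtain rfl : c1 = 1 / (c0 * c2 * c3 * c4 * Q ^ 2 * q ^ 3) := by field_simp; linear_combination hp
  field_simp
  ring

theorem KM {q c1 c2 c3 c4 c0 : ℂ} (hq : q ≠ 0) (h1 : c1 ≠ 0) (h2 : c2 ≠ 0) (h3 : c3 ≠ 0) (h4 : c4 ≠ 0) (h0 : c0 ≠ 0) (N n a : ℤ)
    (hp : c0 * c1 * c2 * c3 * c4 * (q ^ N) ^ 2 * q ^ 3 = 1) :
    PhiM q c3 c0 c4 (N-a) n = -c3 * q ^ (N+1) * Fm q c4 c0 n * lamM q c1 c2 c3 (N-n) a := by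
  simp only [PhiM, Fm, lamM]
  rw [mul_comm c4 c0]
  generalize (1 - c0 * c4 * q ^ (2 * n + 1)) * (1 - c0 * c4 * q ^ (2 * n + 2)) = D
  rcases eq_or_ne D 0 with rfl | hD
  · simp
  have hZ := z_ne hq n
  have hQ := z_ne hq N
  have hA := z_ne hq a
  simp only [two_mul, neg_add, neg_sub, zpow_add₀ hq, zpow_sub₀ hq, zpow_neg, zpow_ofNat, zpow_one, pow_one, zpow_zero] at *
  generalize q ^ n = Z at *
  generalize q ^ N = Q at *
  generalize q ^ a = X at *
  obtain rfl : c1 = 1 / (c0 * c2 * c3 * c4 * Q ^ 2 * q ^ 3) := by field_simp; linear_combination hp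
  field_simp
  ring

theorem lamP_0 {q : ℂ} (hq : q ≠ 0) (c1 c2 c3 : ℂ) (h3 : c3 ≠ 0) (N a : ℤ) : lamP q c1 c2 c3 N a = lam q (c1*c2) a + lamP q c1 c2 c3 N 0 := by
  have hQ := z_ne hq N
  have hA := z_ne hq a
  simp only [lamP, lam, two_mul, neg_add, neg_sub, zpow_add₀ hq, zpow_sub₀ hq, zpow_neg, zpow_ofNat, zpow_one, pow_one, zpow_zero, neg_zero]
  field_simp
  ring
theorem lamM_0 {q : ℂ} (hq : q ≠ 0) (c1 c2 c3 : ℂ) (N a : ℤ) : lamM q c1 c2 c3 N a = lam q (c1*c2) a + lamM q c1 c2 c3 N 0 := by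
  have hQ := z_ne hq N
  have hA := z_ne hq a
  simp only [lamM, lam, two_mul, neg_add, neg_sub, zpow_add₀ hq, zpow_sub₀ hq, zpow_neg, zpow_ofNat, zpow_one, pow_one, zpow_zero, neg_zero]
  field_simp
  ring

structure Ctx (q s c1 c2 c3 c4 c0 t1 t2 t3 t4 t0 : ℂ) (N : ℕ) : Prop where
  g : Gen q s c1 c2 c3 t2 N
  k : Gen q s c3 c0 c4 t0 N
  r : Gen q s c4 c2 c1 t2 N
  hp : c0 * c1 * c2 * c3 * c4 * (q ^ (N:ℤ)) ^ 2 * q ^ 3 = 1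
  ht : t0 * t1 * t2 * t3 * t4 * q ^ (N:ℤ) * q * s = 1
  h1 : t1 ^ 2 = c1
  h3 : t3 ^ 2 = c3
  h4 : t4 ^ 2 = c4
  hA : (q ^ (2 * (N:ℤ) + 3) * c1 * c2 * c3 * c4)⁻¹ = c0
  hA' : (q ^ (2 * (N:ℤ) + 3) * c1 * c0 * c4 * c3)⁻¹ = c2
  n10 : ∀ k : ℤ, 0 ≤ k → k ≤ N + 2 → 1 - c1 * c0 * q ^ k ≠ 0

def TT (q s c1 c2 c3 c4 c0 t2 t0 : ℂ) (N i j a y : ℤ) : ℂ :=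
  p q s c1 c2 c3 t2 (N-j) i a * p q s c3 c0 c4 t0 (N-a) j y

theorem G_eq {q s c1 c2 c3 c4 c0 t1 t2 t3 t4 t0 : ℂ} {N : ℕ}
    (h0 : (q ^ (2 * (N:ℤ) + 3) * c1 * c2 * c3 * c4)⁻¹ = c0) (ht0 : (s ^ (2 * (N:ℤ) + 3) * t1 * t2 * t3 * t4)⁻¹ = t0)
    (i j x : ℤ) (y : ℕ) (hy : y ≤ N) :
    G q s c1 c2 c3 c4 t1 t2 t3 t4 N i j x y = ∑ a ∈ Finset.range (N - y + 1),
      om q (t1*t2*t3/t4) a * TT q s c1 c2 c3 c4 c0 t2 t0 N i j a y * p q s c4 c2 c1 t2 (N-y) a x := by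
  rw [G, h0, ht0]
  split_ifs with h
  · obtain ⟨hi, hj, hij⟩ := h
    simp only [TT, ← mul_assoc]
    apply Finset.sum_subset
    · apply Finset.range_subset_range.2
      omega
    · intro a ha ha'
      simp only [Finset.mem_range] at ha ha'
      rw [p_out q s c1 c2 c3 t2 (N-j) i a (by omega)]
      ring
  · symm
    apply Finset.sum_eq_zero
    intro a ha
    rcases lt_or_ge j 0 with hj | hj
    · rw [TT, p_out q s c3 c0 c4 t0 _ j _ (by omega)]; ring
    · rw [TT, p_out q s c1 c2 c3 t2 _ i _ (by omega)]; ring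

theorem sum3 (f : ℤ → ℤ → ℂ) : ∑ e ∈ ({-1, 0, 1} : Finset ℤ), ∑ e' ∈ ({-1, 0, 1} : Finset ℤ), f e e' =
   (f 1 1 + f 0 1 + f (-1) 1) + (f 1 0 + f 0 0 + f (-1) 0) + (f 1 (-1) + f 0 (-1) + f (-1) (-1)) := by
  have e : ∀ f : ℤ → ℂ, ∑ e ∈ ({-1, 0, 1} : Finset ℤ), f e = f (-1) + f 0 + f 1 := by
    intro f; rw [Finset.sum_insert (by decide), Finset.sum_insert (by decide), Finset.sum_singleton]; ring
  simp only [e]; ring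

theorem partI {q s c1 c2 c3 c4 c0 t1 t2 t3 t4 t0 : ℂ} {N : ℕ} (h : Ctx q s c1 c2 c3 c4 c0 t1 t2 t3 t4 t0 N)
    (i j a y : ℤ) (hi : 0 ≤ i) (hj : 0 ≤ j) (hij : i + j ≤ N) (ha : 0 ≤ a) (haN : a ≤ N) :
    lam q (c3*c0) y * TT q s c1 c2 c3 c4 c0 t2 t0 N i j a y =
    ∑ ε ∈ ({-1, 0, 1} : Finset ℤ), ∑ ε' ∈ ({-1, 0, 1} : Finset ℤ), A q s c1 c2 c3 c4 t2 N ε ε' (i+ε) (j+ε') * TT q s c1 c2 c3 c4 c0 t2 t0 N (i+ε) (j+ε') a y := by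
  have hq := h.g.hq
  rw [sum3]
  rw [App h.hA, A0p h.hA, Amp h.hA, Ap0 h.hA, A00 h.hA, Am0 h.hA, Apm h.hA, A0m h.hA, Amm h.hA]
  rotate_left
  · exact hq
  · exact h.g.h3
  · exact h.g.hst
  · exact g_int h.g.g12 _ (by omega) (by push_cast; omega)
  · exact g_int h.g.g3 _ (by omega) (by push_cast; omega)
  simp only [TT, add_zero, ← sub_eq_add_neg, show (N:ℤ) - (j+1) = N - j - 1 by ring, show (N:ℤ) - (j-1) = N - j + 1 by ring]
  have kp := KP hq h.g.h1 h.g.h2 h.g.h3 h.k.h3 h.k.h2 N j a h.hp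
  have km := KM hq h.g.h1 h.g.h2 h.g.h3 h.k.h3 h.k.h2 N j a h.hp
  have kp' := KP hq h.g.h1 h.g.h2 h.g.h3 h.k.h3 h.k.h2 N (j+1) a h.hp
  have km' := KM hq h.g.h1 h.g.h2 h.g.h3 h.k.h3 h.k.h2 N (j-1) a h.hp
  rw [show (N:ℤ) - (j+1) = N - j - 1 by ring] at kp'
  rw [show (N:ℤ) - (j-1) = N - j + 1 by ring] at km'
  have l1 := lamP_0 hq c1 c2 c3 h.g.h3 (N-j) a
  have l2 := lamM_0 hq c1 c2 c3 (N-j) a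
  have R := Rp h.g (N-j) i a (by omega) hi (by omega)
  -- p_j recurrence
  have S : lam q (c3*c0) y * p q s c3 c0 c4 t0 (N-a) j y * p q s c1 c2 c3 t2 (N-j) i a =
     (PhiP q c3 c0 c4 (N-a) (j+1) * p q s c3 c0 c4 t0 (N-a) (j+1) y + (-PhiP q c3 c0 c4 (N-a) j - PhiM q c3 c0 c4 (N-a) j) * p q s c3 c0 c4 t0 (N-a) j y
      + PhiM q c3 c0 c4 (N-a) (j-1) * p q s c3 c0 c4 t0 (N-a) (j-1) y) * p q s c1 c2 c3 t2 (N-j) i a := by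
    rcases le_or_gt j (N-a) with hja | hja
    · rw [Rp h.k (N-a) j y (by omega) hj hja]
    · rw [p_out q s c1 c2 c3 t2 (N-j) i a (by omega)]; ring
  have P : p q s c3 c0 c4 t0 (N-a) (j+1) y * (lamP q c1 c2 c3 (N-j-1) a * p q s c1 c2 c3 t2 (N-j) i a) = p q s c3 c0 c4 t0 (N-a) (j+1) y * 
     (PhiPp q (s*t2) c1 c2 c3 (N-j-1) (i+1) * p q s c1 c2 c3 t2 (N-j-1) (i+1) a + PhiP0 q (s*t2) c1 c2 c3 (N-j-1) i * p q s c1 c2 c3 t2 (N-j-1) i a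
      + PhiPm q (s*t2) c1 c2 c3 (N-j-1) (i-1) * p q s c1 c2 c3 t2 (N-j-1) (i-1) a) := by
    rcases le_or_gt (j+1) (N-a) with hja | hja
    · have := CP h.g (N-j-1) i a (by omega) hi (by omega) (by omega) (by omega)
      rw [sub_add_cancel] at this
      rw [this]
    · rw [p_out q s c3 c0 c4 t0 (N-a) (j+1) y (by omega)]; ring
  have M : p q s c3 c0 c4 t0 (N-a) (j-1) y * (lamM q c1 c2 c3 (N-j+1) a * p q s c1 c2 c3 t2 (N-j) i a) = p q s c3 c0 c4 t0 (N-a) (j-1) y * 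
     (PhiMp q (s*t2) c1 c2 c3 (N-j+1) (i+1) * p q s c1 c2 c3 t2 (N-j+1) (i+1) a + PhiM0 q (s*t2) c1 c2 c3 (N-j+1) i * p q s c1 c2 c3 t2 (N-j+1) i a
      + PhiMm q (s*t2) c1 c2 c3 (N-j+1) (i-1) * p q s c1 c2 c3 t2 (N-j+1) (i-1) a) := by
    rcases le_or_gt 1 j with hja | hja
    · rw [CM h.g (N-j) i a (by omega) hi (by omega)]
    · rw [p_out q s c3 c0 c4 t0 (N-a) (j-1) y (by omega)]; ring
  rw [kp', km', kp, km, l1, l2] at S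
  rw [FF]
  clear kp km kp' km' l1 l2
  generalize q ^ ((N:ℤ)+1) = Qq at *
  linear_combination S - c3 * Qq * Fp q c4 c0 (j+1) * P - c3 * Qq * Fm q c4 c0 (j-1) * M + c3 * Qq * (Fp q c4 c0 j + Fm q c4 c0 j) * p q s c3 c0 c4 t0 (N-a) j y * R

section
variable (q σ τ c0 c1 c2 c3 c4 r : ℂ) (N M n j a : ℤ) (hq : q ≠ 0) (h0 : c0 ≠ 0) (h1 : c1 ≠ 0) (h2 : c2 ≠ 0) (h3 : c3 ≠ 0) (h4 : c4 ≠ 0) (hσ : σ ≠ 0) (hσ2 : σ ^ 2 = q * c2) (hτ : τ ≠ 0) (hτ2 : τ ^ 2 = q * c0)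
    (hp : c0 * c1 * c2 * c3 * c4 * (q ^ N) ^ 2 * q ^ 3 = 1)
include hq h0 h1 h2 h3 h4 hσ hσ2 hτ hτ2 hp

theorem cM
    (hj : j = n + 1) (hM : M = N - n - 1) (hr : τ * r * c4 * q ^ N * q = 1)
    (d0 : 1 - c0 * c4 * (q ^ n) ^ 2 ≠ 0) (d1 : 1 - c0 * c4 * q * (q ^ n) ^ 2 ≠ 0) (d2 : 1 - c0 * c4 * q ^ 2 * (q ^ n) ^ 2 ≠ 0)
    (e0 : 1 - c1 * c2 * (q ^ a) ^ 2 ≠ 0) (e1 : 1 - c1 * c2 * q * (q ^ a) ^ 2 ≠ 0) (e2 : 1 - c1 * c2 * q ^ 2 * (q ^ a) ^ 2 ≠ 0) :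
    (-(r*q*q^a)*(-c4*q^(N+1)*Fm q c1 c2 a*PhiMm q τ c3 c0 c4 (N-a) n) = (-c4*q^(N+n+3)*Fm q c4 c0 n) * (-σ*c1*c2*c3*q^(M+1)*q^a*PhiMm q σ c3 c2 c1 (M+1) a)) ∧
    (c4*q^(N+1)*FF q c1 c2 a*PhiM q c3 c0 c4 (N-a) n = (-c4*q^(N+n+3)*Fm q c4 c0 n) * (c3*q^M/q^a*FF q c1 c2 a*(1-q^a/q^(M+1))*(1-c1*c2*q^(M+1)*q*q^a))) ∧
    (-(r*q^a)⁻¹*(-c4*q^(N+1)*Fp q c1 c2 a*PhiPm q τ c3 c0 c4 (N-a) n) = (-c4*q^(N+n+3)*Fm q c4 c0 n) * (-σ*c3*q^M/q^a*PhiMp q σ c3 c2 c1 (M+1) a)) := by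
  subst hj hM
  have hX := z_ne hq a
  have hZ := z_ne hq n
  have hQ := z_ne hq N
  obtain rfl : r = 1 / (τ * c4 * q ^ N * q) := by field_simp; linear_combination hr
  simp only [Fp, Fm, PhiM, PhiP, LH, AH, lamM, lamP, PhiPm, PhiPp, PhiP0, PhiMm, PhiMp, PhiM0, two_mul, neg_add, neg_sub, mul_comm c4 c0, mul_comm c2 c1, zpow_add₀ hq, zpow_sub₀ hq, zpow_neg, zpow_ofNat, zpow_one, pow_one, zpow_zero, neg_zero]
  generalize q ^ a = X at *
  generalize q ^ n = Z at *
  generalize q ^ N = Q at *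
  obtain rfl : c3 = 1 / (c0 * c1 * c2 * c4 * Q ^ 2 * q ^ 3) := by field_simp; linear_combination hp
  simp only [q3 q c0 c4 Z,
    q3 q c1 c2 X]
  generalize g0 : 1 - c0 * c4 * Z ^ 2 = D0 at *
  generalize g1 : 1 - c0 * c4 * q * Z ^ 2 = D1 at *
  generalize g2 : 1 - c0 * c4 * q ^ 2 * Z ^ 2 = D2 at *
  generalize f0 : 1 - c1 * c2 * X ^ 2 = E0 at *
  generalize f1 : 1 - c1 * c2 * q * X ^ 2 = E1 at *
  generalize f2 : 1 - c1 * c2 * q ^ 2 * X ^ 2 = E2 at *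
  refine ⟨?_, ?_, ?_⟩
  all_goals
    field_simp
    try simp only [hσ2, hτ2, pw hσ2, pw hτ2]
    try subst g0 g1 g2 f0 f1 f2
    try field_simp
    try ring

theorem cP
    (hj : j = n - 1) (hM : M = N - n) (hr : τ * r * c4 * q ^ N * q = 1)
    (d0 : 1 - c0 * c4 * (q ^ n) ^ 2 ≠ 0) (d1 : 1 - c0 * c4 * q * (q ^ n) ^ 2 ≠ 0) (d2 : 1 - c0 * c4 * q ^ 2 * (q ^ n) ^ 2 ≠ 0)
    (e0 : 1 - c1 * c2 * (q ^ a) ^ 2 ≠ 0) (e1 : 1 - c1 * c2 * q * (q ^ a) ^ 2 ≠ 0) (e2 : 1 - c1 * c2 * q ^ 2 * (q ^ a) ^ 2 ≠ 0) :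
    (-(r*q*q^a)*(-c4*q^(N+1)*Fm q c1 c2 a*PhiMp q τ c3 c0 c4 (N-a) n) = (-q^(N+2-n)/c0*Fp q c4 c0 n) * (-σ*c1*q^a/(c3*q^M*q^2)*PhiPm q σ c3 c2 c1 M a)) ∧
    (c4*q^(N+1)*FF q c1 c2 a*PhiP q c3 c0 c4 (N-a) n = (-q^(N+2-n)/c0*Fp q c4 c0 n) * (-1/(c1*c2*c3*(q^M)^2*q^4)*FF q c1 c2 a*(1-c3*q^M*q/q^a)*(1-c1*c2*c3*q^M*q^2*q^a))) ∧
    (-(r*q^a)⁻¹*(-c4*q^(N+1)*Fp q c1 c2 a*PhiPp q τ c3 c0 c4 (N-a) n) = (-q^(N+2-n)/c0*Fp q c4 c0 n) * (-1/(σ*c3*q^M*q^2*q^a)*PhiPp q σ c3 c2 c1 M a)) := by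
  subst hj hM
  have hX := z_ne hq a
  have hZ := z_ne hq n
  have hQ := z_ne hq N
  obtain rfl : r = 1 / (τ * c4 * q ^ N * q) := by field_simp; linear_combination hr
  simp only [Fp, Fm, PhiM, PhiP, LH, AH, lamM, lamP, PhiPm, PhiPp, PhiP0, PhiMm, PhiMp, PhiM0, two_mul, neg_add, neg_sub, mul_comm c4 c0, mul_comm c2 c1, zpow_add₀ hq, zpow_sub₀ hq, zpow_neg, zpow_ofNat, zpow_one, pow_one, zpow_zero, neg_zero]
  generalize q ^ a = X at *
  generalize q ^ n = Z at *
  generalize q ^ N = Q at *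
  obtain rfl : c3 = 1 / (c0 * c1 * c2 * c4 * Q ^ 2 * q ^ 3) := by field_simp; linear_combination hp
  simp only [q3 q c0 c4 Z,
    q3 q c1 c2 X]
  generalize g0 : 1 - c0 * c4 * Z ^ 2 = D0 at *
  generalize g1 : 1 - c0 * c4 * q * Z ^ 2 = D1 at *
  generalize g2 : 1 - c0 * c4 * q ^ 2 * Z ^ 2 = D2 at *
  generalize f0 : 1 - c1 * c2 * X ^ 2 = E0 at *
  generalize f1 : 1 - c1 * c2 * q * X ^ 2 = E1 at *
  generalize f2 : 1 - c1 * c2 * q ^ 2 * X ^ 2 = E2 at *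
  refine ⟨?_, ?_, ?_⟩
  all_goals
    field_simp
    try simp only [hσ2, hτ2, pw hσ2, pw hτ2]
    try subst g0 g1 g2 f0 f1 f2
    try field_simp
    try ring

theorem cZ
    (hM : M = N - n) (hr : τ * r * c4 * q ^ N * q = 1)
    (d0 : 1 - c0 * c4 * (q ^ n) ^ 2 ≠ 0) (d1 : 1 - c0 * c4 * q * (q ^ n) ^ 2 ≠ 0) (d2 : 1 - c0 * c4 * q ^ 2 * (q ^ n) ^ 2 ≠ 0)
    (e0 : 1 - c1 * c2 * (q ^ a) ^ 2 ≠ 0) (e1 : 1 - c1 * c2 * q * (q ^ a) ^ 2 ≠ 0) (e2 : 1 - c1 * c2 * q ^ 2 * (q ^ a) ^ 2 ≠ 0) :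
    (-(r*q*q^a)*(-c4*q^(N+1)*Fm q c1 c2 a*PhiM0 q τ c3 c0 c4 (N-a) n) = (-q^(N+2)*FF q c0 c4 n) * (c1*c2*q^a*PhiM q c3 c2 c1 M a)) ∧
    (-(r*q^a)⁻¹*(-c4*q^(N+1)*Fp q c1 c2 a*PhiP0 q τ c3 c0 c4 (N-a) n) = (-q^(N+2)*FF q c0 c4 n) * (1/(q*q^a)*PhiP q c3 c2 c1 M a)) := by
  subst hM
  have hX := z_ne hq a
  have hZ := z_ne hq n
  have hQ := z_ne hq N
  obtain rfl : r = 1 / (τ * c4 * q ^ N * q) := by field_simp; linear_combination hr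
  simp only [FF, Fp, Fm, PhiM, PhiP, LH, AH, lamM, lamP, PhiPm, PhiPp, PhiP0, PhiMm, PhiMp, PhiM0, two_mul, neg_add, neg_sub, mul_comm c4 c0, mul_comm c2 c1, zpow_add₀ hq, zpow_sub₀ hq, zpow_neg, zpow_ofNat, zpow_one, pow_one, zpow_zero, neg_zero]
  generalize q ^ a = X at *
  generalize q ^ n = Z at *
  generalize q ^ N = Q at *
  obtain rfl : c3 = 1 / (c0 * c1 * c2 * c4 * Q ^ 2 * q ^ 3) := by field_simp; linear_combination hp
  simp only [q3 q c0 c4 Z,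
    q3 q c1 c2 X]
  generalize g0 : 1 - c0 * c4 * Z ^ 2 = D0 at *
  generalize g1 : 1 - c0 * c4 * q * Z ^ 2 = D1 at *
  generalize g2 : 1 - c0 * c4 * q ^ 2 * Z ^ 2 = D2 at *
  generalize f0 : 1 - c1 * c2 * X ^ 2 = E0 at *
  generalize f1 : 1 - c1 * c2 * q * X ^ 2 = E1 at *
  generalize f2 : 1 - c1 * c2 * q ^ 2 * X ^ 2 = E2 at *
  refine ⟨?_, ?_⟩
  all_goals
    field_simp
    try simp only [hσ2, hτ2, pw hσ2, pw hτ2]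
    try subst g0 g1 g2 f0 f1 f2
    try field_simp
    try ring

theorem cZ0
    (hM : M = N - n) (hr : τ * r * c4 * q ^ N * q = 1)
    (d0 : 1 - c0 * c4 * (q ^ n) ^ 2 ≠ 0) (d1 : 1 - c0 * c4 * q * (q ^ n) ^ 2 ≠ 0) (d2 : 1 - c0 * c4 * q ^ 2 * (q ^ n) ^ 2 ≠ 0)
    (e0 : 1 - c1 * c2 * (q ^ a) ^ 2 ≠ 0) (e1 : 1 - c1 * c2 * q * (q ^ a) ^ 2 ≠ 0) (e2 : 1 - c1 * c2 * q ^ 2 * (q ^ a) ^ 2 ≠ 0) :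
    (c4*q^(N+1)*(FF q c1 c2 a*(-PhiP q c3 c0 c4 (N-a) n - PhiM q c3 c0 c4 (N-a) n) + (Fp q c1 c2 a * lamP q c3 c0 c4 (N-a) 0 + Fm q c1 c2 a * lamM q c3 c0 c4 (N-a) 0)) = (-q^(N+2)*FF q c0 c4 n) * (LH q c1 c2 c3 (q^M) (q^a)) + ((1+c2)*FF q c4 c0 n/c0-1-c2*c4*q)) := by
  subst hM
  have hX := z_ne hq a
  have hZ := z_ne hq n
  have hQ := z_ne hq N
  obtain rfl : r = 1 / (τ * c4 * q ^ N * q) := by field_simp; linear_combination hr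
  simp only [FF, Fp, Fm, PhiM, PhiP, LH, AH, lamM, lamP, PhiPm, PhiPp, PhiP0, PhiMm, PhiMp, PhiM0, two_mul, neg_add, neg_sub, mul_comm c4 c0, mul_comm c2 c1, zpow_add₀ hq, zpow_sub₀ hq, zpow_neg, zpow_ofNat, zpow_one, pow_one, zpow_zero, neg_zero]
  generalize q ^ a = X at *
  generalize q ^ n = Z at *
  generalize q ^ N = Q at *
  obtain rfl : c3 = 1 / (c0 * c1 * c2 * c4 * Q ^ 2 * q ^ 3) := by field_simp; linear_combination hp
  simp only [q3 q c0 c4 Z,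
    q3 q c1 c2 X]
  generalize g0 : 1 - c0 * c4 * Z ^ 2 = D0 at *
  generalize g1 : 1 - c0 * c4 * q * Z ^ 2 = D1 at *
  generalize g2 : 1 - c0 * c4 * q ^ 2 * Z ^ 2 = D2 at *
  generalize f0 : 1 - c1 * c2 * X ^ 2 = E0 at *
  generalize f1 : 1 - c1 * c2 * q * X ^ 2 = E1 at *
  generalize f2 : 1 - c1 * c2 * q ^ 2 * X ^ 2 = E2 at *
  all_goals
    field_simp
    try simp only [hσ2, hτ2, pw hσ2, pw hτ2]
    try subst g0 g1 g2 f0 f1 f2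
    try field_simp
    try ring

end

section
variable (q σ τ c0 c1 c2 c3 c4 u v : ℂ) (N M n j i : ℤ) (hq : q ≠ 0) (h0 : c0 ≠ 0) (h1 : c1 ≠ 0) (h2 : c2 ≠ 0) (h3 : c3 ≠ 0) (h4 : c4 ≠ 0) (hσ : σ ≠ 0) (hσ2 : σ ^ 2 = q * c2) (hτ : τ ≠ 0) (hτ2 : τ ^ 2 = q * c0)
    (hp : c0 * c1 * c2 * c3 * c4 * (q ^ N) ^ 2 * q ^ 3 = 1)
include hq h0 h1 h2 h3 h4 hσ hσ2 hτ hτ2 hp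

theorem wM
    (hj : j = n + 1) (hM : M = N - n - 1) (hu : u = c2 * c3 * c4 * q ^ N * q * τ) (hv : v * σ * c1 * q ^ N * q = 1)
    (d0 : 1 - c0 * c4 * (q ^ n) ^ 2 ≠ 0) (d1 : 1 - c0 * c4 * q * (q ^ n) ^ 2 ≠ 0) (d2 : 1 - c0 * c4 * q ^ 2 * (q ^ n) ^ 2 ≠ 0) :
    (-(u*q^i*q)/(-(v*q^j)⁻¹)*(-c4*q^(N+1)*Fp q c3 c2 (i+1)*PhiPm q τ c1 c0 c4 (N-(i+1)) n) = (-c4*q^(N+n+3)*Fm q c4 c0 n) * (PhiMp q σ c1 c2 c3 (M+1) (i+1) * (c3 * c2 * q ^ i))) ∧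
    (1/(-(v*q^j)⁻¹)*(c4*q^(N+1)*FF q c3 c2 i*PhiM q c1 c0 c4 (N-i) n) = (-c4*q^(N+n+3)*Fm q c4 c0 n) * (-FF q c3 c2 i * (1 - q^i/q^(M+1)) * (1-c3*c2*q^(M+1)*q*q^i)/(σ*q*q^i))) ∧
    (-(u*q^i)⁻¹/(-(v*q^j)⁻¹)*(-c4*q^(N+1)*Fm q c3 c2 (i-1)*PhiMm q τ c1 c0 c4 (N-(i-1)) n) = (-c4*q^(N+n+3)*Fm q c4 c0 n) * (PhiMm q σ c1 c2 c3 (M+1) (i-1) * (q * q ^ i)⁻¹)) := by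
  subst hj hM
  have hX := z_ne hq i
  have hZ := z_ne hq n
  have hQ := z_ne hq N
  obtain rfl : v = 1 / (σ * c1 * q ^ N * q) := by field_simp; linear_combination hv
  subst hu
  simp only [Fp, Fm, PhiM, PhiP, LH, AH, lamM, lamP, PhiPm, PhiPp, PhiP0, PhiMm, PhiMp, PhiM0, two_mul, neg_add, neg_sub, mul_comm c4 c0, mul_comm c3 c2, zpow_add₀ hq, zpow_sub₀ hq, zpow_neg, zpow_ofNat, zpow_one, pow_one, zpow_zero, neg_zero]
  generalize q ^ i = X at *
  generalize q ^ n = Z at *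
  generalize q ^ N = Q at *
  obtain rfl : c1 = 1 / (c0 * c2 * c3 * c4 * Q ^ 2 * q ^ 3) := by field_simp; linear_combination hp
  simp only [q3 q c0 c4 Z,
    q3 q c2 c3 X, show 1 - c2 * c3 * (X * q * (X * q)) = 1 - c2 * c3 * q ^ 2 * X ^ 2 by ring, show 1 - c2 * c3 * (X * q * (X * q) * q) = 1 - c2 * c3 * q ^ 3 * X ^ 2 by ring, show 1 - c2 * c3 * (X / q * (X / q) * q) = 1 - c2 * c3 / q * X ^ 2 by (field_simp), show 1 - c2 * c3 * (X / q * (X / q) * q ^ 2) = 1 - c2 * c3 * X ^ 2 by (field_simp)]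
  generalize g0 : 1 - c0 * c4 * Z ^ 2 = D0 at *
  generalize g1 : 1 - c0 * c4 * q * Z ^ 2 = D1 at *
  generalize g2 : 1 - c0 * c4 * q ^ 2 * Z ^ 2 = D2 at *
  generalize f0 : 1 - c2 * c3 / q * X ^ 2 = E0 at *
  generalize f1 : 1 - c2 * c3 * X ^ 2 = E1 at *
  generalize f2 : 1 - c2 * c3 * q * X ^ 2 = E2 at *
  generalize f3 : 1 - c2 * c3 * q ^ 2 * X ^ 2 = E3 at *
  generalize f4 : 1 - c2 * c3 * q ^ 3 * X ^ 2 = E4 at *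
  refine ⟨?_, ?_, ?_⟩
  all_goals
    field_simp
    try simp only [hσ2, hτ2, pw hσ2, pw hτ2]
    try subst g0 g1 g2 f0 f1 f2 f3 f4
    try field_simp
    try ring

theorem wP
    (hj : j = n - 1) (hM : M = N - n) (hu : u = c2 * c3 * c4 * q ^ N * q * τ) (hv : v * σ * c1 * q ^ N * q = 1)
    (d0 : 1 - c0 * c4 * (q ^ n) ^ 2 ≠ 0) (d1 : 1 - c0 * c4 * q * (q ^ n) ^ 2 ≠ 0) (d2 : 1 - c0 * c4 * q ^ 2 * (q ^ n) ^ 2 ≠ 0) :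
    (-(u*q^i*q)/(-(v*q^j*q))*(-c4*q^(N+1)*Fp q c3 c2 (i+1)*PhiPp q τ c1 c0 c4 (N-(i+1)) n) = (-q^(N+2-n)/c0*Fp q c4 c0 n) * (PhiPp q σ c1 c2 c3 M (i+1) * (c3 * c2 * q ^ i))) ∧
    (1/(-(v*q^j*q))*(c4*q^(N+1)*FF q c3 c2 i*PhiP q c1 c0 c4 (N-i) n) = (-q^(N+2-n)/c0*Fp q c4 c0 n) * (FF q c3 c2 i * (1 - c1*q^M*q/q^i) * (1-c3*c2*c1*q^M*q^2*q^i)/(σ*c3*q^M*q^2))) ∧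
    (-(u*q^i)⁻¹/(-(v*q^j*q))*(-c4*q^(N+1)*Fm q c3 c2 (i-1)*PhiMp q τ c1 c0 c4 (N-(i-1)) n) = (-q^(N+2-n)/c0*Fp q c4 c0 n) * (PhiPm q σ c1 c2 c3 M (i-1) * (q * q ^ i)⁻¹)) := by
  subst hj hM
  have hX := z_ne hq i
  have hZ := z_ne hq n
  have hQ := z_ne hq N
  obtain rfl : v = 1 / (σ * c1 * q ^ N * q) := by field_simp; linear_combination hv
  subst hu
  simp only [Fp, Fm, PhiM, PhiP, LH, AH, lamM, lamP, PhiPm, PhiPp, PhiP0, PhiMm, PhiMp, PhiM0, two_mul, neg_add, neg_sub, mul_comm c4 c0, mul_comm c3 c2, zpow_add₀ hq, zpow_sub₀ hq, zpow_neg, zpow_ofNat, zpow_one, pow_one, zpow_zero, neg_zero]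
  generalize q ^ i = X at *
  generalize q ^ n = Z at *
  generalize q ^ N = Q at *
  obtain rfl : c1 = 1 / (c0 * c2 * c3 * c4 * Q ^ 2 * q ^ 3) := by field_simp; linear_combination hp
  simp only [q3 q c0 c4 Z,
    q3 q c2 c3 X, show 1 - c2 * c3 * (X * q * (X * q)) = 1 - c2 * c3 * q ^ 2 * X ^ 2 by ring, show 1 - c2 * c3 * (X * q * (X * q) * q) = 1 - c2 * c3 * q ^ 3 * X ^ 2 by ring, show 1 - c2 * c3 * (X / q * (X / q) * q) = 1 - c2 * c3 / q * X ^ 2 by (field_simp), show 1 - c2 * c3 * (X / q * (X / q) * q ^ 2) = 1 - c2 * c3 * X ^ 2 by (field_simp)]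
  generalize g0 : 1 - c0 * c4 * Z ^ 2 = D0 at *
  generalize g1 : 1 - c0 * c4 * q * Z ^ 2 = D1 at *
  generalize g2 : 1 - c0 * c4 * q ^ 2 * Z ^ 2 = D2 at *
  generalize f0 : 1 - c2 * c3 / q * X ^ 2 = E0 at *
  generalize f1 : 1 - c2 * c3 * X ^ 2 = E1 at *
  generalize f2 : 1 - c2 * c3 * q * X ^ 2 = E2 at *
  generalize f3 : 1 - c2 * c3 * q ^ 2 * X ^ 2 = E3 at *
  generalize f4 : 1 - c2 * c3 * q ^ 3 * X ^ 2 = E4 at *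
  refine ⟨?_, ?_, ?_⟩
  all_goals
    field_simp
    try simp only [hσ2, hτ2, pw hσ2, pw hτ2]
    try subst g0 g1 g2 f0 f1 f2 f3 f4
    try field_simp
    try ring

theorem wZ
    (hM : M = N - n) (hu : u = c2 * c3 * c4 * q ^ N * q * τ) (hv : v * σ * c1 * q ^ N * q = 1)
    (d0 : 1 - c0 * c4 * (q ^ n) ^ 2 ≠ 0) (d1 : 1 - c0 * c4 * q * (q ^ n) ^ 2 ≠ 0) (d2 : 1 - c0 * c4 * q ^ 2 * (q ^ n) ^ 2 ≠ 0) :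
    (-(u*q^i*q)/(1)*(-c4*q^(N+1)*Fp q c3 c2 (i+1)*PhiP0 q τ c1 c0 c4 (N-(i+1)) n) = (-q^(N+2)*FF q c0 c4 n) * (PhiP q c1 c2 c3 M (i+1) * (c3 * c2 * q ^ i))) ∧
    (-(u*q^i)⁻¹/(1)*(-c4*q^(N+1)*Fm q c3 c2 (i-1)*PhiM0 q τ c1 c0 c4 (N-(i-1)) n) = (-q^(N+2)*FF q c0 c4 n) * (PhiM q c1 c2 c3 M (i-1) * (q * q ^ i)⁻¹)) := by
  subst hM
  have hX := z_ne hq i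
  have hZ := z_ne hq n
  have hQ := z_ne hq N
  obtain rfl : v = 1 / (σ * c1 * q ^ N * q) := by field_simp; linear_combination hv
  subst hu
  simp only [FF, Fp, Fm, PhiM, PhiP, LH, AH, lamM, lamP, PhiPm, PhiPp, PhiP0, PhiMm, PhiMp, PhiM0, two_mul, neg_add, neg_sub, mul_comm c4 c0, mul_comm c3 c2, zpow_add₀ hq, zpow_sub₀ hq, zpow_neg, zpow_ofNat, zpow_one, pow_one, zpow_zero, neg_zero]
  generalize q ^ i = X at *
  generalize q ^ n = Z at *
  generalize q ^ N = Q at *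
  obtain rfl : c1 = 1 / (c0 * c2 * c3 * c4 * Q ^ 2 * q ^ 3) := by field_simp; linear_combination hp
  simp only [q3 q c0 c4 Z,
    q3 q c2 c3 X, show 1 - c2 * c3 * (X * q * (X * q)) = 1 - c2 * c3 * q ^ 2 * X ^ 2 by ring, show 1 - c2 * c3 * (X * q * (X * q) * q) = 1 - c2 * c3 * q ^ 3 * X ^ 2 by ring, show 1 - c2 * c3 * (X / q * (X / q) * q) = 1 - c2 * c3 / q * X ^ 2 by (field_simp), show 1 - c2 * c3 * (X / q * (X / q) * q ^ 2) = 1 - c2 * c3 * X ^ 2 by (field_simp)]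
  generalize g0 : 1 - c0 * c4 * Z ^ 2 = D0 at *
  generalize g1 : 1 - c0 * c4 * q * Z ^ 2 = D1 at *
  generalize g2 : 1 - c0 * c4 * q ^ 2 * Z ^ 2 = D2 at *
  generalize f0 : 1 - c2 * c3 / q * X ^ 2 = E0 at *
  generalize f1 : 1 - c2 * c3 * X ^ 2 = E1 at *
  generalize f2 : 1 - c2 * c3 * q * X ^ 2 = E2 at *
  generalize f3 : 1 - c2 * c3 * q ^ 2 * X ^ 2 = E3 at *
  generalize f4 : 1 - c2 * c3 * q ^ 3 * X ^ 2 = E4 at *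
  refine ⟨?_, ?_⟩
  all_goals
    field_simp
    try simp only [hσ2, hτ2, pw hσ2, pw hτ2]
    try subst g0 g1 g2 f0 f1 f2 f3 f4
    try field_simp
    try ring

theorem wZ0
    (hM : M = N - n) (hu : u = c2 * c3 * c4 * q ^ N * q * τ) (hv : v * σ * c1 * q ^ N * q = 1)
    (d0 : 1 - c0 * c4 * (q ^ n) ^ 2 ≠ 0) (d1 : 1 - c0 * c4 * q * (q ^ n) ^ 2 ≠ 0) (d2 : 1 - c0 * c4 * q ^ 2 * (q ^ n) ^ 2 ≠ 0)
    (e0 : 1 - c2 * c3 * (q ^ i) ^ 2 ≠ 0) (e1 : 1 - c2 * c3 * q * (q ^ i) ^ 2 ≠ 0) (e2 : 1 - c2 * c3 * q ^ 2 * (q ^ i) ^ 2 ≠ 0) :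
    (c4*q^(N+1)*FF q c3 c2 i*(-PhiP q c1 c0 c4 (N-i) n - PhiM q c1 c0 c4 (N-i) n) + c4*q^(N+1)*(Fp q c3 c2 i * lamP q c1 c0 c4 (N-i) 0 + Fm q c3 c2 i * lamM q c1 c0 c4 (N-i) 0) = (-q^(N+2)*FF q c0 c4 n) * (LH q c3 c2 c1 (q^M) (q^i)) + ((1+c2)*FF q c4 c0 n/c0-1-c2*c4*q)) := by
  subst hM
  have hX := z_ne hq i
  have hZ := z_ne hq n
  have hQ := z_ne hq N
  obtain rfl : v = 1 / (σ * c1 * q ^ N * q) := by field_simp; linear_combination hv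
  subst hu
  simp only [FF, Fp, Fm, PhiM, PhiP, LH, AH, lamM, lamP, PhiPm, PhiPp, PhiP0, PhiMm, PhiMp, PhiM0, two_mul, neg_add, neg_sub, mul_comm c4 c0, mul_comm c3 c2, zpow_add₀ hq, zpow_sub₀ hq, zpow_neg, zpow_ofNat, zpow_one, pow_one, zpow_zero, neg_zero]
  generalize q ^ i = X at *
  generalize q ^ n = Z at *
  generalize q ^ N = Q at *
  obtain rfl : c1 = 1 / (c0 * c2 * c3 * c4 * Q ^ 2 * q ^ 3) := by field_simp; linear_combination hp
  simp only [q3 q c0 c4 Z,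
    q3 q c2 c3 X, show 1 - c2 * c3 * (X * q * (X * q)) = 1 - c2 * c3 * q ^ 2 * X ^ 2 by ring, show 1 - c2 * c3 * (X * q * (X * q) * q) = 1 - c2 * c3 * q ^ 3 * X ^ 2 by ring, show 1 - c2 * c3 * (X / q * (X / q) * q) = 1 - c2 * c3 / q * X ^ 2 by (field_simp), show 1 - c2 * c3 * (X / q * (X / q) * q ^ 2) = 1 - c2 * c3 * X ^ 2 by (field_simp)]
  generalize g0 : 1 - c0 * c4 * Z ^ 2 = D0 at *
  generalize g1 : 1 - c0 * c4 * q * Z ^ 2 = D1 at *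
  generalize g2 : 1 - c0 * c4 * q ^ 2 * Z ^ 2 = D2 at *
  generalize f0 : 1 - c2 * c3 / q * X ^ 2 = E0 at *
  generalize f1 : 1 - c2 * c3 * X ^ 2 = E1 at *
  generalize f2 : 1 - c2 * c3 * q * X ^ 2 = E2 at *
  generalize f3 : 1 - c2 * c3 * q ^ 2 * X ^ 2 = E3 at *
  generalize f4 : 1 - c2 * c3 * q ^ 3 * X ^ 2 = E4 at *
  all_goals
    field_simp
    try simp only [hσ2, hτ2, pw hσ2, pw hτ2]
    try subst g0 g1 g2 f0 f1 f2 f3 f4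
    try field_simp
    try ring

end

theorem om1 (q r : ℂ) : om q r 1 = -(r * q) := by
  rw [om, show (1:ℤ) * (1+1) / 2 = 1 by norm_num]; simp
theorem om0 (q r : ℂ) : om q r 0 = 1 := by
  rw [om, show (0:ℤ) * (0+1) / 2 = 0 by norm_num]; simp
theorem omm1 (q r : ℂ) : om q r (-1) = -r⁻¹ := by
  rw [om, show (-1:ℤ) * (-1+1) / 2 = 0 by norm_num]; simp [zpow_neg]

theorem om_succ {q r : ℂ} (hq : q ≠ 0) (hr : r ≠ 0) (a : ℤ) : om q r (a+1) = -(r * q * q ^ a) * om q r a := by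
  rw [om, om, show (a+1) * (a+1+1) / 2 = a * (a+1) / 2 + (a + 1) by
    rw [show (a+1) * (a+1+1) = a * (a+1) + (a+1) * 2 by ring, Int.add_mul_ediv_right _ _ (by norm_num)],
    zpow_add₀ (by norm_num), zpow_add₀ hr, zpow_add₀ hq, zpow_add₀ hq]
  simp; ring

theorem om_pred {q r : ℂ} (hq : q ≠ 0) (hr : r ≠ 0) (a : ℤ) : om q r (a-1) = -(r * q ^ a)⁻¹ * om q r a := by
  have := om_succ hq hr (a-1)
  have hz := z_ne hq a
  rw [sub_add_cancel, zpow_sub_one₀ hq] at this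
  rw [this]; field_simp

theorem Ctx.tne {q s c1 c2 c3 c4 c0 t1 t2 t3 t4 t0 : ℂ} {N : ℕ} (h : Ctx q s c1 c2 c3 c4 c0 t1 t2 t3 t4 t0 N) :
    t1 ≠ 0 ∧ t2 ≠ 0 ∧ t3 ≠ 0 ∧ t4 ≠ 0 ∧ t0 ≠ 0 := by
  have := h.ht
  refine ⟨?_, ?_, ?_, ?_, ?_⟩ <;> rintro rfl <;> simp at this

theorem partII {q s c1 c2 c3 c4 c0 t1 t2 t3 t4 t0 r u v : ℂ} {N : ℕ} (h : Ctx q s c1 c2 c3 c4 c0 t1 t2 t3 t4 t0 N)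
    (hr : r = t1*t2*t3/t4) (hu : u = t2*t3*t4/t1) (hv : v = t0*t3*t4/t1)
    (i j a y : ℤ) (hi : 0 ≤ i) (hj : 0 ≤ j) (hij : i + j ≤ N) (ha : 0 ≤ a) (hy : 0 ≤ y) (hya : y ≤ N - a) :
    -(r*q^a)⁻¹ * PhiP q c4 c2 c1 (N-y) a * TT q s c1 c2 c3 c4 c0 t2 t0 N i j (a-1) y
    + (-PhiP q c4 c2 c1 (N-y) a - PhiM q c4 c2 c1 (N-y) a) * TT q s c1 c2 c3 c4 c0 t2 t0 N i j a y
    + -(r*q*q^a) * PhiM q c4 c2 c1 (N-y) a * TT q s c1 c2 c3 c4 c0 t2 t0 N i j (a+1) y =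
    ∑ ε ∈ ({-1, 0, 1} : Finset ℤ), ∑ ε' ∈ ({-1, 0, 1} : Finset ℤ), om q (u*q^i) ε / om q (v*q^j) ε' *
      A q s c1 c0 c4 c3 t0 N ε' ε (j+ε') (i+ε) * TT q s c1 c2 c3 c4 c0 t2 t0 N (i+ε) (j+ε') a y := by
  have hq := h.g.hq
  have h0 := h.k.h2
  have h1 := h.g.h1
  have h2 := h.g.h2
  have h3 := h.g.h3
  have h4 := h.k.h3
  obtain ⟨y1, y2, y3, y4, y0⟩ := h.tne
  have hp' : c2 * c3 * c0 * c4 * c1 * (q ^ (N:ℤ)) ^ 2 * q ^ 3 = 1 := by linear_combination h.hp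
  have Hr : (s*t0) * r * c4 * q ^ (N:ℤ) * q = 1 := by
    rw [hr, ← h.h4]; field_simp; linear_combination h.ht
  have Hu : u = c2 * c3 * c4 * q ^ (N:ℤ) * q * (s*t0) := by
    have e2 : t2 ^ 2 = c2 := h.g.ht
    rw [hu, ← h.h4, ← h.h3, ← e2]; field_simp; linear_combination -h.ht
  have Hv : v * (s*t2) * c1 * q ^ (N:ℤ) * q = 1 := by
    rw [hv, ← h.h1]; field_simp; linear_combination h.ht
  rw [sum3]
  rw [App h.hA', A0p h.hA', Amp h.hA', Ap0 h.hA', A00 h.hA', Am0 h.hA', Apm h.hA', A0m h.hA', Amm h.hA']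
  rotate_left
  · exact hq
  · exact h4
  · exact h.k.hst
  · exact h.n10 _ (by omega) (by omega)
  · exact g_int h.k.g3 _ (by omega) (by push_cast; omega)
  have kp := KP hq h3 h0 h4 h1 h2 N a y hp'
  have km := KM hq h3 h0 h4 h1 h2 N a y hp'
  have l1 := lamP_0 hq c3 c0 c4 h4 (N-a) y
  have l2 := lamM_0 hq c3 c0 c4 (N-a) y
  simp only [TT, om1, om0, omm1, add_zero, ← sub_eq_add_neg, show (N:ℤ) - (j+1) = N - j - 1 by ring, show (N:ℤ) - (j-1) = N - j + 1 by ring,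
    show (N:ℤ) - (a+1) = N - a - 1 by ring, show (N:ℤ) - (a-1) = N - a + 1 by ring]
  have X1 : p q s c1 c2 c3 t2 (N-j) i (a-1) * (lamP q c3 c0 c4 (N-a) y * p q s c3 c0 c4 t0 (N-a+1) j y) = p q s c1 c2 c3 t2 (N-j) i (a-1) *
     (PhiPp q (s*t0) c3 c0 c4 (N-a) (j+1) * p q s c3 c0 c4 t0 (N-a) (j+1) y + PhiP0 q (s*t0) c3 c0 c4 (N-a) j * p q s c3 c0 c4 t0 (N-a) j y
      + PhiPm q (s*t0) c3 c0 c4 (N-a) (j-1) * p q s c3 c0 c4 t0 (N-a) (j-1) y) := by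
    by_cases hc : 1 ≤ a ∧ j ≤ N - a + 1
    · rw [CP h.k (N-a) j y (by omega) hj (by omega) (by omega) (by omega)]
    · rw [p_out q s c1 c2 c3 t2 (N-j) i (a-1) (by omega)]; ring
  have X2 : p q s c1 c2 c3 t2 (N-j) i (a+1) * (lamM q c3 c0 c4 (N-a) y * p q s c3 c0 c4 t0 (N-a-1) j y) = p q s c1 c2 c3 t2 (N-j) i (a+1) *
     (PhiMp q (s*t0) c3 c0 c4 (N-a) (j+1) * p q s c3 c0 c4 t0 (N-a) (j+1) y + PhiM0 q (s*t0) c3 c0 c4 (N-a) j * p q s c3 c0 c4 t0 (N-a) j y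
      + PhiMm q (s*t0) c3 c0 c4 (N-a) (j-1) * p q s c3 c0 c4 t0 (N-a) (j-1) y) := by
    rcases le_or_gt j (N-a-1) with hc | hc
    · have := CM h.k (N-a-1) j y (by omega) hj (by omega)
      rw [sub_add_cancel] at this
      rw [this]
    · rw [p_out q s c1 c2 c3 t2 (N-j) i (a+1) (by omega)]; ring
  have X0 : p q s c1 c2 c3 t2 (N-j) i a * (lam q (c3*c0) y * p q s c3 c0 c4 t0 (N-a) j y) = p q s c1 c2 c3 t2 (N-j) i a *
     (PhiP q c3 c0 c4 (N-a) (j+1) * p q s c3 c0 c4 t0 (N-a) (j+1) y + (-PhiP q c3 c0 c4 (N-a) j - PhiM q c3 c0 c4 (N-a) j) * p q s c3 c0 c4 t0 (N-a) j y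
      + PhiM q c3 c0 c4 (N-a) (j-1) * p q s c3 c0 c4 t0 (N-a) (j-1) y) := by
    rcases le_or_gt j (N-a) with hja | hja
    · rw [Rp h.k (N-a) j y (by omega) hj hja]
    · rw [p_out q s c1 c2 c3 t2 (N-j) i a (by omega)]; ring
  have ea0 : 1 - c1 * c2 * (q ^ a) ^ 2 ≠ 0 := by rw [mul_comm c1 c2]; exact h.r.e0 a ha (by omega)
  have ea1 : 1 - c1 * c2 * q * (q ^ a) ^ 2 ≠ 0 := by rw [mul_comm c1 c2]; exact h.r.e1 a ha (by omega)
  have ea2 : 1 - c1 * c2 * q ^ 2 * (q ^ a) ^ 2 ≠ 0 := by rw [mul_comm c1 c2]; exact h.r.e2 a ha (by omega)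
  have YM := fun (b0 : 0 ≤ j - 1) (b1 : j - 1 ≤ N - a) =>
    cM q (s*t2) (s*t0) c0 c1 c2 c3 c4 r N (N-j) (j-1) j a hq h0 h1 h2 h3 h4 h.g.hst h.g.hst2 h.k.hst h.k.hst2 h.hp (by ring) (by ring) Hr
      (h.k.e0 _ b0 (by omega)) (h.k.e1 _ b0 (by omega)) (h.k.e2 _ b0 (by omega)) ea0 ea1 ea2
  have ZM := fun (b0 : 0 ≤ j - 1) (b1 : j - 1 ≤ N - a) =>
    wM q (s*t2) (s*t0) c0 c1 c2 c3 c4 u v N (N-j) (j-1) j i hq h0 h1 h2 h3 h4 h.g.hst h.g.hst2 h.k.hst h.k.hst2 h.hp (by ring) (by ring) Hu Hv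
      (h.k.e0 _ b0 (by omega)) (h.k.e1 _ b0 (by omega)) (h.k.e2 _ b0 (by omega))
  have YP := fun (b0 : 0 ≤ j + 1) (b1 : j + 1 ≤ N - a) =>
    cP q (s*t2) (s*t0) c0 c1 c2 c3 c4 r N (N-j-1) (j+1) j a hq h0 h1 h2 h3 h4 h.g.hst h.g.hst2 h.k.hst h.k.hst2 h.hp (by ring) (by ring) Hr
      (h.k.e0 _ b0 (by omega)) (h.k.e1 _ b0 (by omega)) (h.k.e2 _ b0 (by omega)) ea0 ea1 ea2
  have ZP := fun (b0 : 0 ≤ j + 1) (b1 : j + 1 ≤ N - a) =>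
    wP q (s*t2) (s*t0) c0 c1 c2 c3 c4 u v N (N-j-1) (j+1) j i hq h0 h1 h2 h3 h4 h.g.hst h.g.hst2 h.k.hst h.k.hst2 h.hp (by ring) (by ring) Hu Hv
      (h.k.e0 _ b0 (by omega)) (h.k.e1 _ b0 (by omega)) (h.k.e2 _ b0 (by omega))
  have YZ :=
    cZ q (s*t2) (s*t0) c0 c1 c2 c3 c4 r N (N-j) j a hq h0 h1 h2 h3 h4 h.g.hst h.g.hst2 h.k.hst h.k.hst2 h.hp (by ring) Hr
      (h.k.e0 _ hj (by omega)) (h.k.e1 _ hj (by omega)) (h.k.e2 _ hj (by omega)) ea0 ea1 ea2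
  have YZ0 :=
    cZ0 q (s*t2) (s*t0) c0 c1 c2 c3 c4 r N (N-j) j a hq h0 h1 h2 h3 h4 h.g.hst h.g.hst2 h.k.hst h.k.hst2 h.hp (by ring) Hr
      (h.k.e0 _ hj (by omega)) (h.k.e1 _ hj (by omega)) (h.k.e2 _ hj (by omega)) ea0 ea1 ea2
  have ZZ :=
    wZ q (s*t2) (s*t0) c0 c1 c2 c3 c4 u v N (N-j) j i hq h0 h1 h2 h3 h4 h.g.hst h.g.hst2 h.k.hst h.k.hst2 h.hp (by ring) Hu Hv
      (h.k.e0 _ hj (by omega)) (h.k.e1 _ hj (by omega)) (h.k.e2 _ hj (by omega))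
  have ZZ0 :=
    wZ0 q (s*t2) (s*t0) c0 c1 c2 c3 c4 u v N (N-j) j i hq h0 h1 h2 h3 h4 h.g.hst h.g.hst2 h.k.hst h.k.hst2 h.hp (by ring) Hu Hv
      (h.k.e0 _ hj (by omega)) (h.k.e1 _ hj (by omega)) (h.k.e2 _ hj (by omega))
      (h.g.e0 _ hi (by omega)) (h.g.e1 _ hi (by omega)) (h.g.e2 _ hi (by omega))
  -- the three families
  have FM : p q s c3 c0 c4 t0 (N-a) (j-1) y * (
      -(r*q*q^a)*(-c4*q^((N:ℤ)+1)*Fm q c1 c2 a*PhiMm q (s*t0) c3 c0 c4 (N-a) (j-1)) * p q s c1 c2 c3 t2 (N-j) i (a+1)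
      + c4*q^((N:ℤ)+1)*FF q c1 c2 a*PhiM q c3 c0 c4 (N-a) (j-1) * p q s c1 c2 c3 t2 (N-j) i a
      + -(r*q^a)⁻¹*(-c4*q^((N:ℤ)+1)*Fp q c1 c2 a*PhiPm q (s*t0) c3 c0 c4 (N-a) (j-1)) * p q s c1 c2 c3 t2 (N-j) i (a-1)) =
      p q s c3 c0 c4 t0 (N-a) (j-1) y * (
      -(u*q^i*q)/(-(v*q^j)⁻¹)*(-c4*q^((N:ℤ)+1)*Fp q c3 c2 (i+1)*PhiPm q (s*t0) c1 c0 c4 (N-(i+1)) (j-1)) * p q s c1 c2 c3 t2 (N-j+1) (i+1) a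
      + 1/(-(v*q^j)⁻¹)*(c4*q^((N:ℤ)+1)*FF q c3 c2 i*PhiM q c1 c0 c4 (N-i) (j-1)) * p q s c1 c2 c3 t2 (N-j+1) i a
      + -(u*q^i)⁻¹/(-(v*q^j)⁻¹)*(-c4*q^((N:ℤ)+1)*Fm q c3 c2 (i-1)*PhiMm q (s*t0) c1 c0 c4 (N-(i-1)) (j-1)) * p q s c1 c2 c3 t2 (N-j+1) (i-1) a) := by
    by_cases hc : 0 ≤ j - 1 ∧ j - 1 ≤ N - a
    · obtain ⟨z1, z2, z3⟩ := YM hc.1 hc.2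
      obtain ⟨w1, w2, w3⟩ := ZM hc.1 hc.2
      rw [z1, z2, z3, w1, w2, w3]
      linear_combination p q s c3 c0 c4 t0 (N-a) (j-1) y * (-c4*q^((N:ℤ)+(j-1)+3)*Fm q c4 c0 (j-1)) * EM' h.g (N-j) i a (by omega) hi (by omega) ha (by omega)
    · rw [p_out q s c3 c0 c4 t0 (N-a) (j-1) y (by omega)]; ring
  have FP : p q s c3 c0 c4 t0 (N-a) (j+1) y * (
      -(r*q*q^a)*(-c4*q^((N:ℤ)+1)*Fm q c1 c2 a*PhiMp q (s*t0) c3 c0 c4 (N-a) (j+1)) * p q s c1 c2 c3 t2 (N-j) i (a+1)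
      + c4*q^((N:ℤ)+1)*FF q c1 c2 a*PhiP q c3 c0 c4 (N-a) (j+1) * p q s c1 c2 c3 t2 (N-j) i a
      + -(r*q^a)⁻¹*(-c4*q^((N:ℤ)+1)*Fp q c1 c2 a*PhiPp q (s*t0) c3 c0 c4 (N-a) (j+1)) * p q s c1 c2 c3 t2 (N-j) i (a-1)) =
      p q s c3 c0 c4 t0 (N-a) (j+1) y * (
      -(u*q^i*q)/(-(v*q^j*q))*(-c4*q^((N:ℤ)+1)*Fp q c3 c2 (i+1)*PhiPp q (s*t0) c1 c0 c4 (N-(i+1)) (j+1)) * p q s c1 c2 c3 t2 (N-j-1) (i+1) a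
      + 1/(-(v*q^j*q))*(c4*q^((N:ℤ)+1)*FF q c3 c2 i*PhiP q c1 c0 c4 (N-i) (j+1)) * p q s c1 c2 c3 t2 (N-j-1) i a
      + -(u*q^i)⁻¹/(-(v*q^j*q))*(-c4*q^((N:ℤ)+1)*Fm q c3 c2 (i-1)*PhiMp q (s*t0) c1 c0 c4 (N-(i-1)) (j+1)) * p q s c1 c2 c3 t2 (N-j-1) (i-1) a) := by
    by_cases hc : 0 ≤ j + 1 ∧ j + 1 ≤ N - a
    · obtain ⟨z1, z2, z3⟩ := YP hc.1 hc.2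
      obtain ⟨w1, w2, w3⟩ := ZP hc.1 hc.2
      rw [z1, z2, z3, w1, w2, w3]
      have e := EP' h.g (N-j-1) i a (by omega) hi (by omega) ha (by omega)
      rw [sub_add_cancel] at e
      linear_combination p q s c3 c0 c4 t0 (N-a) (j+1) y * (-q^((N:ℤ)+2-(j+1))/c0*Fp q c4 c0 (j+1)) * e
    · rw [p_out q s c3 c0 c4 t0 (N-a) (j+1) y (by omega)]; ring
  have FZ : p q s c3 c0 c4 t0 (N-a) j y * (
      -(r*q*q^a)*(-c4*q^((N:ℤ)+1)*Fm q c1 c2 a*PhiM0 q (s*t0) c3 c0 c4 (N-a) j) * p q s c1 c2 c3 t2 (N-j) i (a+1)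
      + (c4*q^((N:ℤ)+1)*(FF q c1 c2 a*(-PhiP q c3 c0 c4 (N-a) j - PhiM q c3 c0 c4 (N-a) j) + (Fp q c1 c2 a * lamP q c3 c0 c4 (N-a) 0 + Fm q c1 c2 a * lamM q c3 c0 c4 (N-a) 0))) * p q s c1 c2 c3 t2 (N-j) i a
      + -(r*q^a)⁻¹*(-c4*q^((N:ℤ)+1)*Fp q c1 c2 a*PhiP0 q (s*t0) c3 c0 c4 (N-a) j) * p q s c1 c2 c3 t2 (N-j) i (a-1)) =
      p q s c3 c0 c4 t0 (N-a) j y * (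
      -(u*q^i*q)/1*(-c4*q^((N:ℤ)+1)*Fp q c3 c2 (i+1)*PhiP0 q (s*t0) c1 c0 c4 (N-(i+1)) j) * p q s c1 c2 c3 t2 (N-j) (i+1) a
      + (c4*q^((N:ℤ)+1)*FF q c3 c2 i*(-PhiP q c1 c0 c4 (N-i) j - PhiM q c1 c0 c4 (N-i) j) + c4*q^((N:ℤ)+1)*(Fp q c3 c2 i * lamP q c1 c0 c4 (N-i) 0 + Fm q c3 c2 i * lamM q c1 c0 c4 (N-i) 0)) * p q s c1 c2 c3 t2 (N-j) i a
      + -(u*q^i)⁻¹/1*(-c4*q^((N:ℤ)+1)*Fm q c3 c2 (i-1)*PhiM0 q (s*t0) c1 c0 c4 (N-(i-1)) j) * p q s c1 c2 c3 t2 (N-j) (i-1) a) := by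
    rcases le_or_gt j (N-a) with hc | hc
    · rw [YZ.1, YZ.2, YZ0, ZZ0, ZZ.1, ZZ.2]
      linear_combination p q s c3 c0 c4 t0 (N-a) j y * (-q^((N:ℤ)+2)*FF q c0 c4 j) * EZ' h.g (N-j) i a (by omega) hi (by omega) ha (by omega)
    · rw [p_out q s c3 c0 c4 t0 (N-a) j y (by omega)]; ring
  rw [kp, km]
  have l1' : -(-c4*q^((N:ℤ)+1)*Fp q c1 c2 a*lamP q c3 c0 c4 (N-a) y) - (-c4*q^((N:ℤ)+1)*Fm q c1 c2 a*lamM q c3 c0 c4 (N-a) y) =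
      c4*q^((N:ℤ)+1)*(FF q c1 c2 a * lam q (c3*c0) y + (Fp q c1 c2 a * lamP q c3 c0 c4 (N-a) 0 + Fm q c1 c2 a * lamM q c3 c0 c4 (N-a) 0)) := by
    rw [l1, l2, FF]; ring
  rw [l1']
  clear kp km l1 l2 l1' YM ZM YP ZP YZ YZ0 ZZ ZZ0 Hr Hu Hv
  generalize q ^ ((N:ℤ)+1) = Qq at *
  linear_combination (-(r*q^a)⁻¹*(-c4*Qq*Fp q c1 c2 a)) * X1 + (-(r*q*q^a)*(-c4*Qq*Fm q c1 c2 a)) * X2 + c4*Qq*FF q c1 c2 a * X0 + FM + FP + FZ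

theorem byparts (f P a b : ℤ → ℂ) (K : ℕ) (l : ℂ) (h1 : f (-1) = 0) (h2 : P (K+1) = 0) (h3 : P (-1) = 0) (h4 : b K = 0)
    (hl : ∀ n : ℕ, n < K + 1 → l * P n = a (n+1) * P (n+1) + (-a n - b n) * P n + b (n-1) * P (n-1)) :
    l * ∑ n ∈ Finset.range (K+1), f n * P n = ∑ n ∈ Finset.range (K+1), (a n * f (n-1) + (-a n - b n) * f n + b n * f (n+1)) * P n := by
  have t1 := Finset.sum_range_sub (fun n : ℕ => f ((n:ℤ)-1) * a n * P n) (K+1)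
  have t2 := Finset.sum_range_sub (fun n : ℕ => f n * b ((n:ℤ)-1) * P ((n:ℤ)-1)) (K+1)
  simp only [Nat.cast_add, Nat.cast_one, Nat.cast_zero, zero_sub, h1, h2, h3, add_sub_cancel_right, h4, mul_zero, zero_mul, sub_zero] at t1 t2
  rw [Finset.mul_sum, ← sub_eq_zero, ← Finset.sum_sub_distrib]
  rw [← sub_eq_zero.2 (t1.trans t2.symm), ← Finset.sum_sub_distrib]
  apply Finset.sum_congr rfl
  intro n hn
  have := hl n (Finset.mem_range.1 hn)
  linear_combination f n * this

end qR

/-- Recurrence relations of the Griffiths polynomials of q-Racah type. -/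
theorem griffiths_recurrences
    (N : ℕ) (q s c1 c2 c3 c4 c0 t1 t2 t3 t4 t0 : ℂ)
    (hq : q ≠ 0) (hc1 : c1 ≠ 0) (hc2 : c2 ≠ 0) (hc3 : c3 ≠ 0) (hc4 : c4 ≠ 0)
    (hs : s ^ 2 = q) (ht1 : t1 ^ 2 = c1) (ht2 : t2 ^ 2 = c2) (ht3 : t3 ^ 2 = c3)
    (ht4 : t4 ^ 2 = c4)
    (hc0 : c0 = (q ^ (2 * (N : ℤ) + 3) * c1 * c2 * c3 * c4)⁻¹)
    (ht0 : t0 = (s ^ (2 * (N : ℤ) + 3) * t1 * t2 * t3 * t4)⁻¹)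
    (hgen : ∀ e0 e1 e2 e3 e4 : ℕ, e0 ≤ 1 → e1 ≤ 1 → e2 ≤ 1 → e3 ≤ 1 → e4 ≤ 1 →
      1 ≤ e0 + e1 + e2 + e3 + e4 → e0 + e1 + e2 + e3 + e4 ≤ 4 →
      ∀ k : ℤ, 0 ≤ k → k ≤ 2 * (N : ℤ) + 5 →
        c0 ^ e0 * c1 ^ e1 * c2 ^ e2 * c3 ^ e3 * c4 ^ e4 ≠ q ^ (-k))
    (hq1 : ∀ k : ℕ, 1 ≤ k → k ≤ N → q ^ k ≠ 1)
    (i j x y : ℕ) (hij : i + j ≤ N) (hxy : x + y ≤ N) :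
    (qR.lam q (c3 * c0) (y : ℤ)
          * qR.G q s c1 c2 c3 c4 t1 t2 t3 t4 (N : ℤ) (i : ℤ) (j : ℤ) (x : ℤ) (y : ℤ)
        = ∑ ε ∈ ({-1, 0, 1} : Finset ℤ), ∑ ε' ∈ ({-1, 0, 1} : Finset ℤ),
            qR.A q s c1 c2 c3 c4 t2 (N : ℤ) ε ε' ((i : ℤ) + ε) ((j : ℤ) + ε')
              * qR.G q s c1 c2 c3 c4 t1 t2 t3 t4 (N : ℤ) ((i : ℤ) + ε) ((j : ℤ) + ε')
                  (x : ℤ) (y : ℤ))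
    ∧
    (qR.lam q (c4 * c2) (x : ℤ)
          * qR.G q s c1 c2 c3 c4 t1 t2 t3 t4 (N : ℤ) (i : ℤ) (j : ℤ) (x : ℤ) (y : ℤ)
        = ∑ ε ∈ ({-1, 0, 1} : Finset ℤ), ∑ ε' ∈ ({-1, 0, 1} : Finset ℤ),
            qR.om q (q ^ i * t2 * t3 * t4 / t1) ε / qR.om q (q ^ j * t0 * t3 * t4 / t1) ε'
              * qR.A q s c1 c0 c4 c3 t0 (N : ℤ) ε' ε ((j : ℤ) + ε') ((i : ℤ) + ε)
              * qR.G q s c1 c2 c3 c4 t1 t2 t3 t4 (N : ℤ) ((i : ℤ) + ε) ((j : ℤ) + ε')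
                  (x : ℤ) (y : ℤ)) := by
  have h0 : c0 ≠ 0 := by
    rw [hc0]; exact inv_ne_zero (by have := qR.z_ne hq (2*(N:ℤ)+3); simp [*])
  have hg : ∀ e0 e1 e2 e3 e4 : ℕ, (e0 ≤ 1 ∧ e1 ≤ 1 ∧ e2 ≤ 1 ∧ e3 ≤ 1 ∧ e4 ≤ 1 ∧
      1 ≤ e0 + e1 + e2 + e3 + e4 ∧ e0 + e1 + e2 + e3 + e4 ≤ 4) →
      ∀ k : ℕ, k ≤ 2 * N + 5 → 1 - c0 ^ e0 * c1 ^ e1 * c2 ^ e2 * c3 ^ e3 * c4 ^ e4 * q ^ k ≠ 0 := by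
    rintro e0 e1 e2 e3 e4 ⟨a0, a1, a2, a3, a4, b0, b1⟩ k hk e
    refine hgen e0 e1 e2 e3 e4 a0 a1 a2 a3 a4 b0 b1 k (by omega) (by omega) ?_
    rw [zpow_neg, zpow_natCast]
    have := pow_ne_zero k hq
    field_simp
    linear_combination -e
  have hk : ∀ k : ℕ, 1 ≤ k → k ≤ N → 1 - q ^ k ≠ 0 := fun k a b e => hq1 k a b (by linear_combination -e)
  have hs0 : s ≠ 0 := by rintro rfl; exact hq (by rw [← hs]; norm_num)
  have y1 : t1 ≠ 0 := by rintro rfl; exact hc1 (by rw [← ht1]; norm_num)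
  have y2 : t2 ≠ 0 := by rintro rfl; exact hc2 (by rw [← ht2]; norm_num)
  have y3 : t3 ≠ 0 := by rintro rfl; exact hc3 (by rw [← ht3]; norm_num)
  have y4 : t4 ≠ 0 := by rintro rfl; exact hc4 (by rw [← ht4]; norm_num)
  have hQ := qR.z_ne hq (N:ℤ)
  have hpow : q ^ (2 * (N:ℤ) + 3) = (q ^ (N:ℤ)) ^ 2 * q ^ 3 := by
    rw [zpow_add₀ hq, two_mul, zpow_add₀ hq, zpow_ofNat]; ring
  have spow : s ^ (2 * (N:ℤ) + 3) = q ^ (N:ℤ) * q * s := by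
    rw [zpow_add₀ hs0, zpow_mul, zpow_ofNat, zpow_ofNat, hs, ← hs]; ring
  have hp : c0 * c1 * c2 * c3 * c4 * (q ^ (N:ℤ)) ^ 2 * q ^ 3 = 1 := by
    rw [hc0, hpow]; field_simp
  have ht : t0 * t1 * t2 * t3 * t4 * q ^ (N:ℤ) * q * s = 1 := by
    rw [ht0, spow]; field_simp
  have ht00 : t0 ^ 2 = c0 := by
    have : c1 * c2 * c3 * c4 * (q ^ (N:ℤ)) ^ 2 * q ^ 3 ≠ 0 := by simp [*]
    apply mul_right_cancel₀ this
    have e : t0^2*(t1^2*t2^2*t3^2*t4^2*(q ^ (N:ℤ))^2*q^2*s^2) = 1 := by linear_combination (t0 * t1 * t2 * t3 * t4 * q ^ (N:ℤ) * q * s + 1) * ht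
    rw [ht1, ht2, ht3, ht4, hs] at e
    linear_combination e - hp
  have C : qR.Ctx q s c1 c2 c3 c4 c0 t1 t2 t3 t4 t0 N := by
    refine ⟨⟨hq, hs, ht2, hc1, hc2, hc3, hk, ?_, ?_, ?_, ?_, ?_, ?_⟩, ⟨hq, hs, ht00, hc3, h0, hc4, hk, ?_, ?_, ?_, ?_, ?_, ?_⟩,
      ⟨hq, hs, ht2, hc4, hc2, hc1, hk, ?_, ?_, ?_, ?_, ?_, ?_⟩, hp, ht, ht1, ht3, ht4, hc0.symm, ?_, ?_⟩
    · intro k hk; simpa using hg 0 1 0 0 0 (by decide) k hk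
    · intro k hk; simpa using hg 0 0 1 0 0 (by decide) k hk
    · intro k hk; simpa using hg 0 0 0 1 0 (by decide) k hk
    · intro k hk; simpa using hg 0 1 1 0 0 (by decide) k hk
    · intro k hk; simpa using hg 0 0 1 1 0 (by decide) k hk
    · intro k hk; simpa using hg 0 1 1 1 0 (by decide) k hk
    · intro k hk; simpa using hg 0 0 0 1 0 (by decide) k hk
    · intro k hk; simpa using hg 1 0 0 0 0 (by decide) k hk
    · intro k hk; simpa using hg 0 0 0 0 1 (by decide) k hk
    · intro k hk; rw [mul_comm c3 c0]; simpa using hg 1 0 0 1 0 (by decide) k hk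
    · intro k hk; simpa using hg 1 0 0 0 1 (by decide) k hk
    · intro k hk; rw [mul_comm c3 c0]; simpa using hg 1 0 0 1 1 (by decide) k hk
    · intro k hk; simpa using hg 0 0 0 0 1 (by decide) k hk
    · intro k hk; simpa using hg 0 0 1 0 0 (by decide) k hk
    · intro k hk; simpa using hg 0 1 0 0 0 (by decide) k hk
    · intro k hk; rw [mul_comm c4 c2]; simpa using hg 0 0 1 0 1 (by decide) k hk
    · intro k hk; rw [mul_comm c2 c1]; simpa using hg 0 1 1 0 0 (by decide) k hk
    · intro k hk; rw [show c4 * c2 * c1 = c1 * c2 * c4 by ring]; simpa using hg 0 1 1 0 1 (by decide) k hk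
    · rw [hpow]
      apply inv_eq_of_mul_eq_one_right
      linear_combination hp
    · intro k hk0 hk1
      lift k to ℕ using hk0
      rw [zpow_natCast, mul_comm c1 c0]
      simpa using hg 1 1 0 0 0 (by decide) k (by omega)
  have hG := fun i j : ℤ => qR.G_eq hc0.symm ht0.symm i j x y (show y ≤ N by omega)
  simp only [hG]
  constructor
  · simp only [Finset.mul_sum]
    rw [Finset.sum_comm_cycle]
    apply Finset.sum_congr rfl
    intro a ha
    have ha := Finset.mem_range.1 ha
    have e := qR.partI C i j a y (by omega) (by omega) (by omega) (by omega) (by omega)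
    rw [show ∀ a b c d : ℂ, a * (b * c * d) = (a * c) * (b * d) by intros; ring, e, Finset.sum_mul]
    apply Finset.sum_congr rfl
    intro ε _
    rw [Finset.sum_mul]
    apply Finset.sum_congr rfl
    intro ε' _
    ring
  · have hr0 : t1 * t2 * t3 / t4 ≠ 0 := by simp [*]
    have B := qR.byparts (fun a => qR.om q (t1 * t2 * t3 / t4) a * qR.TT q s c1 c2 c3 c4 c0 t2 t0 N i j a y)
      (fun a => qR.p q s c4 c2 c1 t2 (N-y) a x) (fun a => qR.PhiP q c4 c2 c1 (N-y) a) (fun a => qR.PhiM q c4 c2 c1 (N-y) a) (N-y)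
      (qR.lam q (c4*c2) x) (by simp only [qR.TT]; rw [qR.p_out q s c1 c2 c3 t2 _ _ _ (by omega)]; ring) (qR.p_out _ _ _ _ _ _ _ _ _ (by omega))
      (qR.p_out _ _ _ _ _ _ _ _ _ (by omega)) (by rw [Nat.cast_sub (by omega)]; exact qR.PhiM_self _ _ _ _ _)
      (by intro n hn; exact qR.Rp C.r (N-y) n x (by omega) (by omega) (by omega))
    rw [B]
    simp only [Finset.mul_sum]
    rw [Finset.sum_comm_cycle]
    apply Finset.sum_congr rfl
    intro a ha
    have ha := Finset.mem_range.1 ha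
    have e := qR.partII C rfl rfl rfl i j a y (by omega) (by omega) (by omega) (by omega) (by omega) (by omega)
    rw [qR.om_succ hq hr0, qR.om_pred hq hr0]
    trans (qR.om q (t1 * t2 * t3 / t4) a * qR.p q s c4 c2 c1 t2 (N-y) a x) * (∑ ε ∈ ({-1, 0, 1} : Finset ℤ), ∑ ε' ∈ ({-1, 0, 1} : Finset ℤ), qR.om q (t2 * t3 * t4 / t1*q^(i:ℤ)) ε / qR.om q (t0 * t3 * t4 / t1*q^(j:ℤ)) ε' *
      qR.A q s c1 c0 c4 c3 t0 N ε' ε (j+ε') (i+ε) * qR.TT q s c1 c2 c3 c4 c0 t2 t0 N (i+ε) (j+ε') a y)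
    · rw [← e]; ring
    rw [Finset.mul_sum]
    apply Finset.sum_congr rfl
    intro ε _
    rw [Finset.mul_sum]
    apply Finset.sum_congr rfl
    intro ε' _
    rw [zpow_natCast, zpow_natCast, show t2 * t3 * t4 / t1 * q ^ i = q ^ i * t2 * t3 * t4 / t1 by ring, show t0 * t3 * t4 / t1 * q ^ j = q ^ j * t0 * t3 * t4 / t1 by ring]
    ring
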